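/- Suppose the wall motion f satisfies f̈(t) < −g for all t ∈ (0,1), where g is the gravitational constant. Then the limit map F̃∞ is ergodic with respect to the normalized Lebesgue measure μ̃ on the torus 𝕋 = (ℝ/ℤ) × (ℝ/gℤ). -/

import Mathlib

open MeasureTheory Filter Set

/-- The limit map `F̃∞` on the torus `(ℝ/ℤ) × (ℝ/gℤ)`, modeled on the fundamental
domain `[0,1) × [0,g)`:
`F̃∞(t̃, ṽ) = (t̃ + 2ṽ/g mod 1, ṽ + 2ḟ(t̃ + 2ṽ/g) mod g)`. -/
noncomputable def limitTorusMap (f : ℝ → ℝ) (g : ℝ) : ℝ × ℝ → ℝ × ℝ :=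
  fun p =>
    (Int.fract (p.1 + 2 * p.2 / g),
     g * Int.fract ((p.2 + 2 * deriv f (Int.fract (p.1 + 2 * p.2 / g))) / g))

/-- The normalized Lebesgue measure `μ̃ = dt̃ dṽ` on the torus, modeled as the
normalized restriction of Lebesgue measure to the fundamental domain `[0,1) × [0,g)`. -/
noncomputable def torusMeasure (g : ℝ) : Measure (ℝ × ℝ) :=
  (ENNReal.ofReal g)⁻¹ • (volume.restrict (Set.Ico (0 : ℝ) 1 ×ˢ Set.Ico (0 : ℝ) g))


namespace BB

structure Sys where
  φ : ℝ → ℝ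
  β : ℝ → ℝ
  α : ℝ → ℝ
  A : ℝ
  L : ℝ
  meas : Measurable φ
  per : ∀ x, φ (x + 1) = φ x + 2
  br : ∀ x, 0 < x → x < 1 → φ x = β x
  der : ∀ x, HasDerivAt β (-α x) x
  two : ∀ x, 2 ≤ α x
  leA : ∀ x, α x ≤ A
  lip : ∀ x y, |α x - α y| ≤ L * |x - y|
  good : ∀ c, 0 < c → c < 1 / 2 → ∃ ε > 0, ∀ x, c ≤ x → x ≤ 1 - c → 2 + ε ≤ α x

variable (S : Sys)

theorem Sys.L_nonneg : 0 ≤ S.L := by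
  have := S.lip 1 0
  simp at this
  exact (abs_nonneg _).trans this

theorem Sys.A_ge : 2 ≤ S.A := (S.two 0).trans (S.leA 0)

theorem Sys.mean_lt (x y : ℝ) (h : x < y) :
    ∃ ζ, x < ζ ∧ ζ < y ∧ S.β x - S.β y = -S.α ζ * (x - y) := by
  obtain ⟨ζ, hζ, h2⟩ := exists_hasDerivAt_eq_slope S.β (fun z => -S.α z) h
    (fun z _ => (S.der z).continuousAt.continuousWithinAt) (fun z _ => S.der z)
  refine ⟨ζ, hζ.1, hζ.2, ?_⟩
  rw [h2]
  have : y - x ≠ 0 := by linarith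
  field_simp
  ring

theorem Sys.mean (x y : ℝ) :
    ∃ ζ, |ζ - x| ≤ |x - y| ∧ S.β x - S.β y = -S.α ζ * (x - y) := by
  rcases lt_trichotomy x y with h | h | h
  · obtain ⟨ζ, h1, h2, h3⟩ := S.mean_lt x y h
    refine ⟨ζ, ?_, h3⟩
    rw [abs_of_pos (by linarith), abs_of_neg (by linarith)]; linarith
  · subst h; exact ⟨x, by simp, by simp⟩
  · obtain ⟨ζ, h1, h2, h3⟩ := S.mean_lt y x h
    refine ⟨ζ, ?_, by linarith⟩
    rw [abs_of_neg (by linarith), abs_of_pos (by linarith)]; linarith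

theorem Sys.β_cont : Continuous S.β :=
  continuous_iff_continuousAt.2 fun z => (S.der z).continuousAt

/-- branch `k` -/
noncomputable def Sys.bb (k : ℤ) (y : ℝ) : ℝ := S.β (y - k) + 2 * k

theorem Sys.bb_cont (k : ℤ) : Continuous (S.bb k) := by
  unfold Sys.bb
  have := S.β_cont
  fun_prop

theorem Sys.per_int (n : ℤ) (x : ℝ) : S.φ (x + n) = S.φ x + 2 * n := by
  induction n using Int.induction_on with
  | zero => simp
  | succ i ih =>
    push_cast at ih ⊢
    rw [← add_assoc, S.per, ih]; ring
  | pred i ih =>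
    push_cast at ih ⊢
    have := S.per (x + (-(i:ℝ) - 1))
    have e : x + (-(i:ℝ) - 1) + 1 = x + -(i:ℝ) := by ring
    rw [e, ih] at this
    linarith

theorem Sys.φ_eq (k : ℤ) (x : ℝ) (h1 : (k:ℝ) < x) (h2 : x < k + 1) : S.φ x = S.bb k x := by
  have := S.per_int k (x - k)
  rw [sub_add_cancel] at this
  rw [this, S.br _ (by linarith) (by linarith)]
  rfl

theorem Sys.φ_contAt (k : ℤ) (x : ℝ) (h1 : (k:ℝ) < x) (h2 : x < k + 1) : ContinuousAt S.φ x := by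
  have : S.φ =ᶠ[nhds x] S.bb k := by
    filter_upwards [Ioo_mem_nhds h1 h2] with y hy
    exact S.φ_eq k y hy.1 hy.2
  exact (S.bb_cont k).continuousAt.congr this.symm

/-- difference of a branch -/
theorem Sys.bb_diff (k : ℤ) (x y : ℝ) :
    ∃ m, 2 ≤ m ∧ m ≤ S.A ∧ S.bb k x - S.bb k y = - m * (x - y) ∧
      |m - S.α (x - k)| ≤ S.L * |x - y| ∧
      (∀ c ε, (∀ z, c / 2 ≤ z → z ≤ 1 - c / 2 → 2 + ε ≤ S.α z) → k + c ≤ x → x ≤ k + 1 - c →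
        |x - y| ≤ c / 2 → 2 + ε ≤ m) := by
  obtain ⟨ζ, h1, h2⟩ := S.mean (x - k) (y - k)
  have e : x - (k:ℝ) - (y - k) = x - y := by ring
  rw [e] at h1 h2
  refine ⟨S.α ζ, S.two _, S.leA _, ?_, ?_, ?_⟩
  · unfold Sys.bb; linarith
  · refine (S.lip _ _).trans ?_
    exact mul_le_mul_of_nonneg_left h1 S.L_nonneg
  · intro c ε hc hx1 hx2 hxy
    have := abs_le.1 (h1.trans hxy)
    exact hc _ (by linarith) (by linarith)

/-! sequences -/

noncomputable def Sys.X (p : ℝ × ℝ) : ℕ → ℝ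
  | 0 => p.1
  | 1 => p.2
  | (n + 2) => S.φ (Sys.X p (n + 1)) - Sys.X p n

noncomputable def Sys.ext (k : ℕ → ℤ) (a b : ℝ) : ℕ → ℝ
  | 0 => a
  | 1 => b
  | (n + 2) => S.bb (k (n + 1)) (Sys.ext k a b (n + 1)) - Sys.ext k a b n

theorem Sys.X_succ2 (p n) : S.X p (n + 2) = S.φ (S.X p (n + 1)) - S.X p n := rfl
theorem Sys.ext_succ2 (k a b n) :
    S.ext k a b (n + 2) = S.bb (k (n + 1)) (S.ext k a b (n + 1)) - S.ext k a b n := rfl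

theorem Sys.ext_cont (k : ℕ → ℤ) (a : ℝ) : ∀ n, Continuous (fun b => S.ext k a b n)
  | 0 => continuous_const
  | 1 => continuous_id
  | (n + 2) => by
    have h1 := Sys.ext_cont k a (n + 1)
    have h2 := Sys.ext_cont k a n
    exact ((S.bb_cont _).comp h1).sub h2

/-- `x` lies strictly in the `k`-th cell -/
def Cell (k : ℤ) (x : ℝ) : Prop := (k:ℝ) < x ∧ x < k + 1

/-- recurrence with floors `k` -/
def Sys.Rec (k : ℕ → ℤ) (x : ℕ → ℝ) : Prop :=
  ∀ n, x (n + 2) = S.bb (k (n + 1)) (x (n + 1)) - x n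

theorem Sys.rec_X (k : ℕ → ℤ) (p) (h : ∀ n, Cell (k (n + 1)) (S.X p (n + 1))) :
    S.Rec k (S.X p) := by
  intro n
  rw [S.X_succ2, S.φ_eq _ _ (h n).1 (h n).2]

theorem Sys.eq_X_of_rec (k : ℕ → ℤ) (x : ℕ → ℝ) (hx : S.Rec k x)
    (h : ∀ n, Cell (k (n + 1)) (x (n + 1))) : x = S.X (x 0, x 1) := by
  have : ∀ n, x n = S.X (x 0, x 1) n ∧ x (n + 1) = S.X (x 0, x 1) (n + 1) := by
    intro n
    induction n with
    | zero => exact ⟨rfl, rfl⟩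
    | succ n ih =>
      refine ⟨ih.2, ?_⟩
      rw [S.X_succ2, hx n, ← ih.1, ← ih.2, S.φ_eq _ _ (h n).1 (h n).2]
  exact funext fun n => (this n).1

/-- convex growth -/
theorem grow (E : ℕ → ℝ) (N : ℕ)
    (h : ∀ n < N, ∃ m ≥ (2:ℝ), E (n + 2) = m * E (n + 1) - E n) (h0 : 0 ≤ E 0) (h1 : E 0 ≤ E 1) :
    ∀ n ≤ N, 0 ≤ E n ∧ E n ≤ E (n + 1) ∧ E 1 - E 0 ≤ E (n + 1) - E n := by
  intro n hn
  induction n with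
  | zero => exact ⟨h0, h1, le_refl _⟩
  | succ n ih =>
    obtain ⟨a1, a2, a3⟩ := ih (by omega)
    obtain ⟨m, hm, e⟩ := h n (by omega)
    have : 2 * E (n + 1) ≤ m * E (n + 1) := by
      apply mul_le_mul_of_nonneg_right hm; linarith
    refine ⟨by linarith, ?_, ?_⟩ <;> rw [show n + 1 + 1 = n + 2 from rfl, e] <;> linarith

theorem grow_le (E : ℕ → ℝ) (N : ℕ)
    (h : ∀ n < N, ∃ m ≥ (2:ℝ), E (n + 2) = m * E (n + 1) - E n) (h0 : 0 = E 0) (h1 : E 0 ≤ E 1) :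
    ∀ n ≤ N, E n ≤ n * (E (n + 1) - E n) := by
  intro n hn
  induction n with
  | zero => simp [← h0]
  | succ n ih =>
    have ih := ih (by omega)
    obtain ⟨a1, a2, a3⟩ := grow E N h h0.le h1 n (by omega)
    obtain ⟨m, hm, e⟩ := h n (by omega)
    have : 2 * E (n + 1) ≤ m * E (n + 1) := by
      apply mul_le_mul_of_nonneg_right hm; linarith
    rw [show n + 1 + 1 = n + 2 from rfl, e]
    have b : E (n+1) - E n ≤ m * E (n + 1) - E n - E (n + 1) := by linarith
    have c : ((n:ℝ) + 1) * (E (n+1) - E n) ≤ ((n:ℝ) + 1) * (m * E (n + 1) - E n - E (n + 1)) :=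
      mul_le_mul_of_nonneg_left b (by positivity)
    push_cast
    linarith

/-- bounded solutions decrease -/
theorem bdd_decr (E : ℕ → ℝ) (B : ℝ) (hB : ∀ n, |E (n + 1)| ≤ B)
    (h : ∀ n, ∃ m ≥ (2:ℝ), E (n + 2) = m * E (n + 1) - E n) (h0 : 0 ≤ E 0) :
    ∀ n, 0 ≤ E (n + 1) ∧ E (n + 1) ≤ E n := by
  -- a strictly increasing nonneg start is impossible
  have key : ∀ F : ℕ → ℝ, (∀ n, |F (n + 1)| ≤ B) →
      (∀ n, ∃ m ≥ (2:ℝ), F (n + 2) = m * F (n + 1) - F n) → 0 ≤ F 1 → ¬ F 0 < F 1 := by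
    intro F hF hr h1 hlt
    have hn : ∀ n, F 1 - F 0 ≤ F (n + 1) - F n ∧ 0 ≤ F (n + 1) := by
      intro n
      induction n with
      | zero => exact ⟨le_refl _, h1⟩
      | succ n ih =>
        obtain ⟨m, hm, e⟩ := hr n
        have : 2 * F (n + 1) ≤ m * F (n + 1) := mul_le_mul_of_nonneg_right hm ih.2
        rw [show n + 1 + 1 = n + 2 from rfl, e]
        constructor <;> linarith [ih.1]
    have hn2 : ∀ n : ℕ, n * (F 1 - F 0) ≤ F (n + 1) := by
      intro n
      induction n with
      | zero => simpa using h1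
      | succ n ih =>
        have := (hn (n + 1)).1
        push_cast
        linarith
    obtain ⟨n, hn3⟩ := exists_nat_gt (B / (F 1 - F 0))
    rw [div_lt_iff₀ (by linarith)] at hn3
    have := hn2 n
    have := (abs_le.1 (hF n)).2
    linarith
  intro n
  have shift : ∀ n, (∀ j, |E (n + j + 1)| ≤ B) := fun n j => hB _
  induction n with
  | zero =>
    have hp : 0 ≤ E 1 := by
      by_contra hc
      push Not at hc
      apply key (fun n => - E n) (fun n => by simpa using hB n)
      · intro n; obtain ⟨m, hm, e⟩ := h n; exact ⟨m, hm, by show -E _ = _; rw [e]; ring⟩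
      · show 0 ≤ - E 1; linarith
      · show - E 0 < - E 1; linarith
    refine ⟨hp, ?_⟩
    by_contra hc
    push Not at hc
    exact key E hB h hp hc
  | succ n ih =>
    have hr : ∀ j, ∃ m ≥ (2:ℝ), E (n + 1 + (j + 2)) = m * E (n + 1 + (j + 1)) - E (n + 1 + j) := by
      intro j; obtain ⟨m, hm, e⟩ := h (n + 1 + j); exact ⟨m, hm, e⟩
    have hp : 0 ≤ E (n + 1 + 1) := by
      by_contra hc
      push Not at hc
      apply key (fun j => - E (n + 1 + j)) (fun j => by rw [abs_neg]; exact hB (n + 1 + j))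
      · intro j; obtain ⟨m, hm, e⟩ := hr j; exact ⟨m, hm, by show -E _ = _; rw [e]; ring⟩
      · show 0 ≤ - E (n+1+1); linarith
      · show - E (n+1) < - E (n+1+1); linarith [ih.1]
    refine ⟨hp, ?_⟩
    by_contra hc
    push Not at hc
    exact key (fun j => E (n + 1 + j)) (fun j => hB (n + 1 + j)) hr hp hc

/-- signs -/
def Sgn (σ : ℝ) : Prop := σ = 1 ∨ σ = -1

theorem Sgn.sq {σ : ℝ} (h : Sgn σ) : σ * σ = 1 := by rcases h with h | h <;> rw [h] <;> norm_num
theorem Sgn.abs {σ : ℝ} (h : Sgn σ) : |σ| = 1 := by rcases h with h | h <;> rw [h] <;> norm_num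
theorem Sgn.neg {σ : ℝ} (h : Sgn σ) : Sgn (-σ) := by rcases h with h | h <;> rw [h] <;> simp [Sgn]
theorem Sgn.mul {σ τ : ℝ} (h : Sgn σ) (h2 : Sgn τ) : Sgn (σ * τ) := by
  rcases h with h | h <;> rcases h2 with h2 | h2 <;> rw [h, h2] <;> simp [Sgn]
theorem sgn_pow (n : ℕ) : Sgn ((-1) ^ n) := by
  rcases Nat.even_or_odd n with h | h
  · left; exact h.neg_one_pow
  · right; exact h.neg_one_pow

/-- normalized difference -/
def nd (σ : ℝ) (y x : ℕ → ℝ) (n : ℕ) : ℝ := σ * (-1) ^ n * (y n - x n)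

theorem abs_nd {σ : ℝ} (h : Sgn σ) (y x n) : |nd σ y x n| = |y n - x n| := by
  unfold nd
  rw [abs_mul, (h.mul (sgn_pow n)).abs, one_mul]

theorem nd_inv {σ : ℝ} (h : Sgn σ) (y x n) : y n = x n + σ * (-1) ^ n * nd σ y x n := by
  unfold nd
  have := (h.mul (sgn_pow n)).sq
  linear_combination (-(y n - x n)) * this

theorem Sys.nd_rec (k : ℕ → ℤ) (σ : ℝ) (hσ : Sgn σ) (y x : ℕ → ℝ) (n : ℕ)
    (hy : y (n + 2) = S.bb (k (n + 1)) (y (n + 1)) - y n)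
    (hx : x (n + 2) = S.bb (k (n + 1)) (x (n + 1)) - x n) :
    ∃ m, 2 ≤ m ∧ m ≤ S.A ∧ nd σ y x (n + 2) = m * nd σ y x (n + 1) - nd σ y x n ∧
      |m - S.α (x (n + 1) - k (n + 1))| ≤ S.L * |nd σ y x (n + 1)| ∧
      (∀ c ε, (∀ z, c / 2 ≤ z → z ≤ 1 - c / 2 → 2 + ε ≤ S.α z) → k (n + 1) + c ≤ x (n + 1) →
        x (n + 1) ≤ k (n + 1) + 1 - c → |nd σ y x (n + 1)| ≤ c / 2 → 2 + ε ≤ m) := by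
  obtain ⟨m, h1, h2, h3, h4, h5⟩ := S.bb_diff (k (n + 1)) (x (n + 1)) (y (n + 1))
  rw [abs_nd hσ, abs_sub_comm]
  refine ⟨m, h1, h2, ?_, h4, h5⟩
  unfold nd
  rw [hy, hx, pow_succ, pow_succ]
  linear_combination (-σ * (-1) ^ n) * h3

/-- extended stable leaf -/
theorem Sys.ext_leaf (k : ℕ → ℤ) (x : ℕ → ℝ) (hx : S.Rec k x) (σ : ℝ) (hσ : Sgn σ) (t : ℝ)
    (ht : 0 ≤ t) : ∃ y, S.Rec k y ∧ y 0 = x 0 + σ * t ∧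
      ∀ n, 0 ≤ nd σ y x (n + 1) ∧ nd σ y x (n + 1) ≤ nd σ y x n := by
  set y : ℝ → ℕ → ℝ := fun s => S.ext k (x 0 + σ * t) (x 1 - σ * s) with hy
  have hyr : ∀ s, S.Rec k (y s) := fun s n => S.ext_succ2 _ _ _ _
  have hy0 : ∀ s, nd σ (y s) x 0 = t := by
    intro s
    simp only [hy, nd, Sys.ext]
    have := hσ.sq
    linear_combination t * this
  have hy1 : ∀ s, nd σ (y s) x 1 = s := by
    intro s
    simp only [hy, nd, Sys.ext]
    have := hσ.sq
    linear_combination s * this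
  have hc : ∀ n, Continuous fun s => nd σ (y s) x n := by
    intro n
    unfold nd
    have := S.ext_cont k (x 0 + σ * t) n
    have h2 : Continuous fun s => y s n := this.comp (by fun_prop : Continuous fun s => x 1 - σ * s)
    fun_prop
  have hr : ∀ s n, ∃ m ≥ (2:ℝ), nd σ (y s) x (n + 2) = m * nd σ (y s) x (n + 1) - nd σ (y s) x n := by
    intro s n
    obtain ⟨m, h1, _, h3, _⟩ := S.nd_rec k σ hσ (y s) x n (hyr s n) (hx n)
    exact ⟨m, h1, h3⟩
  set K : ℕ → Set ℝ := fun N => {s | s ∈ Icc 0 t ∧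
    ∀ n ≤ N, 0 ≤ nd σ (y s) x (n + 1) ∧ nd σ (y s) x (n + 1) ≤ nd σ (y s) x n} with hK
  have hKclosed : ∀ N, IsClosed (K N) := by
    intro N
    apply isClosed_Icc.inter
    have : {s | ∀ n ≤ N, 0 ≤ nd σ (y s) x (n + 1) ∧ nd σ (y s) x (n + 1) ≤ nd σ (y s) x n} =
      ⋂ n, ⋂ (_ : n ≤ N), ({s | 0 ≤ nd σ (y s) x (n + 1)} ∩
        {s | nd σ (y s) x (n + 1) ≤ nd σ (y s) x n}) := by
      ext s; simp [Set.mem_iInter]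
    rw [show (fun a => ∀ n ≤ N, 0 ≤ nd σ (y a) x (n + 1) ∧ nd σ (y a) x (n + 1) ≤ nd σ (y a) x n) =
      {s | ∀ n ≤ N, 0 ≤ nd σ (y s) x (n + 1) ∧ nd σ (y s) x (n + 1) ≤ nd σ (y s) x n} from rfl, this]
    exact isClosed_iInter fun n => isClosed_iInter fun _ =>
      (isClosed_le continuous_const (hc _)).inter (isClosed_le (hc _) (hc _))
  have hne : ∀ N, (K N).Nonempty := by
    intro N
    -- find zero of E (N+2)
    have e0 : nd σ (y 0) x (N + 2) ≤ 0 := by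
      have := grow (fun n => - nd σ (y 0) x (n + 1)) N (fun n _ => by
        obtain ⟨m, hm, e⟩ := hr 0 (n + 1)
        exact ⟨m, hm, by
          show - nd σ (y 0) x (n + 1 + 2) = _
          rw [e]; ring⟩)
        (by simp [hy1]) (by
          obtain ⟨m, hm, e⟩ := hr 0 0
          simp only [hy0, hy1] at e ⊢
          rw [show 1 + 1 = 0 + 2 from rfl, e]
          linarith) N le_rfl
      have := this.1.trans this.2.1
      have : 0 ≤ - nd σ (y 0) x (N + 2) := this
      linarith
    have e1 : 0 ≤ nd σ (y t) x (N + 2) := by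
      have := grow (fun n => nd σ (y t) x n) (N + 2) (fun n _ => hr t n) (by simp [hy0, ht])
        (by simp [hy0, hy1]) (N + 2) le_rfl
      exact this.1
    obtain ⟨s, hs, hs0⟩ := intermediate_value_Icc ht (hc (N + 2)).continuousOn ⟨e0, e1⟩
    beta_reduce at hs0
    refine ⟨s, hs, ?_⟩
    -- nonneg
    have hpos : ∀ n ≤ N + 2, 0 ≤ nd σ (y s) x n := by
      intro n hn
      by_contra hcon
      push Not at hcon
      classical
      have hex : ∃ n, nd σ (y s) x n < 0 := ⟨n, hcon⟩
      set j := Nat.find hex with hj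
      have hj1 : nd σ (y s) x j < 0 := Nat.find_spec hex
      have hjn : j ≤ n := Nat.find_min' hex hcon
      have hj0 : j ≠ 0 := by
        intro h0
        rw [h0, hy0] at hj1; linarith
      obtain ⟨i, hji⟩ : ∃ i, j = i + 1 := ⟨j - 1, by omega⟩
      rw [hji] at hj1
      have hi : 0 ≤ nd σ (y s) x i := by
        have := Nat.find_min hex (m := i) (by omega)
        push Not at this; exact this
      have hmono : ∀ l, nd σ (y s) x (i + l + 1) ≤ nd σ (y s) x (i + 1) ∧
          nd σ (y s) x (i + l + 1) ≤ nd σ (y s) x (i + l) := by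
        intro l
        induction l with
        | zero => exact ⟨le_refl _, by simp; linarith⟩
        | succ l ih =>
          obtain ⟨m, hm, e⟩ := hr s (i + l)
          have : m * nd σ (y s) x (i + l + 1) ≤ 2 * nd σ (y s) x (i + l + 1) :=
            mul_le_mul_of_nonpos_right hm (by linarith [ih.1])
          rw [show i + (l + 1) + 1 = i + l + 2 from rfl, e, show i + (l + 1) = i + l + 1 from rfl]
          constructor <;> linarith [ih.1, ih.2]
      have := (hmono (N + 1 - i)).1
      rw [show i + (N + 1 - i) + 1 = N + 2 by omega, hs0] at this
      linarith
    -- decreasing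
    have hdec : ∀ l ≤ N + 1, nd σ (y s) x (N + 2 - l) ≤ nd σ (y s) x (N + 1 - l) := by
      intro l
      induction l with
      | zero => intro _; simp only [Nat.sub_zero]; rw [hs0]; exact hpos _ (by omega)
      | succ l ih =>
        intro hl
        have ih := ih (by omega)
        obtain ⟨m, hm, e⟩ := hr s (N + 1 - (l + 1))
        rw [show N + 1 - (l + 1) + 2 = N + 2 - l by omega,
          show N + 1 - (l + 1) + 1 = N + 1 - l by omega] at e
        have := mul_le_mul_of_nonneg_right hm (hpos (N + 1 - l) (by omega))
        rw [show N + 2 - (l + 1) = N + 1 - l by omega]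
        linarith
    intro n hn
    refine ⟨hpos _ (by omega), ?_⟩
    have := hdec (N + 1 - n) (by omega)
    rwa [show N + 2 - (N + 1 - n) = n + 1 by omega, show N + 1 - (N + 1 - n) = n by omega] at this
  obtain ⟨s, hs⟩ := IsCompact.nonempty_iInter_of_sequence_nonempty_isCompact_isClosed K
    (fun N s hs => ⟨hs.1, fun n hn => hs.2 n (by omega)⟩) hne
    (isCompact_Icc.of_isClosed_subset (hKclosed 0) (fun s hs => hs.1)) hKclosed
  rw [mem_iInter] at hs
  exact ⟨y s, hyr s, rfl, fun n => (hs n).2 n le_rfl⟩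

end BB

namespace BB

def gd (c x : ℝ) : Prop := c ≤ Int.fract x ∧ Int.fract x ≤ 1 - c

open Classical in
noncomputable def cnt (c : ℝ) (x : ℕ → ℝ) : ℕ → ℕ
  | 0 => 0
  | (i + 1) => cnt c x i + if gd c (x (i + 1)) then 1 else 0

theorem Cell.floor {k : ℤ} {x : ℝ} (h : Cell k x) : ⌊x⌋ = k :=
  Int.floor_eq_iff.2 ⟨h.1.le, h.2⟩

theorem Cell.gd {k : ℤ} {x c : ℝ} (h : Cell k x) (hg : gd c x) : k + c ≤ x ∧ x ≤ k + 1 - c := by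
  unfold BB.gd at hg
  rw [Int.fract, h.floor] at hg
  constructor <;> linarith [hg.1, hg.2]

theorem gd.cell {x c : ℝ} (hc : 0 < c) (h : BB.gd c x) : Cell ⌊x⌋ x := by
  unfold BB.gd Int.fract at h
  constructor <;> linarith [h.1, h.2]

theorem cnt_mono1 (c x i) : cnt c x i ≤ cnt c x (i + 1) := Nat.le_add_right _ _
theorem cnt_le1 (c x i) : cnt c x (i + 1) ≤ cnt c x i + 1 := by
  show cnt c x i + _ ≤ _
  split_ifs <;> omega
theorem cnt_le (c x i) : cnt c x i ≤ i := by
  induction i with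
  | zero => exact le_rfl
  | succ i ih => exact (cnt_le1 c x i).trans (by omega)

structure Par (S : Sys) where
  c : ℝ
  ε : ℝ
  ρ : ℝ
  c0 : 0 < c
  c1 : c < 1 / 8
  hα : ∀ z, c / 2 ≤ z → z ≤ 1 - c / 2 → 2 + ε ≤ S.α z
  ρ0 : 0 < ρ
  ρ1 : ρ < 1
  hq : 1 ≤ ρ ^ 3 * (1 + ε)

variable {S : Sys} (R : Par S)

def Par.q : ℝ := R.ρ ^ 3
theorem Par.q0 : 0 < R.q := pow_pos R.ρ0 3
theorem Par.q1 : R.q < 1 := pow_lt_one₀ R.ρ0.le R.ρ1 (by norm_num)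
theorem Par.q_pow (n : ℕ) : R.q ^ n = (R.ρ ^ n) ^ 3 := by
  rw [Par.q, ← pow_mul, ← pow_mul, mul_comm]
theorem Par.qn0 (n : ℕ) : 0 < R.q ^ n := pow_pos R.q0 n
theorem Par.qn1 (n : ℕ) : R.q ^ n ≤ 1 := pow_le_one₀ R.q0.le R.q1.le
theorem Par.ρn0 (n : ℕ) : 0 < R.ρ ^ n := pow_pos R.ρ0 n
theorem Par.ρn1 (n : ℕ) : R.ρ ^ n ≤ 1 := pow_le_one₀ R.ρ0.le R.ρ1.le
theorem Par.q_le_ρ (n : ℕ) : R.q ^ n ≤ R.ρ ^ n := by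
  rw [R.q_pow]
  exact pow_le_of_le_one (R.ρn0 n).le (R.ρn1 n) (by norm_num)

noncomputable def Par.N (x : ℕ → ℝ) (i : ℕ) : ℕ := cnt R.c x i

theorem Sys.pair (k : ℕ → ℤ) (x y : ℕ → ℝ) (hx : S.Rec k x) (hy : S.Rec k y) (B : ℝ)
    (hB : ∀ n, |y (n + 1) - x (n + 1)| ≤ B) :
    ∃ σ, Sgn σ ∧ nd σ y x 0 = |y 0 - x 0| ∧ y 0 = x 0 + σ * |y 0 - x 0| ∧
      ∀ n, 0 ≤ nd σ y x (n + 1) ∧ nd σ y x (n + 1) ≤ nd σ y x n := by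
  obtain ⟨σ, hσ, h0⟩ : ∃ σ, Sgn σ ∧ nd σ y x 0 = |y 0 - x 0| := by
    rcases le_total 0 (y 0 - x 0) with h | h
    · exact ⟨1, Or.inl rfl, by rw [abs_of_nonneg h]; simp [nd]⟩
    · exact ⟨-1, Or.inr rfl, by rw [abs_of_nonpos h]; simp [nd]⟩
  refine ⟨σ, hσ, h0, ?_, ?_⟩
  · have := nd_inv hσ y x 0
    rw [h0] at this
    simpa using this
  · apply bdd_decr _ B
    · intro n; rw [abs_nd hσ]; exact hB n
    · intro n
      obtain ⟨m, h1, _, h3, _⟩ := S.nd_rec k σ hσ y x n (hy n) (hx n)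
      exact ⟨m, h1, h3⟩
    · rw [h0]; positivity

theorem nd_nonneg {E : ℕ → ℝ} (h : ∀ n, 0 ≤ E (n + 1) ∧ E (n + 1) ≤ E n) (n : ℕ) : 0 ≤ E n :=
  (h n).1.trans (h n).2

theorem dec_le {E : ℕ → ℝ} (h : ∀ n, 0 ≤ E (n + 1) ∧ E (n + 1) ≤ E n) (n : ℕ) : E n ≤ E 0 := by
  induction n with
  | zero => exact le_rfl
  | succ n ih => exact (h n).2.trans ih

theorem Par.contr1 (k : ℕ → ℤ) (x y : ℕ → ℝ) (hx : S.Rec k x) (hy : S.Rec k y)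
    (hcell : ∀ n, Cell (k (n + 1)) (x (n + 1))) (σ : ℝ) (hσ : Sgn σ)
    (hd : ∀ n, 0 ≤ nd σ y x (n + 1) ∧ nd σ y x (n + 1) ≤ nd σ y x n) (h0 : nd σ y x 0 ≤ R.c / 2)
    (n : ℕ) (hg : gd R.c (x (n + 1))) : nd σ y x (n + 1) ≤ nd σ y x n * R.q := by
  obtain ⟨m, h1, _, h3, _, h5⟩ := S.nd_rec k σ hσ y x n (hy n) (hx n)
  have hm := h5 R.c R.ε R.hα ((hcell n).gd hg).1 ((hcell n).gd hg).2 (by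
    rw [abs_of_nonneg (hd n).1]
    exact (dec_le hd (n + 1)).trans h0)
  have e1 : (1 + R.ε) * nd σ y x (n + 1) ≤ nd σ y x n := by
    have := mul_le_mul_of_nonneg_right hm (hd n).1
    linarith [(hd (n + 1)).2]
  have e2 := mul_le_mul_of_nonneg_right R.hq (hd n).1
  have e3 := mul_le_mul_of_nonneg_left e1 R.q0.le
  unfold Par.q at *
  linarith

theorem Par.contr (k : ℕ → ℤ) (x y : ℕ → ℝ) (hx : S.Rec k x) (hy : S.Rec k y)
    (hcell : ∀ n, Cell (k (n + 1)) (x (n + 1))) (σ : ℝ) (hσ : Sgn σ)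
    (hd : ∀ n, 0 ≤ nd σ y x (n + 1) ∧ nd σ y x (n + 1) ≤ nd σ y x n) (h0 : nd σ y x 0 ≤ R.c / 2) :
    ∀ i, nd σ y x i ≤ nd σ y x 0 * R.q ^ R.N x i := by
  intro i
  induction i with
  | zero => simp [Par.N, cnt]
  | succ i ih =>
    by_cases hg : gd R.c (x (i + 1))
    · have := R.contr1 k x y hx hy hcell σ hσ hd h0 i hg
      have e : R.N x (i + 1) = R.N x i + 1 := by simp [Par.N, cnt, hg]
      rw [e, pow_succ]
      have := mul_le_mul_of_nonneg_right ih R.q0.le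
      linarith
    · have e : R.N x (i + 1) = R.N x i := by simp [Par.N, cnt, hg]
      rw [e]
      exact (hd i).2.trans ih

def Par.GS (p : ℝ × ℝ) (d : ℝ) : Prop :=
  ∀ i, ∃ k : ℤ, Cell k (S.X p (i + 1)) ∧
    Cell k (S.X p (i + 1) - (-1) ^ i * d * R.q ^ R.N (S.X p) i)

variable (S) in
def Sys.SL (p z : ℝ × ℝ) : Prop :=
  ∀ j, ∃ k : ℤ, Cell k (S.X p (j + 1)) ∧ Cell k (S.X z (j + 1))

variable (S) in
noncomputable def Sys.K (p : ℝ × ℝ) (n : ℕ) : ℤ := ⌊S.X p n⌋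

theorem Sys.SL.rec {p z : ℝ × ℝ} (h : S.SL p z) :
    (∀ n, Cell (S.K p (n + 1)) (S.X p (n + 1))) ∧ S.Rec (S.K p) (S.X p) ∧
    (∀ n, Cell (S.K p (n + 1)) (S.X z (n + 1))) ∧ S.Rec (S.K p) (S.X z) ∧
    ∀ n, |S.X z (n + 1) - S.X p (n + 1)| ≤ 1 := by
  have h1 : ∀ n, Cell (S.K p (n + 1)) (S.X p (n + 1)) := by
    intro n
    obtain ⟨k, h1, h2⟩ := h n
    rw [Sys.K, h1.floor]; exact h1
  have h2 : ∀ n, Cell (S.K p (n + 1)) (S.X z (n + 1)) := by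
    intro n
    obtain ⟨k, h1, h2⟩ := h n
    rw [Sys.K, h1.floor]; exact h2
  refine ⟨h1, S.rec_X _ _ h1, h2, S.rec_X _ _ h2, ?_⟩
  intro n
  rw [abs_le]
  constructor <;> linarith [(h1 n).1, (h1 n).2, (h2 n).1, (h2 n).2]

/-- contraction along leaf -/
theorem Par.SL_contr {p z : ℝ × ℝ} (h : S.SL p z) (hz : |z.1 - p.1| ≤ R.c / 2) (i : ℕ) :
    |S.X z i - S.X p i| ≤ |z.1 - p.1| * R.q ^ R.N (S.X p) i := by
  obtain ⟨h1, h2, h3, h4, h5⟩ := h.rec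
  obtain ⟨σ, hσ, e0, _, hd⟩ := S.pair _ _ _ h2 h4 1 h5
  have := R.contr _ _ _ h2 h4 h1 σ hσ hd (by rw [e0]; exact hz) i
  rw [e0, ← abs_of_nonneg (nd_nonneg hd i), abs_nd hσ] at this
  exact this

theorem between_cell {k : ℤ} {x d e : ℝ} (hx : Cell k x) (hd : Cell k (x + d)) (s : ℝ)
    (h0 : 0 ≤ s) (h1 : s ≤ 1) (he : e = s * d) : Cell k (x + e) := by
  subst he
  obtain ⟨a1, a2⟩ := hx
  obtain ⟨b1, b2⟩ := hd
  rcases le_total 0 d with h | h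
  · have e1 : 0 ≤ s * d := mul_nonneg h0 h
    have e2 : s * d ≤ 1 * d := mul_le_mul_of_nonneg_right h1 h
    constructor <;> linarith
  · have e1 : s * d ≤ 0 := mul_nonpos_of_nonneg_of_nonpos h0 h
    have e2 : 1 * d ≤ s * d := mul_le_mul_of_nonpos_right h1 h
    constructor <;> linarith

theorem Par.leaf (p : ℝ × ℝ) (σ : ℝ) (hσ : Sgn σ) (D : ℝ) (hD : 0 ≤ D) (hDc : D ≤ R.c / 2)
    (hG : R.GS p (σ * D)) : ∃ s : ℝ → ℝ, ∀ t, 0 ≤ t → t ≤ D →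
      0 ≤ s t ∧ s t ≤ t ∧ (gd R.c p.2 → s t ≤ t * R.q) ∧
      S.SL p (p.1 + σ * t, p.2 - σ * s t) ∧
      ∀ t', 0 ≤ t' → t' ≤ D → |s t - s t'| ≤ |t - t'| := by
  have h1 : ∀ n, Cell (S.K p (n + 1)) (S.X p (n + 1)) := by
    intro n
    obtain ⟨k, h1, h2⟩ := hG n
    rw [Sys.K, h1.floor]; exact h1
  have hx := S.rec_X _ _ h1
  choose y hy hy0 hd using fun t : {t : ℝ // 0 ≤ t} => S.ext_leaf (S.K p) (S.X p) hx σ hσ t.1 t.2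
  have e0 : ∀ t, nd σ (y t) (S.X p) 0 = t.1 := by
    intro t
    unfold nd
    rw [hy0]
    have := hσ.sq
    linear_combination t.1 * this
  refine ⟨fun t => nd σ (y ⟨max t 0, le_max_right _ _⟩) (S.X p) 1, ?_⟩
  intro t ht htD
  have hmax : (⟨max t 0, le_max_right _ _⟩ : {t : ℝ // 0 ≤ t}) = ⟨t, ht⟩ := by
    simp [ht]
  beta_reduce
  rw [hmax]
  set T : {t : ℝ // 0 ≤ t} := ⟨t, ht⟩ with hT
  have hc := R.contr _ _ _ hx (hy T) h1 σ hσ (hd T) (by rw [e0]; exact htD.trans hDc)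
  have y1 : y T 1 = p.2 - σ * nd σ (y T) (S.X p) 1 := by
    have := nd_inv hσ (y T) (S.X p) 1
    have e : p.2 = S.X p 1 := rfl
    rw [e]; linear_combination this
  have hcell : ∀ n, Cell (S.K p (n + 1)) (y T (n + 1)) := by
    intro n
    obtain ⟨k, b1, b2⟩ := hG n
    rw [Sys.K, b1.floor, nd_inv hσ (y T) (S.X p) (n + 1)]
    rw [sub_eq_add_neg] at b2
    have e1 : nd σ (y T) (S.X p) (n + 1) ≤ t * R.q ^ R.N (S.X p) n := by
      have a1 := hc n
      rw [e0] at a1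
      exact ((hd T n).2).trans a1
    rcases hD.eq_or_lt with hD0 | hDp
    · have : nd σ (y T) (S.X p) (n + 1) = 0 := by
        apply le_antisymm _ (hd T n).1
        have : t = 0 := le_antisymm (by linarith) ht
        rw [this] at e1; linarith
      rw [this]; simpa using b1
    have hp := mul_pos hDp (R.qn0 (R.N (S.X p) n))
    refine between_cell b1 b2 (nd σ (y T) (S.X p) (n + 1) / (D * R.q ^ R.N (S.X p) n))
      (div_nonneg (hd T n).1 hp.le) ?_ ?_
    · rw [div_le_one hp]
      exact e1.trans (mul_le_mul_of_nonneg_right htD (R.qn0 _).le)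
    · have h1 := R.qn0 (R.N (S.X p) n)
      generalize R.q ^ R.N (S.X p) n = Q at h1 ⊢
      rw [pow_succ]
      field_simp
  have hyX := S.eq_X_of_rec _ _ (hy T) hcell
  refine ⟨(hd T 0).1, ?_, ?_, ?_, ?_⟩
  · have := (hd T 0).2
    rw [e0] at this; exact this
  · intro hg
    have := R.contr1 _ _ _ hx (hy T) h1 σ hσ (hd T) (by rw [e0]; exact htD.trans hDc) 0 hg
    rw [e0] at this; exact this
  · intro j
    refine ⟨S.K p (j + 1), h1 j, ?_⟩
    have := hcell j
    rw [hyX, hy0, y1] at this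
    exact this
  · intro t' ht' htD'
    have hmax' : (⟨max t' 0, le_max_right _ _⟩ : {t : ℝ // 0 ≤ t}) = ⟨t', ht'⟩ := by
      simp [ht']
    rw [hmax']
    set T' : {t : ℝ // 0 ≤ t} := ⟨t', ht'⟩ with hT'
    obtain ⟨σ', hσ', f0, _, fd⟩ := S.pair _ _ _ (hy T') (hy T) (t + t') (by
      intro n
      have a1 := dec_le (hd T) (n + 1)
      have a2 := dec_le (hd T') (n + 1)
      rw [e0] at a1 a2
      rw [← abs_of_nonneg (hd T n).1, abs_nd hσ] at a1
      rw [← abs_of_nonneg (hd T' n).1, abs_nd hσ] at a2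
      have := abs_sub_le (y T (n+1)) (S.X p (n+1)) (y T' (n+1))
      rw [abs_sub_comm (S.X p (n+1))] at this
      simp only [hT, hT'] at a1 a2 this ⊢
      linarith)
    have g := (fd 0).2
    rw [f0, ← abs_of_nonneg (fd 0).1, abs_nd hσ', hy0, hy0] at g
    have e3 : nd σ (y T) (S.X p) 1 - nd σ (y T') (S.X p) 1 = - σ * (y T (0 + 1) - y T' (0 + 1)) := by
      simp [nd]; ring
    rw [e3, abs_mul, abs_neg, hσ.abs, one_mul]
    refine g.trans (le_of_eq ?_)
    rw [show S.X p 0 + σ * T.1 - (S.X p 0 + σ * T'.1) = σ * (t - t') by simp only [hT, hT']; ring,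
      abs_mul, hσ.abs, one_mul]

end BB

namespace BB
variable {S : Sys} (R : Par S)

theorem lip_cont {s : ℝ → ℝ} {D : ℝ}
    (h : ∀ t, 0 ≤ t → t ≤ D → ∀ t', 0 ≤ t' → t' ≤ D → |s t - s t'| ≤ |t - t'|) :
    ContinuousOn s (Icc 0 D) := by
  have : LipschitzOnWith 1 s (Icc 0 D) := by
    apply LipschitzOnWith.of_dist_le_mul
    intro x hx y hy
    simpa [Real.dist_eq] using h x hx.1 hx.2 y hy.1 hy.2
  exact this.continuousOn

theorem Par.zpt (P : ℝ × ℝ) (σ : ℝ) (hσ : Sgn σ) (a : ℝ) (ha : 0 ≤ a)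
    (haD : a / (1 - R.q) ≤ R.c / 2) (hg : gd R.c P.1)
    (hU : R.GS P.swap (σ * (a / (1 - R.q)))) (hS : R.GS (P.1, P.2 + σ * a) (-σ * (a / (1 - R.q)))) :
    ∃ z : ℝ × ℝ, S.SL (P.1, P.2 + σ * a) z ∧ S.SL P.swap z.swap ∧
      |z.1 - P.1| ≤ a / (1 - R.q) ∧ |z.2 - P.2| ≤ a / (1 - R.q) := by
  have h1q : 0 < 1 - R.q := by linarith [R.q1]
  set D := a / (1 - R.q) with hD
  have hD0 : 0 ≤ D := div_nonneg ha h1q.le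
  have hDa : D * (1 - R.q) = a := by rw [hD]; field_simp
  obtain ⟨τ, hτ⟩ := R.leaf _ σ hσ D hD0 haD hU
  obtain ⟨s, hs⟩ := R.leaf _ (-σ) hσ.neg D hD0 haD hS
  have cτ : ContinuousOn τ (Icc 0 D) := lip_cont fun t h1 h2 => (hτ t h1 h2).2.2.2.2
  have cs : ContinuousOn s (Icc 0 D) := lip_cont fun t h1 h2 => (hs t h1 h2).2.2.2.2
  have mτ : MapsTo τ (Icc 0 D) (Icc 0 D) := fun t ht =>
    ⟨(hτ t ht.1 ht.2).1, (hτ t ht.1 ht.2).2.1.trans ht.2⟩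
  have cF : ContinuousOn (fun v => v - a - s (τ v)) (Icc 0 D) :=
    (continuousOn_id.sub continuousOn_const).sub (cs.comp cτ mτ)
  have m0 := mτ ⟨le_rfl, hD0⟩
  have mD := mτ ⟨hD0, le_rfl⟩
  obtain ⟨v, hv, hv0⟩ := intermediate_value_Icc hD0 cF (show (0:ℝ) ∈ _ from by
    refine ⟨?_, ?_⟩
    · have := (hs _ m0.1 m0.2).1
      show 0 - a - s (τ 0) ≤ 0
      linarith
    · have b1 := (hs _ mD.1 mD.2).2.1
      have b2 := (hτ D hD0 le_rfl).2.2.1 hg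
      show 0 ≤ D - a - s (τ D)
      linarith)
  have hv0 : v - a - s (τ v) = 0 := hv0
  have mv := mτ hv
  refine ⟨(P.1 - σ * τ v, P.2 + σ * v), ?_, ?_, ?_, ?_⟩
  · have := (hs _ mv.1 mv.2).2.2.2.1
    convert this using 1
    ext
    · simp; ring
    · simp; linear_combination σ * hv0
  · exact (hτ v hv.1 hv.2).2.2.2.1
  · show |P.1 - σ * τ v - P.1| ≤ D
    rw [show P.1 - σ * τ v - P.1 = - σ * τ v by ring, abs_mul, hσ.neg.abs, one_mul,
      abs_of_nonneg mv.1]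
    exact mv.2
  · show |P.2 + σ * v - P.2| ≤ D
    rw [show P.2 + σ * v - P.2 = σ * v by ring, abs_mul, hσ.abs, one_mul,
      abs_of_nonneg hv.1]
    exact hv.2
end BB

namespace BB

theorem wron (E A e : ℕ → ℝ) (N : ℕ)
    (h : ∀ n < N, ∃ m m', 2 ≤ m ∧ E (n + 2) = m * E (n + 1) - E n ∧
      A (n + 2) = m' * A (n + 1) - A n ∧ |m - m'| ≤ e n)
    (h0 : E 0 = 0) (h1 : 0 ≤ E 1) (hA : ∀ n, 0 ≤ A (n + 1) ∧ A (n + 1) ≤ A n) (n : ℕ) (hn : n ≤ N) :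
    E n * A n ≤ n * (E (n + 1) * A n - E n * A (n + 1)) ∧
    0 ≤ E (n + 1) * A n - E n * A (n + 1) ∧
    E (n + 1) * A n - E n * A (n + 1) ≤
      (E 1 * A 0) * Real.exp (∑ i ∈ Finset.range n, (i + 1) * e i) ∧
    E 1 * A 0 ≤
      (E (n + 1) * A n - E n * A (n + 1)) * Real.exp (∑ i ∈ Finset.range n, (i + 1) * e i) := by
  have hr : ∀ n < N, ∃ m ≥ (2:ℝ), E (n + 2) = m * E (n + 1) - E n := by
    intro n hn
    obtain ⟨m, m', a, b, _⟩ := h n hn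
    exact ⟨m, a, b⟩
  have g1 := grow E N hr h0.ge (by rw [h0]; exact h1)
  have g2 := grow_le E N hr h0.symm (by rw [h0]; exact h1)
  have w1 : ∀ n ≤ N, E n * A n ≤ n * (E (n + 1) * A n - E n * A (n + 1)) := by
    intro n hn
    have a1 := mul_le_mul_of_nonneg_right (g2 n hn) (nd_nonneg hA n)
    have a2 := mul_le_mul_of_nonneg_left (hA n).2 (g1 n hn).1
    have a3 : (n:ℝ) * (E n * A (n+1)) ≤ n * (E n * A n) := mul_le_mul_of_nonneg_left a2 (by positivity)
    linarith
  have w2 : ∀ n ≤ N, E (n+1) * A (n+1) ≤ (n + 1) * (E (n + 1) * A n - E n * A (n + 1)) := by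
    intro n hn
    have b : E (n + 1) ≤ (n + 1) * (E (n + 1) - E n) := by linarith [g2 n hn]
    have a1 := mul_le_mul_of_nonneg_right b (hA n).1
    have a2 := mul_le_mul_of_nonneg_left (hA n).2 ((g1 n hn).1.trans (g1 n hn).2.1)
    have a3 : ((n:ℝ) + 1) * (E (n+1) * A (n+1)) ≤ (n + 1) * (E (n+1) * A n) :=
      mul_le_mul_of_nonneg_left a2 (by positivity)
    linarith
  have w3 : ∀ n ≤ N, 0 ≤ E (n + 1) * A n - E n * A (n + 1) := by
    intro n hn
    have a2 := mul_le_mul_of_nonneg_left (hA n).2 (g1 n hn).1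
    have a3 := mul_le_mul_of_nonneg_right (g1 n hn).2.1 (nd_nonneg hA n)
    linarith
  refine ⟨w1 n hn, w3 n hn, ?_⟩
  induction n with
  | zero => simp [h0]
  | succ n ih =>
    obtain ⟨i1, i2⟩ := ih (by omega)
    obtain ⟨m, m', hm, eE, eA, hmm⟩ := h n (by omega)
    have he : 0 ≤ e n := (abs_nonneg _).trans hmm
    have z1 := w1 (n + 1) hn
    have z2 := w2 n (by omega)
    have z3 := w3 n (by omega)
    have z4 := w3 (n + 1) hn
    have hd : (E (n + 1 + 1) * A (n + 1) - E (n + 1) * A (n + 1 + 1)) -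
      (E (n + 1) * A n - E n * A (n + 1)) = (m - m') * (E (n + 1) * A (n + 1)) := by
      rw [show n + 1 + 1 = n + 2 from rfl, eE, eA]; ring
    set W := E (n + 1) * A n - E n * A (n + 1) with hW
    set W' := E (n + 1 + 1) * A (n + 1) - E (n + 1) * A (n + 1 + 1) with hW'
    have hEA : 0 ≤ E (n + 1) * A (n + 1) :=
      mul_nonneg (g1 (n+1) hn).1 (hA n).1
    have hab : |W' - W| ≤ e n * (E (n + 1) * A (n + 1)) := by
      rw [hd, abs_mul, abs_of_nonneg hEA]
      exact mul_le_mul_of_nonneg_right hmm hEA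
    have hex := Real.add_one_le_exp ((n + 1) * e n)
    push_cast at z1
    have y1 := mul_le_mul_of_nonneg_left z2 he
    have y2 := mul_le_mul_of_nonneg_left z1 he
    have x1 : W' ≤ W * Real.exp ((n + 1) * e n) := by
      have := mul_le_mul_of_nonneg_left hex z3
      have := (abs_le.1 hab).2
      linarith
    have x2 : W ≤ W' * Real.exp ((n + 1) * e n) := by
      have := mul_le_mul_of_nonneg_left hex z4
      have := (abs_le.1 hab).1
      linarith
    rw [Finset.sum_range_succ, Real.exp_add]
    constructor
    · refine x1.trans ?_
      rw [← mul_assoc]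
      exact mul_le_mul_of_nonneg_right i1 (Real.exp_pos _).le
    · refine i2.trans ?_
      have := mul_le_mul_of_nonneg_right x2
        (Real.exp_pos (∑ i ∈ Finset.range n, ((i:ℝ) + 1) * e i)).le
      linarith

theorem exists_sgn_abs (x : ℝ) : ∃ s, Sgn s ∧ s * x = |x| := by
  rcases le_total 0 x with h | h
  · exact ⟨1, Or.inl rfl, by rw [abs_of_nonneg h, one_mul]⟩
  · exact ⟨-1, Or.inr rfl, by rw [abs_of_nonpos h]; ring⟩

theorem Sys.gap (S : Sys) (k k' : ℕ → ℤ) (P P' Q Q' : ℕ → ℝ) (hP : S.Rec k P) (hP' : S.Rec k P')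
    (hQ : S.Rec k' Q) (hQ' : S.Rec k' Q') (σ : ℝ) (hσ : Sgn σ) (h0 : P 0 = Q 0) (h0' : P' 0 = Q' 0)
    (hA : ∀ n, 0 ≤ nd σ P' P (n + 1) ∧ nd σ P' P (n + 1) ≤ nd σ P' P n)
    (hB : ∀ n, 0 ≤ nd σ Q' Q (n + 1) ∧ nd σ Q' Q (n + 1) ≤ nd σ Q' Q n)
    (hA0 : 0 < nd σ P' P 0) (w : ℝ) (hw : w = |Q 1 - P 1|) (U : ℕ → ℝ) (hU0 : w ≤ U 0)
    (hU : ∀ j, 2 * S.A * (j + 1) * nd σ Q' Q j ≤ U j)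
    (hcell : ∀ j, |Q (j + 1) - P (j + 1)| ≤ S.A ^ j * w → |Q (j + 1) - P (j + 1)| ≤ U j →
      k (j + 1) = k' (j + 1)) (M : ℝ)
    (hM : ∀ n, ∑ j ∈ Finset.range n, ((j:ℝ) + 1) *
      (S.L * (U j + 3 * nd σ P' P (j + 1) + nd σ Q' Q (j + 1))) ≤ M)
    (hlim : 0 < w → ∃ n, 1 ≤ n ∧ 2 * n * nd σ Q' Q n ≤ w) :
    w ≤ 2 * Real.exp (2 * M) * |Q' 1 - P' 1| := by
  have hw0 : 0 ≤ w := by rw [hw]; positivity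
  rcases hw0.eq_or_lt with h | hwp
  · rw [← h]; positivity
  obtain ⟨s, hs, hsw⟩ := exists_sgn_abs (Q 1 - P 1)
  set τ := -s with hτ
  have hτs : Sgn τ := hs.neg
  set E := nd τ Q P with hE
  set A := nd σ P' P with hAdef
  set B := nd σ Q' Q with hBdef
  have E0 : E 0 = 0 := by simp [hE, nd, h0]
  have E1 : E 1 = w := by rw [hw, ← hsw]; simp [hE, nd, hτ]
  have hrec : ∀ n, k (n + 1) = k' (n + 1) → ∃ m, 2 ≤ m ∧ m ≤ S.A ∧ E (n + 2) = m * E (n + 1) - E n ∧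
      |m - S.α (P (n + 1) - k (n + 1))| ≤ S.L * |E (n + 1)| := by
    intro n hk
    obtain ⟨m, a1, a2, a3, a4, _⟩ := S.nd_rec k τ hτs Q P n (by rw [hk]; exact hQ n) (hP n)
    exact ⟨m, a1, a2, a3, a4⟩
  have hC : ∀ j, (∀ i, 1 ≤ i → i ≤ j → E i < 2 * i * B i) →
      ∀ i ≤ j, k (i + 1) = k' (i + 1) ∧ 0 ≤ E (i + 1) ∧ E (i + 1) ≤ S.A ^ i * w ∧ E (i + 1) ≤ U i := by
    intro j
    induction j with
    | zero =>
      intro _ i hi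
      obtain rfl : i = 0 := by omega
      have e1 : |Q (0 + 1) - P (0 + 1)| = w := by rw [hw]
      refine ⟨hcell 0 (by rw [e1]; simp) (by rw [e1]; exact hU0), ?_, ?_, ?_⟩
      · show 0 ≤ E 1; rw [E1]; exact hw0
      · show E 1 ≤ _; rw [E1]; simp
      · show E 1 ≤ _; rw [E1]; exact hU0
    | succ j ih =>
      intro hj i hi
      have ih := ih fun i h1 h2 => hj i h1 (by omega)
      rcases Nat.lt_or_ge i (j + 1) with h | h
      · exact ih i (by omega)
      obtain rfl : i = j + 1 := by omega
      have g := grow E (j + 1) (fun n hn => by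
        obtain ⟨m, a1, _, a3, _⟩ := hrec n (ih n (by omega)).1
        exact ⟨m, a1, a3⟩) E0.ge (by rw [E0, E1]; exact hw0)
      obtain ⟨m, a1, a2, a3, _⟩ := hrec j (ih j le_rfl).1
      obtain ⟨b1, b2, b3, b4⟩ := ih j le_rfl
      have g1 := g (j + 1) le_rfl
      have c1 : E (j + 1 + 1) ≤ S.A * E (j + 1) := by
        rw [show j + 1 + 1 = j + 2 from rfl, a3]
        have := mul_le_mul_of_nonneg_right a2 b2
        linarith [(g j (by omega)).1]
      have hA2 := S.A_ge
      have c2 : E (j + 1 + 1) ≤ S.A ^ (j + 1) * w := by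
        refine c1.trans ?_
        rw [pow_succ']
        have := mul_le_mul_of_nonneg_left b3 (by linarith : 0 ≤ S.A)
        linarith
      have c3 : E (j + 1 + 1) ≤ U (j + 1) := by
        refine c1.trans (le_trans ?_ (hU (j + 1)))
        have := hj (j + 1) (by omega) le_rfl
        push_cast at this ⊢
        have := mul_le_mul_of_nonneg_left this.le (by linarith : 0 ≤ S.A)
        have h9 : 0 ≤ S.A * B (j + 1) := mul_nonneg (by linarith) (hB j).1
        linarith
      have c0 : 0 ≤ E (j + 1 + 1) := g1.1.trans g1.2.1
      have e1 : |Q (j + 1 + 1) - P (j + 1 + 1)| = E (j + 1 + 1) := by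
        rw [← abs_nd hτs Q P, abs_of_nonneg c0]
      exact ⟨hcell (j + 1) (by rw [e1]; exact c2) (by rw [e1]; exact c3), c0, c2, c3⟩
  -- existence of stopping time
  have hex : ∃ n, 1 ≤ n ∧ 2 * n * B n ≤ E n := by
    by_contra hcon
    push Not at hcon
    obtain ⟨n, hn1, hn⟩ := hlim hwp
    have hall := hC n (fun i h1 _ => hcon i h1)
    have g := grow E n (fun l hl => by
      obtain ⟨m, a1, _, a3, _⟩ := hrec l (hall l hl.le).1
      exact ⟨m, a1, a3⟩) E0.ge (by rw [E0, E1]; exact hw0)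
    have : w ≤ E n := by
      obtain ⟨l, rfl⟩ : ∃ l, n = l + 1 := ⟨n - 1, by omega⟩
      have := (g l (by omega))
      rw [E0, E1] at this
      linarith [this.1, this.2.2]
    linarith [hcon n hn1]
  classical
  obtain ⟨hn1, hnB⟩ := Nat.find_spec hex
  have hmin : ∀ i < Nat.find hex, 1 ≤ i → E i < 2 * i * B i := by
    intro i hi h1
    have := Nat.find_min hex hi
    push Not at this
    exact this h1
  generalize Nat.find hex = n at hn1 hnB hmin
  have hC := hC (n - 1) (fun i h1 h2 => hmin i (by omega) h1)
  have hk : ∀ l < n, k (l + 1) = k' (l + 1) := fun l hl => (hC l (by omega)).1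
  have hmA : ∀ l, ∃ m', A (l + 2) = m' * A (l + 1) - A l ∧
      |m' - S.α (P (l + 1) - k (l + 1))| ≤ S.L * A (l + 1) := by
    intro l
    obtain ⟨m, a1, a2, a3, a4, _⟩ := S.nd_rec k σ hσ P' P l (hP' l) (hP l)
    exact ⟨m, a3, by rwa [abs_of_nonneg (hA l).1] at a4⟩
  set e : ℕ → ℝ := fun j => S.L * (U j + 3 * A (j + 1) + B (j + 1)) with he
  have hEU : ∀ l < n, |E (l + 1)| ≤ U l := by
    intro l hl
    have := hC l (by omega)
    rw [abs_of_nonneg this.2.1]; exact this.2.2.2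
  obtain ⟨v1, v2, -, v4⟩ := wron E A e n (fun l hl => by
    obtain ⟨m, a1, _, a3, a4⟩ := hrec l (hk l hl)
    obtain ⟨m', b1, b2⟩ := hmA l
    refine ⟨m, m', a1, a3, b1, ?_⟩
    have := abs_sub_le m (S.α (P (l + 1) - k (l + 1))) m'
    rw [abs_sub_comm] at b2
    have h2 := mul_le_mul_of_nonneg_left (hEU l hl) S.L_nonneg
    have h3 := mul_nonneg S.L_nonneg (hA l).1
    have h4 := mul_nonneg S.L_nonneg (hB l).1
    simp only [he]
    linarith) E0 (by rw [E1]; exact hw0) hA n le_rfl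
  obtain ⟨s', hs', hsw'⟩ := exists_sgn_abs (nd τ Q' P' 1)
  have E'eq : ∀ i, nd τ Q' P' i = E i + τ * σ * (B i - A i) := by
    intro i
    have := hσ.sq
    simp only [hE, hAdef, hBdef, nd]
    linear_combination (-τ * (-1) ^ i * (Q' i - Q i - P' i + P i)) * this
  have E''eq : ∀ i, nd (s' * τ) Q' P' i = s' * nd τ Q' P' i := by
    intro i; unfold nd; ring
  have hςA : |τ * σ| = 1 := (hτs.mul hσ).abs
  obtain ⟨-, u2, u3, -⟩ := wron (nd (s' * τ) Q' P') A e n (fun l hl => by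
    obtain ⟨m, a1, _, a3, a4, _⟩ := S.nd_rec k (s' * τ) (hs'.mul hτs) Q' P' l
      (by rw [hk l hl]; exact hQ' l) (hP' l)
    obtain ⟨m', b1, b2⟩ := hmA l
    refine ⟨m, m', a1, a3, b1, ?_⟩
    have t1 := abs_sub_le m (S.α (P' (l + 1) - k (l + 1))) m'
    have t2 := abs_sub_le (S.α (P' (l + 1) - k (l + 1))) (S.α (P (l + 1) - k (l + 1))) m'
    rw [abs_sub_comm] at b2
    have t3 := S.lip (P' (l + 1) - k (l + 1)) (P (l + 1) - k (l + 1))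
    rw [show P' (l + 1) - (k (l + 1):ℝ) - (P (l + 1) - k (l + 1)) = P' (l + 1) - P (l + 1) by ring,
      ← abs_nd hσ P' P, abs_of_nonneg (hA l).1] at t3
    have t4 : |nd (s' * τ) Q' P' (l + 1)| ≤ U l + A (l + 1) + B (l + 1) := by
      rw [E''eq, abs_mul, hs'.abs, one_mul, E'eq]
      refine (abs_add_le _ _).trans ?_
      rw [abs_mul, hςA, one_mul]
      have := abs_sub (B (l + 1)) (A (l + 1))
      rw [abs_of_nonneg (hA l).1, abs_of_nonneg (hB l).1] at this
      linarith [hEU l hl]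
    have h2 := mul_le_mul_of_nonneg_left t4 S.L_nonneg
    simp only [he]
    linarith) (by simp [nd, h0']) (by rw [E''eq, hsw']; positivity) hA n le_rfl
  have hexp : Real.exp (∑ i ∈ Finset.range n, ((i:ℝ) + 1) * e i) ≤ Real.exp M :=
    Real.exp_le_exp.2 (hM n)
  -- comparison at n
  have hn0 : (0:ℝ) < n := by exact_mod_cast hn1
  have An := nd_nonneg hA n
  have Bn := nd_nonneg hB n
  have f1 : 2 * (A n * B n) ≤ E (n + 1) * A n - E n * A (n + 1) := by
    have := mul_le_mul_of_nonneg_right hnB An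
    have h3 : (n:ℝ) * (2 * (A n * B n)) ≤ n * (E (n + 1) * A n - E n * A (n + 1)) := by linarith
    exact le_of_mul_le_mul_left h3 hn0
  have f2 : |B (n + 1) * A n - B n * A (n + 1)| ≤ A n * B n := by
    have a1 := mul_le_mul_of_nonneg_right (hB n).2 An
    have a2 := mul_le_mul_of_nonneg_left (hA n).2 Bn
    have a3 := mul_nonneg (hB n).1 An
    have a4 := mul_nonneg Bn (hA n).1
    rw [abs_le]; constructor <;> linarith
  have f3 : E (n + 1) * A n - E n * A (n + 1) ≤
      2 * (nd (s' * τ) Q' P' (n + 1) * A n - nd (s' * τ) Q' P' n * A (n + 1)) := by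
    have e1 : nd (s' * τ) Q' P' (n + 1) * A n - nd (s' * τ) Q' P' n * A (n + 1) =
      s' * ((E (n + 1) * A n - E n * A (n + 1)) +
        τ * σ * (B (n + 1) * A n - B n * A (n + 1))) := by
      rw [E''eq, E''eq, E'eq, E'eq]; ring
    have e2 : |s' * ((E (n + 1) * A n - E n * A (n + 1)) +
        τ * σ * (B (n + 1) * A n - B n * A (n + 1)))| = |(E (n + 1) * A n - E n * A (n + 1)) +
        τ * σ * (B (n + 1) * A n - B n * A (n + 1))| := by rw [abs_mul, hs'.abs, one_mul]
    rw [← abs_of_nonneg u2, e1, e2]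
    have e3 := le_abs_self ((E (n + 1) * A n - E n * A (n + 1)) +
        τ * σ * (B (n + 1) * A n - B n * A (n + 1)))
    have e4 : |τ * σ * (B (n + 1) * A n - B n * A (n + 1))| ≤ A n * B n := by
      rw [abs_mul, hςA, one_mul]; exact f2
    have := (abs_le.1 e4).1
    linarith
  have g1 : |nd τ Q' P' 1| = |Q' 1 - P' 1| := abs_nd hτs _ _ _
  rw [E''eq 1, hsw', g1] at u3
  rw [E1] at v4
  set X := Real.exp (∑ i ∈ Finset.range n, ((i:ℝ) + 1) * e i) with hX
  have hXp : 0 < X := Real.exp_pos _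
  have d : 0 ≤ |Q' 1 - P' 1| := abs_nonneg _
  have k1 : w * A 0 ≤ 2 * (|Q' 1 - P' 1| * A 0 * X) * X := by
    refine v4.trans (mul_le_mul_of_nonneg_right ?_ hXp.le)
    linarith
  have k2 : X * X ≤ Real.exp (2 * M) := by
    rw [two_mul, Real.exp_add]
    exact mul_le_mul hexp hexp hXp.le (Real.exp_pos _).le
  have k3 : w * A 0 ≤ 2 * Real.exp (2 * M) * |Q' 1 - P' 1| * A 0 := by
    have := mul_le_mul_of_nonneg_left k2 (mul_nonneg d hA0.le)
    linarith
  exact le_of_mul_le_mul_right k3 hA0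

end BB

namespace BB
variable {S : Sys} (R : Par S)

def Par.Blk (K : ℝ) (p : ℝ × ℝ) : Prop :=
  (∀ n, ∑ i ∈ Finset.range n, R.ρ ^ R.N (S.X p) i ≤ K) ∧
  ∀ i, ∃ k : ℤ, k + R.ρ ^ R.N (S.X p) i / K ≤ S.X p (i + 1) ∧
    S.X p (i + 1) + R.ρ ^ R.N (S.X p) i / K ≤ k + 1

theorem Par.N_mono (x : ℕ → ℝ) {i j : ℕ} (h : i ≤ j) : R.N x i ≤ R.N x j :=
  monotone_nat_of_le_succ (cnt_mono1 R.c x) h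

theorem Par.Blk.mul_le {K : ℝ} {p : ℝ × ℝ} (h : R.Blk K p) (j : ℕ) :
    ((j:ℝ) + 1) * R.ρ ^ R.N (S.X p) j ≤ K := by
  refine le_trans ?_ (h.1 (j + 1))
  have : ∑ i ∈ Finset.range (j + 1), R.ρ ^ R.N (S.X p) j ≤
      ∑ i ∈ Finset.range (j + 1), R.ρ ^ R.N (S.X p) i := by
    apply Finset.sum_le_sum
    intro i hi
    exact pow_le_pow_of_le_one R.ρ0.le R.ρ1.le
      (R.N_mono _ (by rw [Finset.mem_range] at hi; omega))
  simpa using this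

theorem Par.Blk.cell {K : ℝ} (hK : 1 ≤ K) {p : ℝ × ℝ} (h : R.Blk K p) (j : ℕ) :
    Cell (S.K p (j + 1)) (S.X p (j + 1)) ∧
      S.K p (j + 1) + R.ρ ^ R.N (S.X p) j / K ≤ S.X p (j + 1) ∧
      S.X p (j + 1) + R.ρ ^ R.N (S.X p) j / K ≤ S.K p (j + 1) + 1 := by
  obtain ⟨k, h1, h2⟩ := h.2 j
  have : 0 < R.ρ ^ R.N (S.X p) j / K := div_pos (R.ρn0 _) (by linarith)
  have hc : Cell k (S.X p (j + 1)) := ⟨by linarith, by linarith⟩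
  rw [Sys.K, hc.floor]
  exact ⟨hc, h1, h2⟩

theorem Par.Blk.sum3 {K : ℝ} {p : ℝ × ℝ} (h : R.Blk K p) (n : ℕ) :
    ∑ j ∈ Finset.range n, ((j:ℝ) + 1) ^ 2 * R.q ^ R.N (S.X p) j ≤ K ^ 3 := by
  have : ∀ j ∈ Finset.range n, ((j:ℝ) + 1) ^ 2 * R.q ^ R.N (S.X p) j ≤
      K ^ 2 * R.ρ ^ R.N (S.X p) j := by
    intro j _
    have h1 := h.mul_le R j
    have h0 := R.ρn0 (R.N (S.X p) j)
    rw [R.q_pow]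
    set r := R.ρ ^ R.N (S.X p) j
    have : (((j:ℝ) + 1) * r) ^ 2 ≤ K ^ 2 := pow_le_pow_left₀ (by positivity) h1 2
    calc _ = (((j:ℝ) + 1) * r) ^ 2 * r := by ring
      _ ≤ _ := mul_le_mul_of_nonneg_right this h0.le
  refine (Finset.sum_le_sum this).trans ?_
  rw [← Finset.mul_sum]
  have := mul_le_mul_of_nonneg_left (h.1 n) (sq_nonneg K)
  linarith

set_option maxHeartbeats 1000000 in
theorem Par.half (K : ℝ) (hK : 1 ≤ K) : ∃ κ > 0, ∃ C ≥ 0, ∀ Q₁ Q₂ z₁ z₂ : ℝ × ℝ,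
    R.Blk K Q₁ → R.Blk K Q₂ → gd R.c Q₂.2 → |Q₂.1 - Q₁.1| ≤ κ → |Q₂.2 - Q₁.2| ≤ κ →
    S.SL Q₁ z₁ → S.SL Q₂ z₂ → |z₁.1 - Q₁.1| ≤ R.c / 4 →
    |Q₂.2 - Q₁.2| ≤ R.q * |Q₂.1 - Q₁.1| + C * (|z₁.1 - z₂.1| + |z₁.2 - z₂.2|) := by
  have hA := S.A_ge
  have hL := S.L_nonneg
  obtain ⟨J, hJ⟩ := exists_nat_gt (2 * S.A * K ^ 3)
  have hc0 := R.c0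
  have hc1 := R.c1
  have hAJ : 0 < S.A ^ J := by positivity
  have hρJ := R.ρn0 J
  set κ := min (R.c / 4) (R.ρ ^ J / (4 * K * S.A ^ J)) with hκ
  have κ0 : 0 < κ := lt_min (by linarith) (by positivity)
  have κ1 : κ ≤ R.c / 4 := min_le_left _ _
  have κ2 : S.A ^ J * (2 * κ) ≤ R.ρ ^ J / (2 * K) := by
    have : κ ≤ R.ρ ^ J / (4 * K * S.A ^ J) := min_le_right _ _
    rw [le_div_iff₀ (by positivity)] at this ⊢
    linarith
  have κ3 : κ < 1 / K := by
    have a1 : 1 ≤ S.A ^ J := one_le_pow₀ (by linarith)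
    have a2 := R.ρn1 J
    have a3 : R.ρ ^ J / (2 * K) ≤ 1 / (2 * K) := by gcongr
    have a4 : 1 * (2 * κ) ≤ S.A ^ J * (2 * κ) := by gcongr
    have a5 : 1 / (2 * K) < 1 / K := by
      apply one_div_lt_one_div_of_lt <;> linarith
    linarith
  set M := S.L * (2 * S.A * K ^ 3 + 3 * K ^ 3 + K ^ 3) with hM
  refine ⟨κ, κ0, 2 * Real.exp (2 * M), by positivity, ?_⟩
  intro Q₁ Q₂ z₁ z₂ hb1 hb2 hg h1 h2 hs1 hs2 hz1
  obtain ⟨c1, r1, cz1, rz1, bz1⟩ := hs1.rec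
  obtain ⟨c2, r2, cz2, rz2, bz2⟩ := hs2.rec
  -- extended leaves from Q₂
  have ext : ∀ x : ℝ, ∃ y, S.Rec (S.K Q₂) y ∧ y 0 = x ∧ (∀ n, |y n - S.X Q₂ n| ≤ |x - Q₂.1|) ∧
      (|x - Q₂.1| ≤ R.c / 2 → (∀ n, |y n - S.X Q₂ n| ≤ |x - Q₂.1| * R.q ^ R.N (S.X Q₂) n)) := by
    intro x
    obtain ⟨σ, hσ, hσx⟩ := exists_sgn_abs (x - Q₂.1)
    obtain ⟨y, hy, hy0, hd⟩ := S.ext_leaf _ _ r2 σ hσ |x - Q₂.1| (abs_nonneg _)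
    have e0 : y 0 = x := by
      rw [hy0, ← hσx]
      show Q₂.1 + _ = _
      have := hσ.sq
      linear_combination (x - Q₂.1) * this
    have e1 : nd σ y (S.X Q₂) 0 = |x - Q₂.1| := by
      rw [← abs_of_nonneg (nd_nonneg hd 0), abs_nd hσ, e0]; rfl
    refine ⟨y, hy, e0, ?_, ?_⟩
    · intro n
      rw [← abs_nd hσ, abs_of_nonneg (nd_nonneg hd n), ← e1]
      exact dec_le hd n
    · intro h n
      rw [← abs_nd hσ, abs_of_nonneg (nd_nonneg hd n), ← e1]
      exact R.contr _ _ _ r2 hy c2 σ hσ hd (by rw [e1]; exact h) n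
  obtain ⟨P, hP, hP0, hPb, hPc⟩ := ext Q₁.1
  obtain ⟨P', hP', hP0', hPb', hPc'⟩ := ext z₁.1
  rw [abs_sub_comm] at h1
  replace hPc := hPc (by linarith)
  have hz1' : |z₁.1 - Q₂.1| ≤ R.c / 2 := (abs_sub_le _ Q₁.1 _).trans (by linarith)
  replace hPc' := hPc' hz1'
  have hPP : ∀ n, |P' n - P n| ≤ R.q ^ R.N (S.X Q₂) n := by
    intro n
    have a := hPc n
    have b := hPc' n
    have e := abs_sub_le (P' n) (S.X Q₂ n) (P n)
    rw [abs_sub_comm (S.X Q₂ n)] at e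
    have h0 := (R.qn0 (R.N (S.X Q₂) n)).le
    have : (|z₁.1 - Q₂.1| + |Q₁.1 - Q₂.1|) * R.q ^ R.N (S.X Q₂) n ≤ 1 * R.q ^ R.N (S.X Q₂) n :=
      mul_le_mul_of_nonneg_right (by linarith) h0
    linarith
  have hZ : ∀ n, |S.X z₁ n - S.X Q₁ n| ≤ R.q ^ R.N (S.X Q₁) n := by
    intro n
    refine (R.SL_contr hs1 (by linarith) n).trans ?_
    have h0 := (R.qn0 (R.N (S.X Q₁) n)).le
    have : |z₁.1 - Q₁.1| * R.q ^ R.N (S.X Q₁) n ≤ 1 * R.q ^ R.N (S.X Q₁) n :=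
      mul_le_mul_of_nonneg_right (by linarith) h0
    linarith
  -- P 1
  have hP1 : |Q₂.2 - P 1| ≤ R.q * |Q₂.1 - Q₁.1| := by
    have := hPc 1
    have e : R.N (S.X Q₂) 1 = 1 := by simp [Par.N, cnt, Sys.X, hg]
    rw [e, pow_one] at this
    rw [abs_sub_comm, abs_sub_comm Q₂.1, mul_comm]
    exact this
  have hP1' : |z₁.2 - P' 1| ≤ |z₁.1 - z₂.1| + |z₁.2 - z₂.2| := by
    obtain ⟨σ, hσ, e0, _, hd⟩ := S.pair _ _ _ rz2 hP' (R.c / 2 + 1) (by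
      intro n
      refine (abs_sub_le _ (S.X Q₂ (n+1)) _).trans ?_
      have := bz2 n
      rw [abs_sub_comm] at this
      linarith [hPb' (n + 1)])
    have a := (hd 0).2
    rw [e0, ← abs_of_nonneg (hd 0).1, abs_nd hσ, hP0'] at a
    have a' : |P' 1 - z₂.2| ≤ |z₁.1 - z₂.1| := a
    refine (abs_sub_le _ z₂.2 _).trans ?_
    rw [abs_sub_comm z₂.2]; linarith
  set w := |S.X Q₁ 1 - P 1| with hw
  have hwle : w ≤ 2 * κ := by
    refine (abs_sub_le _ Q₂.2 _).trans ?_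
    have : R.q * |Q₂.1 - Q₁.1| ≤ 1 * κ := by
      rw [abs_sub_comm]
      exact mul_le_mul R.q1.le h1 (abs_nonneg _) zero_le_one
    have e : |S.X Q₁ 1 - Q₂.2| = |Q₂.2 - Q₁.2| := abs_sub_comm _ _
    linarith
  suffices hmain : w ≤ 2 * Real.exp (2 * M) * |S.X z₁ 1 - P' 1| by
    have t1 := abs_sub_le Q₂.2 (P 1) Q₁.2
    have t2 : |P 1 - Q₁.2| = w := abs_sub_comm _ _
    have t3 : |S.X z₁ 1 - P' 1| ≤ |z₁.1 - z₂.1| + |z₁.2 - z₂.2| := hP1'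
    have t4 := mul_le_mul_of_nonneg_left t3 (by positivity : 0 ≤ 2 * Real.exp (2 * M))
    linarith
  have hMM : 0 ≤ M := by positivity
  obtain ⟨σ, hσ, eA0, eA, hdA⟩ := S.pair _ _ _ hP hP' 1 (fun n => (hPP _).trans (R.qn1 _))
  obtain ⟨σ', hσ', eB0, eB, hdB⟩ := S.pair _ _ _ r1 rz1 1 bz1
  by_cases hzz : z₁.1 = Q₁.1
  · have a := (hdA 0).2
    rw [eA0, ← abs_of_nonneg (hdA 0).1, abs_nd hσ, hP0', hP0, hzz, sub_self, abs_zero] at a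
    have b := (hdB 0).2
    rw [eB0, ← abs_of_nonneg (hdB 0).1, abs_nd hσ'] at b
    change |S.X z₁ 1 - S.X Q₁ 1| ≤ |z₁.1 - Q₁.1| at b
    rw [hzz, sub_self, abs_zero] at b
    have a' := abs_nonpos_iff.1 a
    have b' := abs_nonpos_iff.1 b
    have e1 : P' 1 = P 1 := by simpa using sub_eq_zero.1 a'
    rw [sub_eq_zero.1 b', e1, ← hw]
    have := Real.one_le_exp (by positivity : 0 ≤ 2 * M)
    nlinarith [abs_nonneg (S.X Q₁ 1 - P 1)]
  have hpos : 0 < |z₁.1 - Q₁.1| := abs_pos.2 (sub_ne_zero.2 hzz)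
  have hσσ : σ' = σ := by
    rw [hP0', hP0] at eA
    have eB' : z₁.1 = Q₁.1 + σ' * |z₁.1 - Q₁.1| := eB
    have : (σ' - σ) * |z₁.1 - Q₁.1| = 0 := by linear_combination eA - eB'
    rcases mul_eq_zero.1 this with h | h
    · linarith
    · exact absurd h hpos.ne'
  subst hσσ
  have hBj : ∀ j, nd σ' (S.X z₁) (S.X Q₁) j ≤ R.q ^ R.N (S.X Q₁) j := by
    intro j
    rw [← abs_of_nonneg (nd_nonneg hdB j), abs_nd hσ']; exact hZ j
  have hAj : ∀ j, nd σ' P' P j ≤ R.q ^ R.N (S.X Q₂) j := by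
    intro j
    rw [← abs_of_nonneg (nd_nonneg hdA j), abs_nd hσ']; exact hPP j
  have qmono : ∀ x j, R.q ^ R.N x (j + 1) ≤ R.q ^ R.N x j := fun x j =>
    pow_le_pow_of_le_one R.q0.le R.q1.le (R.N_mono _ (by omega))
  refine S.gap (S.K Q₂) (S.K Q₁) P P' (S.X Q₁) (S.X z₁) hP hP' r1 rz1 σ' hσ' hP0 hP0' hdA hdB
    (by rw [eA0, hP0, hP0']; exact hpos) w rfl
    (fun j => 2 * S.A * (j + 1) * R.q ^ R.N (S.X Q₁) j) ?_ ?_ ?_ M ?_ ?_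
  · simp [Par.N, cnt]; linarith
  · intro j
    have : 0 ≤ 2 * S.A * ((j:ℝ) + 1) := by positivity
    exact mul_le_mul_of_nonneg_left (hBj j) this
  · intro j ha hb
    obtain ⟨-, m1, m2⟩ := hb1.cell R hK j
    obtain ⟨-, n1, n2⟩ := hb2.cell R hK j
    have hr0 := R.ρn0 (R.N (S.X Q₁) j)
    have hlt : |S.X Q₁ (j + 1) - P (j + 1)| < R.ρ ^ R.N (S.X Q₁) j / K := by
      rw [lt_div_iff₀ (by linarith)]
      rcases lt_or_ge j J with hj | hj
      · have a1 : S.A ^ j ≤ S.A ^ J := pow_le_pow_right₀ (by linarith) hj.le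
        have a2 : S.A ^ j * w ≤ S.A ^ J * (2 * κ) := mul_le_mul a1 hwle (abs_nonneg _) hAJ.le
        have a3 : R.ρ ^ J ≤ R.ρ ^ R.N (S.X Q₁) j := pow_le_pow_of_le_one R.ρ0.le R.ρ1.le
          ((cnt_le _ _ _).trans hj.le)
        have a4 := ha.trans (a2.trans κ2)
        rw [le_div_iff₀ (by linarith)] at a4
        linarith
      · have a1 := hb1.mul_le R j
        have a2 : (J:ℝ) ≤ j := by exact_mod_cast hj
        simp only [R.q_pow] at hb
        set r := R.ρ ^ R.N (S.X Q₁) j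
        have a3 : (((j:ℝ) + 1) * r) ^ 2 ≤ K ^ 2 := pow_le_pow_left₀ (by positivity) a1 2
        have a4 : 2 * S.A * K * (((j:ℝ) + 1) * r) ^ 2 ≤ 2 * S.A * K * K ^ 2 :=
          mul_le_mul_of_nonneg_left a3 (by positivity)
        have a5 : ((j:ℝ) + 1) * (2 * S.A * ((j:ℝ) + 1) * r ^ 3 * K) < ((j:ℝ) + 1) * r := by
          have : 2 * S.A * K * (((j:ℝ) + 1) * r) ^ 2 * r ≤ (2 * S.A * K * K ^ 2) * r :=
            mul_le_mul_of_nonneg_right a4 hr0.le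
          have : (2 * S.A * K * K ^ 2) * r < ((j:ℝ) + 1) * r :=
            mul_lt_mul_of_pos_right (by linarith) hr0
          linarith
        have a6 := lt_of_mul_lt_mul_left a5 (by positivity)
        exact lt_of_le_of_lt (mul_le_mul_of_nonneg_right hb (by linarith)) a6
    have hlt2 : |P (j + 1) - S.X Q₂ (j + 1)| < R.ρ ^ R.N (S.X Q₂) j / K := by
      refine (hPc (j + 1)).trans_lt ?_
      have a1 := (qmono (S.X Q₂) j).trans (R.q_le_ρ _)
      have a2 : |Q₁.1 - Q₂.1| * R.q ^ R.N (S.X Q₂) (j + 1) ≤ κ * R.ρ ^ R.N (S.X Q₂) j :=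
        mul_le_mul h1 a1 (R.qn0 _).le κ0.le
      have a3 := mul_lt_mul_of_pos_right κ3 (R.ρn0 (R.N (S.X Q₂) j))
      rw [one_div_mul_eq_div] at a3
      linarith
    rw [abs_lt] at hlt hlt2
    have c1 : Cell (S.K Q₁ (j + 1)) (P (j + 1)) := ⟨by linarith, by linarith⟩
    have c2 : Cell (S.K Q₂ (j + 1)) (P (j + 1)) := ⟨by linarith, by linarith⟩
    rw [← c1.floor, ← c2.floor]
  · intro n
    have key : ∀ j ∈ Finset.range n, ((j:ℝ) + 1) * (S.L * (2 * S.A * ((j:ℝ) + 1) *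
        R.q ^ R.N (S.X Q₁) j + 3 * nd σ' P' P (j + 1) + nd σ' (S.X z₁) (S.X Q₁) (j + 1))) ≤
        S.L * (2 * S.A + 1) * (((j:ℝ) + 1) ^ 2 * R.q ^ R.N (S.X Q₁) j) +
        S.L * 3 * (((j:ℝ) + 1) ^ 2 * R.q ^ R.N (S.X Q₂) j) := by
      intro j _
      have a1 := (hAj (j + 1)).trans (qmono _ _)
      have a2 := (hBj (j + 1)).trans (qmono _ _)
      have q1 := (R.qn0 (R.N (S.X Q₁) j)).le
      have q2 := (R.qn0 (R.N (S.X Q₂) j)).le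
      have hj : (1:ℝ) ≤ (j:ℝ) + 1 := by linarith [Nat.cast_nonneg (α := ℝ) j]
      have b1 : R.q ^ R.N (S.X Q₁) j ≤ ((j:ℝ) + 1) * R.q ^ R.N (S.X Q₁) j := le_mul_of_one_le_left q1 hj
      have b2 : R.q ^ R.N (S.X Q₂) j ≤ ((j:ℝ) + 1) * R.q ^ R.N (S.X Q₂) j := le_mul_of_one_le_left q2 hj
      calc _ ≤ ((j:ℝ) + 1) * (S.L * (2 * S.A * ((j:ℝ) + 1) * R.q ^ R.N (S.X Q₁) j +
            3 * (((j:ℝ) + 1) * R.q ^ R.N (S.X Q₂) j) + ((j:ℝ) + 1) * R.q ^ R.N (S.X Q₁) j)) := by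
            gcongr <;> linarith
        _ = _ := by ring
    refine (Finset.sum_le_sum key).trans ?_
    rw [Finset.sum_add_distrib, ← Finset.mul_sum, ← Finset.mul_sum]
    have s1 := mul_le_mul_of_nonneg_left (hb1.sum3 R n) (by positivity : 0 ≤ S.L * (2 * S.A + 1))
    have s2 := mul_le_mul_of_nonneg_left (hb2.sum3 R n) (by positivity : 0 ≤ S.L * 3)
    rw [hM]; linarith
  · intro hwp
    obtain ⟨n, hn⟩ := exists_nat_gt (2 * K ^ 2 / w)
    rw [div_lt_iff₀ hwp] at hn
    refine ⟨n + 1, by omega, ?_⟩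
    have a1 := hBj (n + 1)
    have a2 := hb1.mul_le R (n + 1)
    rw [R.q_pow] at a1
    have r0 := R.ρn0 (R.N (S.X Q₁) (n + 1))
    have r1 := R.ρn1 (R.N (S.X Q₁) (n + 1))
    set r := R.ρ ^ R.N (S.X Q₁) (n + 1)
    push_cast at a2 ⊢
    have hn0 : (0:ℝ) < (n:ℝ) + 1 := by positivity
    have a3 : ((n:ℝ) + 1) * r ≤ K := by linarith
    have a4 : (((n:ℝ) + 1) * r) ^ 2 ≤ K ^ 2 := pow_le_pow_left₀ (by positivity) a3 2
    have a5 : ((n:ℝ) + 1) * (2 * ((n:ℝ) + 1) * r ^ 3) ≤ ((n:ℝ) + 1) * w := by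
      have : (((n:ℝ) + 1) * r) ^ 2 * r ≤ K ^ 2 * 1 := mul_le_mul a4 r1 r0.le (by positivity)
      linarith
    have a6 := le_of_mul_le_mul_left a5 hn0
    have : 2 * ((n:ℝ) + 1) * nd σ' (S.X z₁) (S.X Q₁) (n + 1) ≤ 2 * ((n:ℝ) + 1) * r ^ 3 :=
      mul_le_mul_of_nonneg_left a1 (by positivity)
    linarith
end BB

namespace BB
variable {S : Sys} (R : Par S)

theorem Par.lipinv (K : ℝ) (hK : 1 ≤ K) (r : ℝ) : ∃ κ > 0, ∃ C ≥ 0, ∀ P₁ P₂ z₁ z₂ : ℝ × ℝ,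
    R.Blk K (P₁.1, P₁.2 + r) → R.Blk K (P₂.1, P₂.2 + r) → R.Blk K P₁.swap → R.Blk K P₂.swap →
    gd R.c (P₂.2 + r) → gd R.c P₂.1 → |P₂.1 - P₁.1| ≤ κ → |P₂.2 - P₁.2| ≤ κ →
    S.SL (P₁.1, P₁.2 + r) z₁ → S.SL (P₂.1, P₂.2 + r) z₂ → S.SL P₁.swap z₁.swap →
    S.SL P₂.swap z₂.swap → |z₁.1 - P₁.1| ≤ R.c / 4 → |z₁.2 - P₁.2| ≤ R.c / 4 →
    |P₂.1 - P₁.1| + |P₂.2 - P₁.2| ≤ C * (|z₁.1 - z₂.1| + |z₁.2 - z₂.2|) := by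
  obtain ⟨κ, hκ, C, hC, h⟩ := R.half K hK
  have hq : 0 < 1 - R.q := by linarith [R.q1]
  refine ⟨κ, hκ, 2 * C / (1 - R.q), by positivity, ?_⟩
  intro P₁ P₂ z₁ z₂ b1 b2 b3 b4 g1 g2 k1 k2 s1 s2 s3 s4 t1 t2
  have a1 := h _ _ z₁ z₂ b1 b2 g1 k1 (by simpa using k2) s1 s2 t1
  have a2 := h _ _ z₁.swap z₂.swap b3 b4 g2 k2 k1 s3 s4 t2
  simp only [Prod.fst_swap, Prod.snd_swap, add_sub_add_right_eq_sub] at a1 a2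
  rw [div_mul_eq_mul_div, le_div_iff₀ hq]
  linarith

/-! the map -/
variable (S) in
noncomputable def Sys.T (p : ℝ × ℝ) : ℝ × ℝ := (p.2, S.φ p.2 - p.1)

theorem Sys.X_T (p) : ∀ n, S.X (S.T p) n = S.X p (n + 1)
  | 0 => rfl
  | 1 => rfl
  | (n + 2) => by
    rw [S.X_succ2, S.X_succ2, Sys.X_T p (n + 1), Sys.X_T p n]

theorem Sys.X_iter (p) (i n) : S.X (S.T^[i] p) n = S.X p (n + i) := by
  induction i generalizing p with
  | zero => rfl
  | succ i ih => rw [Function.iterate_succ_apply, ih, S.X_T, add_assoc]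

theorem Sys.T_iter (p) (i) : S.T^[i] p = (S.X p i, S.X p (i + 1)) := by
  have h0 := S.X_iter p i 0
  have h1 := S.X_iter p i 1
  rw [zero_add] at h0
  rw [add_comm] at h1
  exact Prod.ext h0 h1

theorem Sys.T_swap_T (p) : S.T (S.T p).swap = p.swap := by
  simp [Sys.T, Prod.swap]

variable (S) in
noncomputable def Sys.Ti (p : ℝ × ℝ) : ℝ × ℝ := (S.T p.swap).swap

theorem Sys.T_Ti (p) : S.T (S.Ti p) = p := by
  rw [Sys.Ti, S.T_swap_T, Prod.swap_swap]
theorem Sys.Ti_T (p) : S.Ti (S.T p) = p := by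
  rw [Sys.Ti, S.T_swap_T, Prod.swap_swap]

theorem Sys.T_meas : Measurable S.T :=
  measurable_snd.prodMk ((S.meas.comp measurable_snd).sub measurable_fst)
theorem Sys.Ti_meas : Measurable S.Ti :=
  measurable_swap.comp (S.T_meas.comp measurable_swap)

theorem Sys.X_meas : ∀ n, Measurable fun p => S.X p n
  | 0 => measurable_fst
  | 1 => measurable_snd
  | (n + 2) => (S.meas.comp (Sys.X_meas (n + 1))).sub (Sys.X_meas n)

def Per (E : Set (ℝ × ℝ)) : Prop :=
  MeasurableSet E ∧ ∀ p : ℝ × ℝ, ∀ m n : ℤ, (p.1 + 2 * m, p.2 + 2 * n) ∈ E ↔ p ∈ E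

theorem Sys.X_per (p : ℝ × ℝ) (m n : ℤ) : ∀ i, ∃ j : ℤ,
    S.X (p.1 + 2 * m, p.2 + 2 * n) i = S.X p i + 2 * j
  | 0 => ⟨m, rfl⟩
  | 1 => ⟨n, rfl⟩
  | (i + 2) => by
    obtain ⟨a, ha⟩ := Sys.X_per p m n (i + 1)
    obtain ⟨b, hb⟩ := Sys.X_per p m n i
    refine ⟨2 * a - b, ?_⟩
    have := S.per_int (2 * a) (S.X p (i + 1))
    rw [S.X_succ2, S.X_succ2, ha, hb]
    push_cast at this ⊢
    rw [this]; ring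

theorem Sys.X_fract (p : ℝ × ℝ) (m n : ℤ) (i) :
    Int.fract (S.X (p.1 + 2 * m, p.2 + 2 * n) i) = Int.fract (S.X p i) := by
  obtain ⟨j, hj⟩ := S.X_per p m n i
  rw [hj]
  have := Int.fract_add_intCast (S.X p i) (2 * j)
  push_cast at this
  exact this

theorem Per.T {E} (h : Per E) : Per (S.T ⁻¹' E) := by
  refine ⟨S.T_meas h.1, fun p m n => ?_⟩
  have := h.2 (S.T p) n (2 * n - m)
  rw [mem_preimage, mem_preimage, ← this]
  have e := S.per_int (2 * n) p.2
  simp only [Sys.T]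
  push_cast at e ⊢
  rw [e]
  ring_nf

theorem Per.swap {E} (h : Per E) : Per (Prod.swap ⁻¹' E) :=
  ⟨measurable_swap h.1, fun p m n => h.2 p.swap n m⟩

theorem Per.add {E} (h : Per E) (v : ℝ × ℝ) : Per ((fun p => p + v) ⁻¹' E) := by
  refine ⟨(measurable_add_const v) h.1, fun p m n => ?_⟩
  have := h.2 (p + v) m n
  rw [mem_preimage, mem_preimage, ← this]
  have e : (p.1 + 2 * (m:ℝ), p.2 + 2 * (n:ℝ)) + v = ((p + v).1 + 2 * m, (p + v).2 + 2 * n) := by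
    ext <;> simp <;> ring
  rw [e]

theorem Per.Ti {E} (h : Per E) : Per (S.Ti ⁻¹' E) := h.swap.T.swap
theorem Per.compl {E} (h : Per E) : Per Eᶜ := ⟨h.1.compl, fun p m n => not_congr (h.2 p m n)⟩
theorem Per.inter {E F} (h : Per E) (h' : Per F) : Per (E ∩ F) :=
  ⟨h.1.inter h'.1, fun p m n => and_congr (h.2 p m n) (h'.2 p m n)⟩
theorem Per.union {E F} (h : Per E) (h' : Per F) : Per (E ∪ F) :=
  ⟨h.1.union h'.1, fun p m n => or_congr (h.2 p m n) (h'.2 p m n)⟩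
theorem Per.univ : Per univ := ⟨MeasurableSet.univ, fun _ _ _ => Iff.rfl⟩
theorem Per.iUnion {E : ℕ → Set (ℝ × ℝ)} (h : ∀ i, Per (E i)) : Per (⋃ i, E i) :=
  ⟨MeasurableSet.iUnion fun i => (h i).1, fun p m n => by
    simp only [mem_iUnion]; exact exists_congr fun i => (h i).2 p m n⟩

def I2 : Set ℝ := Ico 0 2
noncomputable def μ : Measure (ℝ × ℝ) := (volume.restrict I2).prod (volume.restrict I2)

theorem μ_eq : μ = volume.restrict (I2 ×ˢ I2) := by
  rw [μ, Measure.prod_restrict]; rfl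

instance : IsFiniteMeasure (volume.restrict I2) := ⟨by simp [I2]⟩
instance : IsFiniteMeasure μ := by unfold μ; infer_instance

theorem μ_univ : μ univ = 4 := by
  rw [μ_eq, Measure.restrict_apply_univ, Measure.volume_eq_prod, Measure.prod_prod]
  simp only [I2, Real.volume_Ico]
  rw [← ENNReal.ofReal_mul (by norm_num)]; norm_num

theorem per1 (s : Set ℝ) (hs : MeasurableSet s) (h : ∀ x : ℝ, ∀ n : ℤ, x + 2 * n ∈ s ↔ x ∈ s) (a : ℝ) :
    volume (s ∩ Ioc a (a + 2)) = volume (s ∩ I2) := by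
  have h1 := isAddFundamentalDomain_Ioc (two_pos : (0:ℝ) < 2) a volume
  have h2 := isAddFundamentalDomain_Ioc (two_pos : (0:ℝ) < 2) 0 volume
  have := h1.measure_set_eq h2 hs (by
    rintro ⟨g, hg⟩
    obtain ⟨n, rfl⟩ := hg
    ext x
    have := h x n
    rw [mem_preimage, ← this, AddSubgroup.vadd_def, vadd_eq_add]
    simp only [zsmul_eq_mul]
    rw [add_comm x, mul_comm])
  rw [this, I2, zero_add]
  exact measure_congr ((ae_eq_refl s).inter Ico_ae_eq_Ioc.symm)

theorem per1_neg (s : Set ℝ) (hs : MeasurableSet s) (h : ∀ x : ℝ, ∀ n : ℤ, x + 2 * n ∈ s ↔ x ∈ s)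
    (a : ℝ) : volume ({x | a - x ∈ s} ∩ I2) = volume (s ∩ I2) := by
  rw [← per1 s hs h (a - 2)]
  have := (Measure.measurePreserving_sub_left (volume : Measure ℝ) a).measure_preimage
    (hs.inter (measurableSet_Ioc (a := a - 2) (b := a))).nullMeasurableSet
  rw [show a - 2 + 2 = a by ring, ← this]
  congr 1
  ext x
  simp only [I2, mem_inter_iff, mem_ofPred_eq, mem_preimage, mem_Ico, mem_Ioc]
  constructor
  · rintro ⟨h, h1, h2⟩; exact ⟨h, by linarith, by linarith⟩
  · rintro ⟨h, h1, h2⟩; exact ⟨h, by linarith, by linarith⟩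

theorem per1_add (s : Set ℝ) (hs : MeasurableSet s) (h : ∀ x : ℝ, ∀ n : ℤ, x + 2 * n ∈ s ↔ x ∈ s)
    (a : ℝ) : volume ({x | x + a ∈ s} ∩ I2) = volume (s ∩ I2) := by
  have h1 := per1_neg s hs h 0
  have := per1_neg {x | 0 - x ∈ s} ((measurable_const.sub measurable_id) hs) (fun x n => by
    have := h (0 - x) (-n)
    push_cast at this
    simp only [mem_ofPred_eq]
    rw [← this]; ring_nf) (-a)
  rw [h1] at this
  rw [← this]
  congr 2
  ext x
  simp only [mem_ofPred_eq]
  ring_nf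

theorem μ_fub {E} (h : MeasurableSet E) :
    μ E = ∫⁻ y in I2, volume ({x | (x, y) ∈ E} ∩ I2) := by
  rw [μ, Measure.prod_apply_symm h]
  apply lintegral_congr
  intro y
  rw [Measure.restrict_apply]; rfl
  exact measurable_prodMk_right h

theorem Per.sec {E} (h : Per E) (y : ℝ) : MeasurableSet {x | (x, y) ∈ E} ∧
    ∀ x : ℝ, ∀ n : ℤ, x + 2 * n ∈ {x | (x, y) ∈ E} ↔ x ∈ {x | (x, y) ∈ E} :=
  ⟨measurable_prodMk_right h.1, fun x n => by simpa using h.2 (x, y) n 0⟩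

theorem Per.μ_swap {E} (h : Per E) : μ (Prod.swap ⁻¹' E) = μ E := by
  rw [← Measure.map_apply measurable_swap h.1, μ, Measure.prod_swap]

theorem Per.μ_T {E} (h : Per E) : μ (S.T ⁻¹' E) = μ E := by
  rw [← h.μ_swap, μ_fub h.T.1, μ_fub h.swap.1]
  apply lintegral_congr
  intro y
  exact per1_neg _ (h.swap.sec y).1 (h.swap.sec y).2 (S.φ y)

theorem Per.μ_add1 {E} (h : Per E) (a : ℝ) : μ ((fun p => p + (a, 0)) ⁻¹' E) = μ E := by
  rw [μ_fub (h.add _).1, μ_fub h.1]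
  apply lintegral_congr
  intro y
  have := per1_add _ (h.sec y).1 (h.sec y).2 a
  simpa using this

theorem Per.μ_add {E} (h : Per E) (v : ℝ × ℝ) : μ ((fun p => p + v) ⁻¹' E) = μ E := by
  have h1 := h.swap.μ_add1 v.2
  have h2 := ((h.swap.add (v.2, 0)).swap).μ_add1 v.1
  rw [(h.swap.add (v.2, 0)).μ_swap, h1, h.μ_swap] at h2
  rw [← h2]
  congr 1
  ext p
  simp [Prod.swap, Prod.add_def]

theorem Per.iter {E} (h : Per E) (n : ℕ) : Per (S.T^[n] ⁻¹' E) := by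
  induction n with
  | zero => exact h
  | succ n ih => rw [Function.iterate_succ, preimage_comp]; exact ih.T

theorem Per.μ_iter {E} (h : Per E) (n : ℕ) : μ (S.T^[n] ⁻¹' E) = μ E := by
  induction n with
  | zero => rfl
  | succ n ih => rw [Function.iterate_succ, preimage_comp, (h.iter n).μ_T, ih]

theorem Per.Ti_iter {E} (h : Per E) (n : ℕ) : Per (S.Ti^[n] ⁻¹' E) := by
  induction n with
  | zero => exact h
  | succ n ih => rw [Function.iterate_succ, preimage_comp]; exact ih.Ti

theorem Per.μ_Ti {E} (h : Per E) : μ (S.Ti ⁻¹' E) = μ E := by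
  rw [← h.Ti.μ_T (S := S), ← preimage_comp]
  congr 1
  ext p
  simp [S.Ti_T]

theorem Per.μ_Ti_iter {E} (h : Per E) (n : ℕ) : μ (S.Ti^[n] ⁻¹' E) = μ E := by
  induction n with
  | zero => rfl
  | succ n ih => rw [Function.iterate_succ, preimage_comp, (h.Ti_iter n).μ_Ti, ih]

theorem Per.vol_sq {E} (h : Per E) (v : ℝ × ℝ) :
    volume (E ∩ Ico v.1 (v.1 + 2) ×ˢ Ico v.2 (v.2 + 2)) = μ E := by
  rw [← h.μ_add v, μ_eq, Measure.restrict_apply (h.add v).1]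
  have := measure_preimage_add_right (volume : Measure (ℝ × ℝ)) v
    (E ∩ Ico v.1 (v.1 + 2) ×ˢ Ico v.2 (v.2 + 2))
  rw [← this]
  congr 1
  ext p
  simp [I2, add_comm v.1, add_comm v.2]
end BB

namespace BB
variable {S : Sys} (R : Par S)

theorem lipvol (s : Set (ℝ × ℝ)) (u : ℝ × ℝ → ℝ × ℝ) (C : NNReal)
    (h : ∀ P ∈ s, ∀ P' ∈ s, dist P P' ≤ C * dist (u P) (u P')) :
    volume s ≤ (C:ENNReal) ^ (2:ℝ) * volume (u '' s) := by
  have hg : ∀ y ∈ u '' s, Function.invFunOn u s y ∈ s ∧ u (Function.invFunOn u s y) = y :=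
    fun y hy => ⟨Function.invFunOn_mem hy, Function.invFunOn_eq hy⟩
  have hl : LipschitzOnWith C (Function.invFunOn u s) (u '' s) := by
    apply LipschitzOnWith.of_dist_le_mul
    intro x hx y hy
    have := h _ (hg x hx).1 _ (hg y hy).1
    rwa [(hg x hx).2, (hg y hy).2] at this
  have := hl.hausdorffMeasure_image_le (d := 2) (by norm_num)
  rw [hausdorffMeasure_prod_real] at this
  refine (measure_mono ?_).trans this
  intro P hP
  refine ⟨u P, mem_image_of_mem _ hP, ?_⟩
  have hy := hg _ (mem_image_of_mem u hP)
  have := h _ hy.1 _ hP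
  rw [hy.2, dist_self, mul_zero] at this
  exact dist_le_zero.1 this

noncomputable def red (x : ℝ) : ℝ := x - 2 * ⌊x / 2⌋

theorem red_mem (x : ℝ) : red x ∈ I2 := by
  unfold red I2
  have h1 := Int.floor_le (x / 2)
  have h2 := Int.lt_floor_add_one (x / 2)
  constructor <;> linarith

theorem floor_half {k : ℤ} {x : ℝ} (h : Cell k x) : ⌊x / 2⌋ = k / 2 := by
  have h1 := Int.emod_add_mul_ediv k 2
  have h2 := Int.emod_nonneg k (two_ne_zero)
  have h3 := Int.emod_lt_of_pos k (two_pos)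
  have h4 : (k:ℝ) = ((k % 2 : ℤ) : ℝ) + 2 * ((k / 2 : ℤ) : ℝ) := by exact_mod_cast h1.symm
  have h5 : (0:ℝ) ≤ ((k % 2 : ℤ) : ℝ) := by exact_mod_cast h2
  have h6 : ((k % 2 : ℤ) : ℝ) ≤ 1 := by exact_mod_cast (by omega : k % 2 ≤ 1)
  rw [Int.floor_eq_iff]
  constructor <;> linarith [h.1, h.2]

theorem red_sub {k : ℤ} {x y : ℝ} (hx : Cell k x) (hy : Cell k y) : red x - red y = x - y := by
  unfold red
  rw [floor_half hx, floor_half hy]; ring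

theorem red_meas : Measurable red := by
  unfold red
  fun_prop

theorem Per.red {E} (h : Per E) (p : ℝ × ℝ) : (red p.1, red p.2) ∈ E ↔ p ∈ E := by
  rw [← h.2 p (-⌊p.1 / 2⌋) (-⌊p.2 / 2⌋)]
  simp [BB.red, sub_eq_add_neg]

theorem red_id {x : ℝ} (h : x ∈ I2) : red x = x := by
  unfold red
  have : ⌊x / 2⌋ = 0 := Int.floor_eq_iff.2 ⟨by simp; linarith [h.1], by simp; linarith [h.2]⟩
  rw [this]; simp

theorem red_add (x : ℝ) (n : ℤ) : red (x + 2 * n) = red x := by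
  unfold red
  have : (x + 2 * n) / 2 = x / 2 + n := by ring
  rw [this, Int.floor_add_intCast]; push_cast; ring

/-- periodization of a set -/
theorem per_red (K : Set (ℝ × ℝ)) (hK : MeasurableSet K) : Per {p | (red p.1, red p.2) ∈ K} :=
  ⟨((red_meas.comp measurable_fst).prodMk (red_meas.comp measurable_snd)) hK, fun p m n => by
    show (red (p.1 + 2 * m), red (p.2 + 2 * n)) ∈ K ↔ (red p.1, red p.2) ∈ K
    rw [red_add, red_add]⟩

theorem theta (A : Set (ℝ × ℝ)) (hA : Per A) (hT : ∀ p, S.T p ∈ A ↔ p ∈ A) (B : Set (ℝ × ℝ))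
    (u Z : ℝ × ℝ → ℝ × ℝ) (C : NNReal)
    (hu : ∀ P ∈ B, ∀ P' ∈ B, dist P P' ≤ C * dist (u P) (u P'))
    (hZ : ∀ P ∈ B, ∀ P' ∈ B, dist P P' ≤ C * dist (Z P) (Z P')) (v : ℝ × ℝ)
    (hu' : ∀ P ∈ B, u P ∈ Ico v.1 (v.1 + 2) ×ˢ Ico v.2 (v.2 + 2))
    (hZ' : ∀ P ∈ B, Z P ∈ Ico v.1 (v.1 + 2) ×ˢ Ico v.2 (v.2 + 2))
    (hSL : ∀ P ∈ B, S.SL (u P) (Z P)) (ω : ℕ → ℝ) (hω : Tendsto ω atTop (nhds 0))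
    (hd : ∀ P ∈ B, ∀ n, |S.X (Z P) n - S.X (u P) n| ≤ ω n) :
    volume {P | P ∈ B ∧ ¬(u P ∈ A ↔ Z P ∈ A)} = 0 := by
  have key : ∀ δ : NNReal, 0 < δ → volume {P | P ∈ B ∧ ¬(u P ∈ A ↔ Z P ∈ A)} ≤
      ((C:ENNReal) ^ (2:ℝ) * 4) * δ := by
    intro δ hδ
    have hδ' : (δ:ENNReal) ≠ 0 := by simpa using hδ.ne'
    have hm := hA.1
    obtain ⟨K1, k1s, k1c, k1m⟩ := hm.exists_isCompact_sdiff_lt (μ := μ) (measure_ne_top _ _) hδ'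
    obtain ⟨K2, k2s, k2c, k2m⟩ := hm.compl.exists_isCompact_sdiff_lt (μ := μ) (measure_ne_top _ _) hδ'
    obtain ⟨d, hd0, hdist⟩ := Metric.exists_pos_forall_lt_edist k1c k2c.isClosed
      (disjoint_compl_right.mono k1s k2s)
    set V : Set (ℝ × ℝ) := {p | (red p.1, red p.2) ∈ (K1 ∪ K2)ᶜ} with hV
    have hVp : Per V := per_red _ (k1c.measurableSet.union k2c.measurableSet).compl
    have hVm : μ V ≤ 2 * δ := by
      have : μ V ≤ μ (A \ K1 ∪ Aᶜ \ K2) := by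
        rw [μ_eq, Measure.restrict_apply hVp.1]
        refine (measure_mono ?_).trans (Measure.le_restrict_apply _ _)
        rintro p ⟨hp, hp1, hp2⟩
        refine ⟨?_, hp1, hp2⟩
        simp only [hV, mem_ofPred_eq] at hp
        rw [red_id hp1, red_id hp2] at hp
        simp only [mem_compl_iff, mem_union, not_or] at hp
        by_cases hpa : p ∈ A
        · left; exact ⟨hpa, hp.1⟩
        · right; exact ⟨hpa, hp.2⟩
      refine this.trans ((measure_union_le _ _).trans ?_)
      rw [two_mul]
      exact add_le_add k1m.le k2m.le
    obtain ⟨n, hn⟩ := ((hω.comp (tendsto_add_atTop_nat 1)).eventually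
      (Iio_mem_nhds (by exact_mod_cast hd0 : (0:ℝ) < d))).and
      ((hω.comp (tendsto_add_atTop_nat 2)).eventually
      (Iio_mem_nhds (by exact_mod_cast hd0 : (0:ℝ) < d))) |>.exists
    have hTn : ∀ p, ∀ n, S.T^[n] p ∈ A ↔ p ∈ A := by
      intro p n
      induction n with
      | zero => exact Iff.rfl
      | succ n ih => rw [Function.iterate_succ_apply', hT, ih]
    have hsub : {P | P ∈ B ∧ ¬(u P ∈ A ↔ Z P ∈ A)} ⊆
        {P | P ∈ B ∧ S.T^[n + 1] (u P) ∈ V} ∪ {P | P ∈ B ∧ S.T^[n + 1] (Z P) ∈ V} := by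
      rintro P ⟨hP, hbad⟩
      by_contra hcon
      simp only [mem_union, mem_ofPred_eq, not_or, hP, true_and] at hcon
      obtain ⟨n1, n2⟩ := hcon
      rw [← hTn (u P) (n + 1), ← hTn (Z P) (n + 1)] at hbad
      have hs := hSL P hP
      have d1 := hd P hP (n + 1)
      have d2 := hd P hP (n + 2)
      rw [S.T_iter] at n1 n2
      rw [S.T_iter, S.T_iter, ← hA.red (S.X (u P) (n + 1), S.X (u P) (n + 1 + 1)),
        ← hA.red (S.X (Z P) (n + 1), S.X (Z P) (n + 1 + 1))] at hbad
      obtain ⟨k, c1, c2⟩ := hs n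
      obtain ⟨k', c1', c2'⟩ := hs (n + 1)
      have e1 := red_sub c2 c1
      have e2 := red_sub c2' c1'
      have : ¬ ((d:ENNReal) < edist (red (S.X (u P) (n + 1)), red (S.X (u P) (n + 1 + 1)))
          (red (S.X (Z P) (n + 1)), red (S.X (Z P) (n + 1 + 1)))) := by
        rw [not_lt, edist_dist, ENNReal.ofReal_le_iff_le_toReal ENNReal.coe_ne_top]
        rw [dist_comm, Prod.dist_eq, Real.dist_eq, Real.dist_eq, e1, e2]
        exact max_le (d1.trans hn.1.le) (d2.trans hn.2.le)
      simp only [hV, mem_ofPred_eq, mem_compl_iff, not_not] at n1 n2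
      rcases n1 with n1 | n1 <;> rcases n2 with n2 | n2
      · exact hbad (iff_of_true (k1s n1) (k1s n2))
      · exact this (hdist _ n1 _ n2)
      · rw [edist_comm] at this; exact this (hdist _ n2 _ n1)
      · exact hbad (iff_of_false (k2s n1) (k2s n2))
    have hpart : ∀ w : ℝ × ℝ → ℝ × ℝ, (∀ P ∈ B, ∀ P' ∈ B, dist P P' ≤ C * dist (w P) (w P')) →
        (∀ P ∈ B, w P ∈ Ico v.1 (v.1 + 2) ×ˢ Ico v.2 (v.2 + 2)) →
        volume {P | P ∈ B ∧ S.T^[n + 1] (w P) ∈ V} ≤ (C:ENNReal) ^ (2:ℝ) * (2 * δ) := by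
      intro w hw hw'
      refine (lipvol _ w C (fun P hP P' hP' => hw P hP.1 P' hP'.1)).trans ?_
      gcongr
      rw [← hVp.μ_iter (S := S) (n + 1), ← (hVp.iter (n + 1)).vol_sq v] at hVm
      refine (measure_mono ?_).trans hVm
      rintro _ ⟨P, hP, rfl⟩
      exact ⟨hP.2, hw' P hP.1⟩
    refine (measure_mono hsub).trans ((measure_union_le _ _).trans ?_)
    refine (add_le_add (hpart u hu hu') (hpart Z hZ hZ')).trans (le_of_eq ?_)
    ring
  set c := ((C:ENNReal) ^ (2:ℝ) * 4) with hc
  have hct : c ≠ ⊤ := ENNReal.mul_ne_top (ENNReal.rpow_ne_top_of_nonneg (by norm_num)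
    ENNReal.coe_ne_top) (by norm_num)
  have : Tendsto (fun n : ℕ => c * (((n:NNReal) + 1)⁻¹ : NNReal)) atTop (nhds (c * ((0:NNReal):ENNReal))) := by
    apply ENNReal.Tendsto.const_mul _ (Or.inr hct)
    apply ENNReal.tendsto_coe.2
    have := tendsto_one_div_add_atTop_nhds_zero_nat (𝕜 := NNReal)
    simpa using this
  simp only [ENNReal.coe_zero, mul_zero] at this
  exact le_antisymm (ge_of_tendsto' this fun n => key _ (by positivity)) bot_le
end BB

namespace BB
variable {S : Sys} (R : Par S)

theorem gd_meas (c : ℝ) : MeasurableSet {x | gd c x} :=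
  (measurableSet_le measurable_const measurable_fract).inter
    (measurableSet_le measurable_fract measurable_const)

theorem gd_mono {c d x : ℝ} (h : c ≤ d) (hd : gd d x) : gd c x :=
  ⟨h.trans hd.1, hd.2.trans (by linarith)⟩

theorem gd_X_per (c : ℝ) (i) (p : ℝ × ℝ) (m n : ℤ) :
    gd c (S.X (p.1 + 2 * m, p.2 + 2 * n) i) ↔ gd c (S.X p i) := by
  unfold gd; rw [S.X_fract]

theorem cnt_per (c : ℝ) (p : ℝ × ℝ) (m n : ℤ) (i) :
    cnt c (S.X (p.1 + 2 * m, p.2 + 2 * n)) i = cnt c (S.X p) i := by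
  induction i with
  | zero => rfl
  | succ i ih => simp only [cnt, ih]; congr 2; exact propext (gd_X_per _ _ _ _ _)

theorem cnt_meas (c : ℝ) (i) : Measurable fun p => cnt c (S.X p) i := by
  induction i with
  | zero => exact measurable_const
  | succ i ih =>
    exact ih.add (Measurable.ite ((S.X_meas (i + 1)) (gd_meas c)) measurable_const measurable_const)

theorem per_gd (c : ℝ) (i) : Per {p | gd c (S.X p i)} :=
  ⟨(S.X_meas i) (gd_meas c), fun p m n => gd_X_per c i p m n⟩

theorem per_N (i : ℕ) (s : Set ℕ) : Per {p | R.N (S.X p) i ∈ s} :=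
  ⟨(cnt_meas R.c i) (MeasurableSet.of_discrete (s := s)), fun p m n => by
    simp only [mem_ofPred_eq, Par.N, cnt_per]⟩

theorem cnt_shift (c : ℝ) (x : ℕ → ℝ) (m i : ℕ) :
    cnt c x (m + i) = cnt c x m + cnt c (fun n => x (n + m)) i := by
  induction i with
  | zero => rfl
  | succ i ih =>
    rw [← add_assoc]
    simp only [cnt, ih]
    rw [add_assoc, add_comm m i, add_right_comm i m 1]

theorem Sys.T_Ti_iter (p) (n : ℕ) : S.T^[n] (S.Ti^[n] p) = p :=
  Function.LeftInverse.iterate (f := S.Ti) (g := S.T) S.T_Ti n p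

theorem trick (B : Set (ℝ × ℝ)) (hB : Per B) (N : ℕ) :
    ∑' i, μ {p | gd R.c p.2 ∧ R.N (S.X p) i = N ∧ S.T^[i] p ∈ B} ≤ μ B := by
  have hE : ∀ i, Per {p : ℝ × ℝ | gd R.c p.2 ∧ R.N (S.X p) i = N ∧ S.T^[i] p ∈ B} := fun i =>
    (per_gd (S := S) R.c 1).inter ((per_N R i {N}).inter (hB.iter i))
  simp_rw [fun i => ((hE i).μ_Ti_iter (S := S) i).symm]
  rw [← measure_iUnion]
  · apply measure_mono
    intro r hr
    obtain ⟨i, hi⟩ := mem_iUnion.1 hr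
    have := hi.2.2
    rwa [S.T_Ti_iter] at this
  · have key : ∀ i j, i < j → Disjoint
        (S.Ti^[i] ⁻¹' {p | gd R.c p.2 ∧ R.N (S.X p) i = N ∧ S.T^[i] p ∈ B})
        (S.Ti^[j] ⁻¹' {p | gd R.c p.2 ∧ R.N (S.X p) j = N ∧ S.T^[j] p ∈ B}) := by
      intro i j hij
      rw [Set.disjoint_left]
      rintro r ⟨-, h1, -⟩ ⟨g, h2, -⟩
      obtain ⟨m, rfl⟩ := Nat.exists_eq_add_of_lt hij
      have e : S.Ti^[i] r = S.T^[m + 1] (S.Ti^[i + m + 1] r) := by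
        rw [show i + m + 1 = (m + 1) + i by ring, Function.iterate_add_apply S.Ti, S.T_Ti_iter]
      rw [e] at h1
      set p' := S.Ti^[i + m + 1] r
      unfold Par.N at h1 h2
      rw [show i + m + 1 = (m + 1) + i by ring, cnt_shift] at h2
      have e2 : (fun n => S.X p' (n + (m + 1))) = S.X (S.T^[m + 1] p') := by
        funext n; rw [S.X_iter]
      rw [e2, h1] at h2
      have : 1 ≤ cnt R.c (S.X p') (m + 1) := by
        refine le_trans ?_ (R.N_mono (S.X p') (show 1 ≤ m + 1 by omega))
        simp [Par.N, cnt, Sys.X, g]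
      omega
    intro i j hij
    rcases lt_or_gt_of_ne hij with h | h
    · exact key i j h
    · exact (key j i h).symm
  · exact fun i => ((hE i).Ti_iter i).1

theorem near_le (d : ℝ) : μ {q : ℝ × ℝ | ¬ gd d q.2} ≤ ENNReal.ofReal (8 * d) := by
  have hsub : {q : ℝ × ℝ | ¬ gd d q.2} = univ ×ˢ {x | ¬ gd d x} := by ext; simp
  rw [hsub, μ, Measure.prod_prod]
  simp only [Measure.restrict_apply_univ]
  have h1 : volume.restrict I2 {x | ¬ gd d x} ≤ ENNReal.ofReal (4 * d) := by
    rcases le_or_gt d 0 with hd | hd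
    · have : {x | ¬ gd d x} = ∅ := by
        ext x
        simp only [mem_ofPred_eq, mem_empty_iff_false, iff_false, not_not]
        exact ⟨hd.trans (Int.fract_nonneg _), by linarith [Int.fract_lt_one x]⟩
      rw [this]; simp
    rw [Measure.restrict_apply (show MeasurableSet {x | ¬ gd d x} from (gd_meas d).compl)]
    have : {x | ¬ gd d x} ∩ I2 ⊆ Ico 0 d ∪ (Ioo (1 - d) (1 + d) ∪ Ioo (2 - d) 2) := by
      rintro x ⟨hx, h0, h2⟩
      simp only [mem_ofPred_eq, gd, not_and_or, not_le] at hx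
      have hfl : ⌊x⌋ = 0 ∨ ⌊x⌋ = 1 := by
        have a := Int.floor_nonneg.2 h0
        have b : ⌊x⌋ < 2 := Int.floor_lt.2 (by exact_mod_cast h2)
        omega
      simp only [mem_union, mem_Ico, mem_Ioo]
      have f0 := Int.fract_nonneg x
      have f1 := Int.fract_lt_one x
      unfold Int.fract at hx f0 f1
      rcases hfl with h | h <;> rw [h] at hx f0 f1 <;> push_cast at hx f0 f1 <;>
        rcases hx with hx | hx
      · left; constructor <;> linarith
      · right; left; constructor <;> linarith
      · right; left; constructor <;> linarith
      · right; right; constructor <;> linarith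
    refine (measure_mono this).trans ((measure_union_le _ _).trans
      ((add_le_add_right (measure_union_le _ _) _).trans ?_))
    simp only [Real.volume_Ico, Real.volume_Ioo]
    rw [← ENNReal.ofReal_add (by linarith) (by linarith), ← ENNReal.ofReal_add (by linarith) (by linarith)]
    apply ENNReal.ofReal_le_ofReal; linarith
  have h2 : volume I2 = ENNReal.ofReal 2 := by simp [I2]
  rw [h2]
  refine (mul_le_mul_right h1 _).trans ?_
  rw [← ENNReal.ofReal_mul (by norm_num)]
  apply ENNReal.ofReal_le_ofReal; linarith

theorem Par.geom : ∑' N, ENNReal.ofReal R.ρ ^ N ≠ ⊤ := by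
  rw [ENNReal.tsum_geometric]
  apply ENNReal.inv_ne_top.2
  have : ENNReal.ofReal R.ρ < 1 := by
    rw [← ENNReal.ofReal_one]
    exact (ENNReal.ofReal_lt_ofReal_iff one_pos).2 R.ρ1
  exact (tsub_pos_of_lt this).ne'

theorem ae_sum : ∀ᵐ p ∂μ, gd R.c p.2 → ∃ K : ℝ, ∀ n,
    ∑ i ∈ Finset.range n, R.ρ ^ R.N (S.X p) i ≤ K := by
  set E : ℕ → ℕ → Set (ℝ × ℝ) := fun i N => {p | gd R.c p.2 ∧ R.N (S.X p) i = N ∧ S.T^[i] p ∈ univ}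
    with hE
  have hEm : ∀ i N, MeasurableSet (E i N) := fun i N =>
    ((per_gd (S := S) R.c 1).inter ((per_N R i {N}).inter (Per.univ.iter (S := S) i))).1
  set f : ℝ × ℝ → ENNReal := fun p => ∑' i, ∑' N, (E i N).indicator
    (fun _ => ENNReal.ofReal R.ρ ^ N) p with hf
  have hfm : Measurable f := Measurable.tsum fun i => Measurable.ennreal_tsum fun N =>
    measurable_const.indicator (hEm i N)
  have hint : ∫⁻ p, f p ∂μ ≠ ⊤ := by
    have : ∫⁻ p, f p ∂μ = ∑' i, ∑' N, ENNReal.ofReal R.ρ ^ N * μ (E i N) := by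
      rw [hf, lintegral_tsum]
      · congr 1
        funext i
        rw [lintegral_tsum]
        · congr 1
          funext N
          rw [lintegral_indicator_const (hEm i N)]
        · exact fun N => (measurable_const.indicator (hEm i N)).aemeasurable
      · exact fun i => (Measurable.tsum fun N =>
          measurable_const.indicator (hEm i N)).aemeasurable
    rw [this, ENNReal.tsum_comm]
    simp_rw [ENNReal.tsum_mul_left]
    refine ne_top_of_le_ne_top ?_ (ENNReal.tsum_le_tsum fun N =>
      mul_le_mul_right (trick R univ Per.univ N) _)
    rw [ENNReal.tsum_mul_right, μ_univ]
    exact ENNReal.mul_ne_top R.geom (by norm_num)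
  filter_upwards [ae_lt_top hfm hint] with p hp hg
  refine ⟨(f p).toReal, fun n => ?_⟩
  rw [← ENNReal.ofReal_le_iff_le_toReal hp.ne, ENNReal.ofReal_sum_of_nonneg (fun i _ => (R.ρn0 _).le)]
  refine le_trans ?_ (ENNReal.sum_le_tsum (Finset.range n))
  apply Finset.sum_le_sum
  intro i _
  refine le_trans ?_ (ENNReal.le_tsum (R.N (S.X p) i))
  rw [indicator_of_mem (by exact ⟨hg, rfl, trivial⟩), ENNReal.ofReal_pow R.ρ0.le]

/-- union over all times -/
theorem trick2 (B : ℕ → Set (ℝ × ℝ)) (hB : ∀ N, Per (B N)) :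
    μ {p | gd R.c p.2 ∧ ∃ i, S.T^[i] p ∈ B (R.N (S.X p) i)} ≤ ∑' N, μ (B N) := by
  have : {p : ℝ × ℝ | gd R.c p.2 ∧ ∃ i, S.T^[i] p ∈ B (R.N (S.X p) i)} ⊆
      ⋃ N, ⋃ i, {p | gd R.c p.2 ∧ R.N (S.X p) i = N ∧ S.T^[i] p ∈ B N} := by
    rintro p ⟨h1, i, h2⟩
    exact mem_iUnion.2 ⟨_, mem_iUnion.2 ⟨i, h1, rfl, h2⟩⟩
  refine (measure_mono this).trans ((measure_iUnion_le _).trans ?_)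
  exact ENNReal.tsum_le_tsum fun N => (measure_iUnion_le _).trans (trick R _ (hB N) N)

theorem ae_near : ∀ᵐ p ∂μ, gd R.c p.2 → ∃ m : ℕ, ∀ i,
    gd (R.ρ ^ R.N (S.X p) i / (m + 1)) (S.X p (i + 1)) := by
  rw [ae_iff]
  have key : ∀ m : ℕ, μ {p | ¬ (gd R.c p.2 → ∃ m : ℕ, ∀ i,
      gd (R.ρ ^ R.N (S.X p) i / (m + 1)) (S.X p (i + 1)))} ≤
      (8 * ∑' N, ENNReal.ofReal R.ρ ^ N) * (((m:NNReal) + 1)⁻¹ : NNReal) := by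
    intro m
    have := trick2 R (fun N => {q | ¬ gd (R.ρ ^ N / (m + 1)) q.2})
      (fun N => (per_gd (S := S) _ 1).compl)
    refine (measure_mono ?_).trans (this.trans ?_)
    · intro p hp
      simp only [mem_ofPred_eq, Classical.not_imp, not_exists, not_forall] at hp
      refine ⟨hp.1, ?_⟩
      obtain ⟨i, hi⟩ := hp.2 m
      exact ⟨i, by rw [S.T_iter]; exact hi⟩
    · rw [mul_right_comm, ← ENNReal.tsum_mul_left]
      apply ENNReal.tsum_le_tsum
      intro N
      refine (near_le _).trans (le_of_eq ?_)
      have e : 8 * (R.ρ ^ N / ((m:ℝ) + 1)) = 8 * (((m:ℝ) + 1)⁻¹ * R.ρ ^ N) := by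
        rw [div_eq_mul_inv]; ring
      rw [e, ENNReal.ofReal_mul (by norm_num), ENNReal.ofReal_mul (by positivity),
        ENNReal.ofReal_pow R.ρ0.le, mul_assoc]
      congr 2
      · norm_num
      · rw [ENNReal.ofReal, Real.toNNReal_inv]
        congr 2
        rw [Real.toNNReal_add (by positivity) (by norm_num)]
        simp
  set c := (8 * ∑' N, ENNReal.ofReal R.ρ ^ N) with hc
  have hct : c ≠ ⊤ := ENNReal.mul_ne_top (by norm_num) R.geom
  have : Tendsto (fun n : ℕ => c * (((n:NNReal) + 1)⁻¹ : NNReal)) atTop (nhds (c * ((0:NNReal):ENNReal))) := by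
    apply ENNReal.Tendsto.const_mul _ (Or.inr hct)
    apply ENNReal.tendsto_coe.2
    have := tendsto_one_div_add_atTop_nhds_zero_nat (𝕜 := NNReal)
    simpa using this
  simp only [ENNReal.coe_zero, mul_zero] at this
  exact le_antisymm (ge_of_tendsto' this key) bot_le

theorem null_vol (E : Set (ℝ × ℝ)) (h : ∀ p : ℝ × ℝ, ∀ m n : ℤ, p ∈ E → (p.1 + 2 * m, p.2 + 2 * n) ∈ E)
    (h0 : μ E = 0) : volume E = 0 := by
  rw [μ_eq, Measure.restrict_apply'
    (show MeasurableSet (I2 ×ˢ I2) from measurableSet_Ico.prod measurableSet_Ico)] at h0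
  have : E ⊆ ⋃ m : ℤ, ⋃ n : ℤ, (fun p : ℝ × ℝ => p + (2 * (m:ℝ), 2 * (n:ℝ))) ⁻¹' (E ∩ I2 ×ˢ I2) := by
    intro p hp
    refine mem_iUnion.2 ⟨-⌊p.1 / 2⌋, mem_iUnion.2 ⟨-⌊p.2 / 2⌋, h p _ _ hp, ?_, ?_⟩⟩
    · have := red_mem p.1
      unfold red at this
      convert this using 1
      simp [sub_eq_add_neg]
    · have := red_mem p.2
      unfold red at this
      convert this using 1
      simp [sub_eq_add_neg]
  refine measure_mono_null this (measure_iUnion_null fun m => measure_iUnion_null fun n => ?_)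
  rw [measure_preimage_add_right]; exact h0

theorem ae_blk : ∀ᵐ p : ℝ × ℝ, gd R.c p.2 → ∃ K : ℕ, 1 ≤ K ∧ R.Blk K p := by
  have h1 : ∀ᵐ p : ℝ × ℝ, gd R.c p.2 → ∃ K : ℝ, ∀ n,
      ∑ i ∈ Finset.range n, R.ρ ^ R.N (S.X p) i ≤ K := by
    refine null_vol _ (fun p m n hp => ?_) (ae_sum R)
    have e := gd_X_per (S := S) R.c 1 p m n
    simp only [mem_compl_iff, mem_ofPred_eq, Par.N, cnt_per, Sys.X] at hp e ⊢
    rw [e]; exact hp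
  have h2 : ∀ᵐ p : ℝ × ℝ, gd R.c p.2 → ∃ m : ℕ, ∀ i,
      gd (R.ρ ^ R.N (S.X p) i / (m + 1)) (S.X p (i + 1)) := by
    refine null_vol _ (fun p m n hp => ?_) (ae_near R)
    have e := gd_X_per (S := S) R.c 1 p m n
    simp only [mem_compl_iff, mem_ofPred_eq, Par.N, cnt_per, gd_X_per, Sys.X] at hp e ⊢
    rw [e]; exact hp
  filter_upwards [h1, h2] with p h1 h2 hg
  obtain ⟨K, hK⟩ := h1 hg
  obtain ⟨m, hm⟩ := h2 hg
  obtain ⟨k, hk⟩ := exists_nat_ge K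
  refine ⟨max k (m + 1), le_max_of_le_right (by omega), fun n => (hK n).trans (hk.trans ?_), fun i => ?_⟩
  · exact_mod_cast le_max_left _ _
  · have hle : R.ρ ^ R.N (S.X p) i / (max k (m + 1) : ℕ) ≤ R.ρ ^ R.N (S.X p) i / ((m:ℝ) + 1) := by
      have : ((m:ℝ) + 1) ≤ (max k (m + 1) : ℕ) := by exact_mod_cast le_max_right _ _
      have h0 := (R.ρn0 (R.N (S.X p) i)).le
      gcongr
    have := hm i
    unfold gd Int.fract at this
    exact ⟨⌊S.X p (i + 1)⌋, by linarith [this.1], by linarith [this.2]⟩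
end BB

namespace BB
variable {S : Sys} (R : Par S)

theorem Par.Blk.mono {K K' : ℝ} (hK : 1 ≤ K) (h : K ≤ K') {p} (hp : R.Blk K p) : R.Blk K' p := by
  refine ⟨fun n => (hp.1 n).trans h, fun i => ?_⟩
  obtain ⟨k, h1, h2⟩ := hp.2 i
  have : R.ρ ^ R.N (S.X p) i / K' ≤ R.ρ ^ R.N (S.X p) i / K := by
    have h0 := (R.ρn0 (R.N (S.X p) i)).le
    gcongr
  exact ⟨k, by linarith, by linarith⟩

theorem swap_inv {A : Set (ℝ × ℝ)} (hT : ∀ p, S.T p ∈ A ↔ p ∈ A) :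
    ∀ p, S.T p ∈ Prod.swap ⁻¹' A ↔ p ∈ Prod.swap ⁻¹' A := by
  intro p
  rw [mem_preimage, mem_preimage, ← hT, S.T_swap_T]

theorem ae_swap {p : ℝ × ℝ → Prop} (h : ∀ᵐ x : ℝ × ℝ, p x) : ∀ᵐ x : ℝ × ℝ, p x.swap :=
  (Measure.measurePreserving_swap (μ := (volume : Measure ℝ)) (ν := (volume : Measure ℝ))
    ).quasiMeasurePreserving.ae h

theorem ae_shift {p : ℝ × ℝ → Prop} (h : ∀ᵐ x : ℝ × ℝ, p x) (v : ℝ × ℝ) :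
    ∀ᵐ x : ℝ × ℝ, p (x + v) :=
  (measurePreserving_add_right (volume : Measure (ℝ × ℝ)) v).quasiMeasurePreserving.ae h

def Par.Hyp (r : ℝ) (P : ℝ × ℝ) : Prop := gd R.c P.1 ∧ gd R.c (P.2 + r) ∧
  R.GS P.swap (r / (1 - R.q)) ∧ R.GS (P.1, P.2 + r) (-(r / (1 - R.q)))

theorem Par.zpt' (r : ℝ) (hr : |r| / (1 - R.q) ≤ R.c / 4) (P) (h : R.Hyp r P) :
    ∃ z : ℝ × ℝ, S.SL (P.1, P.2 + r) z ∧ S.SL P.swap z.swap ∧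
      |z.1 - P.1| ≤ R.c / 4 ∧ |z.2 - P.2| ≤ R.c / 4 := by
  obtain ⟨σ, hσ, e⟩ := exists_sgn_abs r
  have e' : σ * |r| = r := by rw [← e, ← mul_assoc, hσ.sq, one_mul]
  obtain ⟨h1, -, h3, h4⟩ := h
  have hc := R.c0
  obtain ⟨z, z1, z2, z3, z4⟩ := R.zpt P σ hσ |r| (abs_nonneg _) (by linarith) h1
    (by rw [← mul_div_assoc, e']; exact h3)
    (by rw [← mul_div_assoc, neg_mul, e', neg_div]; exact h4)
  rw [e'] at z1
  exact ⟨z, z1, z2, z3.trans hr, z4.trans hr⟩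

theorem T0 (A : Set (ℝ × ℝ)) (hA : Per A) (hT : ∀ p, S.T p ∈ A ↔ p ∈ A) (r : ℝ)
    (hr : |r| / (1 - R.q) ≤ R.c / 4) :
    ∀ᵐ P : ℝ × ℝ, R.Hyp r P → (P ∈ A ↔ (P.1, P.2 + r) ∈ A) := by
  have hc0 := R.c0
  have hc1 := R.c1
  have hr' : |r| ≤ R.c / 4 := by
    refine le_trans ?_ hr
    rw [le_div_iff₀ (by linarith [R.q1])]
    nlinarith [abs_nonneg r, R.q0]
  have hz : ∀ P, ∃ z : ℝ × ℝ, R.Hyp r P → S.SL (P.1, P.2 + r) z ∧ S.SL P.swap z.swap ∧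
      |z.1 - P.1| ≤ R.c / 4 ∧ |z.2 - P.2| ≤ R.c / 4 := by
    intro P
    by_cases h : R.Hyp r P
    · obtain ⟨z, hz⟩ := R.zpt' r hr P h
      exact ⟨z, fun _ => hz⟩
    · exact ⟨P, fun h' => absurd h' h⟩
  choose Z hZ using hz
  have hblk : ∀ᵐ P : ℝ × ℝ, R.Hyp r P → ∃ K : ℕ, 1 ≤ K ∧ R.Blk K (P.1, P.2 + r) ∧ R.Blk K P.swap := by
    filter_upwards [ae_swap (ae_blk R), ae_shift (ae_blk R) (0, r)] with P h1 h2 hP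
    obtain ⟨K1, k1, b1⟩ := h1 hP.1
    obtain ⟨K2, k2, b2⟩ := h2 hP.2.1
    rw [show P + (0, r) = (P.1, P.2 + r) by ext <;> simp] at b2
    refine ⟨max K1 K2, le_max_of_le_left k1, b2.mono R (by exact_mod_cast k2) ?_,
      b1.mono R (by exact_mod_cast k1) ?_⟩
    · exact_mod_cast le_max_right _ _
    · exact_mod_cast le_max_left _ _
  choose κ hκ C hC hlip using fun K : ℕ => R.lipinv (max K 1) (le_max_right _ _) r
  set η : ℕ → ℝ := fun K => min (κ K) (1 / 4) with hη
  have η0 : ∀ K, 0 < η K := fun K => lt_min (hκ K) (by norm_num)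
  set B : ℕ → ℤ → ℤ → Set (ℝ × ℝ) := fun K m n => {P | R.Hyp r P ∧ 1 ≤ K ∧ R.Blk K (P.1, P.2 + r) ∧
    R.Blk K P.swap ∧ m * η K ≤ P.1 ∧ P.1 < m * η K + η K ∧ n * η K ≤ P.2 ∧ P.2 < n * η K + η K} with hB
  have main : ∀ K m n, volume {P | P ∈ B K m n ∧ ¬(P ∈ A ↔ (P.1, P.2 + r) ∈ A)} = 0 := by
    intro K m n
    have ηk : η K ≤ κ K := min_le_left _ _
    have η4 : η K ≤ 1 / 4 := min_le_right _ _
    have hle : ∀ P ∈ B K m n, ∀ P' ∈ B K m n, dist P P' ≤ (2 * C K + 1) * dist (Z P) (Z P') := by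
      rintro P ⟨a1, a2, a3, a4, a5, a6, a7, a8⟩ P' ⟨b1, b2, b3, b4, b5, b6, b7, b8⟩
      have hK : max (K:ℝ) 1 = K := max_eq_left (by exact_mod_cast a2)
      have hl := hlip K P P' (Z P) (Z P')
      rw [hK] at hl
      obtain ⟨z1, z2, z3, z4⟩ := hZ P a1
      obtain ⟨y1, y2, y3, y4⟩ := hZ P' b1
      have := hl a3 b3 a4 b4 b1.2.1 b1.1 (by rw [abs_le]; constructor <;> linarith)
        (by rw [abs_le]; constructor <;> linarith) z1 y1 z2 y2 z3 z4
      rw [Prod.dist_eq, Prod.dist_eq, Real.dist_eq, Real.dist_eq, Real.dist_eq, Real.dist_eq]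
      rw [abs_sub_comm P'.1, abs_sub_comm P'.2] at this
      set a := |(Z P).1 - (Z P').1|
      set b := |(Z P).2 - (Z P').2|
      have m1 : a ≤ max a b := le_max_left _ _
      have m2 : b ≤ max a b := le_max_right _ _
      have hm : 0 ≤ max a b := (abs_nonneg _).trans m1
      have : C K * (a + b) ≤ C K * (2 * max a b) := mul_le_mul_of_nonneg_left (by linarith) (hC K)
      have x1 := abs_nonneg (P.1 - P'.1)
      have x2 := abs_nonneg (P.2 - P'.2)
      apply max_le <;> linarith
    have hω : Tendsto (fun n : ℕ => (K:ℝ) / ((n:ℝ) + 1)) atTop (nhds 0) := by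
      have := (tendsto_one_div_add_atTop_nhds_zero_nat (𝕜 := ℝ)).const_mul (K:ℝ)
      simpa [div_eq_mul_inv] using this
    have hsmall : ∀ (p z : ℝ × ℝ), R.Blk K p → S.SL p z → |z.1 - p.1| ≤ R.c / 4 → ∀ n,
        |S.X z n - S.X p n| ≤ (K:ℝ) / ((n:ℝ) + 1) := by
      intro p z hb hs hd n
      refine (R.SL_contr hs (by linarith) n).trans ?_
      rw [le_div_iff₀ (by positivity)]
      have h1 := hb.mul_le R n
      have h2 := R.q_le_ρ (R.N (S.X p) n)
      have h3 : |z.1 - p.1| * R.q ^ R.N (S.X p) n ≤ 1 * R.ρ ^ R.N (S.X p) n :=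
        mul_le_mul (by linarith) h2 (R.qn0 _).le zero_le_one
      have h4 : (0:ℝ) ≤ (n:ℝ) + 1 := by positivity
      have := mul_le_mul_of_nonneg_right h3 h4
      linarith
    set D : NNReal := ⟨2 * C K + 1, by have := hC K; linarith⟩ with hD
    have hD1 : (1:ℝ) ≤ D := by show 1 ≤ 2 * C K + 1; linarith [hC K]
    have t1 := theta (S := S) A hA hT (B K m n) (fun P => (P.1, P.2 + r)) Z D
      (fun P _ P' _ => by
        have : dist P P' = dist (P.1, P.2 + r) (P'.1, P'.2 + r) := by simp [Prod.dist_eq]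
        rw [← this]
        exact le_mul_of_one_le_left dist_nonneg hD1) hle (m * η K - 1 / 2, n * η K - 1 / 2)
      (by
        rintro P ⟨a1, a2, a3, a4, a5, a6, a7, a8⟩
        rw [abs_le] at hr'
        refine ⟨⟨?_, ?_⟩, ?_, ?_⟩ <;> dsimp only <;> linarith)
      (by
        rintro P ⟨a1, a2, a3, a4, a5, a6, a7, a8⟩
        obtain ⟨z1, z2, z3, z4⟩ := hZ P a1
        rw [abs_le] at z3 z4
        refine ⟨⟨?_, ?_⟩, ?_, ?_⟩ <;> dsimp only <;> linarith)
      (fun P hP => (hZ P hP.1).1) _ hω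
      (fun P hP n => hsmall _ _ hP.2.2.1 (hZ P hP.1).1 (hZ P hP.1).2.2.1 n)
    have t2 := theta (S := S) _ hA.swap (swap_inv hT) (B K m n) Prod.swap (fun P => (Z P).swap) D
      (fun P _ P' _ => by
        have : dist P P' = dist P.swap P'.swap := by simp [Prod.dist_eq, max_comm]
        rw [← this]
        exact le_mul_of_one_le_left dist_nonneg hD1)
      (fun P h P' h' => by
        have : dist (Z P).swap (Z P').swap = dist (Z P) (Z P') := by simp [Prod.dist_eq, max_comm]
        rw [this]; exact hle P h P' h') (n * η K - 1 / 2, m * η K - 1 / 2)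
      (by
        rintro P ⟨a1, a2, a3, a4, a5, a6, a7, a8⟩
        refine ⟨⟨?_, ?_⟩, ?_, ?_⟩ <;> simp only [Prod.fst_swap, Prod.snd_swap] <;> linarith)
      (by
        rintro P ⟨a1, a2, a3, a4, a5, a6, a7, a8⟩
        obtain ⟨z1, z2, z3, z4⟩ := hZ P a1
        rw [abs_le] at z3 z4
        refine ⟨⟨?_, ?_⟩, ?_, ?_⟩ <;> simp only [Prod.fst_swap, Prod.snd_swap] <;> linarith)
      (fun P hP => (hZ P hP.1).2.1) _ hω
      (fun P hP n => hsmall _ _ hP.2.2.2.1 (hZ P hP.1).2.1 (hZ P hP.1).2.2.2 n)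
    refine measure_mono_null ?_ (measure_union_null t1 t2)
    rintro P ⟨hP, hbad⟩
    by_contra hcon
    simp only [mem_union, mem_ofPred_eq, hP, true_and, not_or, not_not, mem_preimage,
      Prod.swap_swap] at hcon
    exact hbad (hcon.2.trans hcon.1.symm)
  have main' : ∀ᵐ P : ℝ × ℝ, ∀ K m n, P ∈ B K m n → (P ∈ A ↔ (P.1, P.2 + r) ∈ A) := by
    rw [ae_all_iff]; intro K
    rw [ae_all_iff]; intro m
    rw [ae_all_iff]; intro n
    rw [ae_iff]
    simpa only [Classical.not_imp] using main K m n
  filter_upwards [hblk, main'] with P h1 h2 hP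
  obtain ⟨K, k1, b1, b2⟩ := h1 hP
  have grid : ∀ x : ℝ, ⌊x / η K⌋ * η K ≤ x ∧ x < ⌊x / η K⌋ * η K + η K := by
    intro x
    have a := Int.floor_le (x / η K)
    have b := Int.lt_floor_add_one (x / η K)
    rw [le_div_iff₀ (η0 K)] at a
    rw [div_lt_iff₀ (η0 K)] at b
    constructor <;> linarith
  exact h2 K _ _ ⟨hP, k1, b1, b2, (grid P.1).1, (grid P.1).2, (grid P.2).1, (grid P.2).2⟩
end BB

namespace BB
variable {S : Sys} (R : Par S)

/-- itinerary data -/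
noncomputable def itin (x : ℕ → ℝ) (i : ℕ) : List (ℤ × ℤ) :=
  (List.range i).map fun j => (⌊x j⌋, round (x j))

theorem itin_eq {x y : ℕ → ℝ} {i : ℕ} (h : itin x i = itin y i) (j : ℕ) (hj : j < i) :
    ⌊x j⌋ = ⌊y j⌋ ∧ round (x j) = round (y j) := by
  have := List.map_inj_left.1 h j (List.mem_range.2 hj)
  simpa using this

def NI (x : ℝ) : Prop := ∀ m : ℤ, x ≠ m

theorem NI.cell {x : ℝ} (h : NI x) : Cell ⌊x⌋ x :=
  ⟨lt_of_le_of_ne (Int.floor_le x) fun e => h _ e.symm, Int.lt_floor_add_one x⟩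

theorem first_int (n : ℤ) (m : ℕ) (l : List (ℤ × ℤ)) :
    {y : ℝ | (∀ i < m, NI (S.X (n, y) (i + 1))) ∧ ¬ NI (S.X (n, y) (m + 1)) ∧
      itin (S.X (n, y)) (m + 2) = l}.Subsingleton := by
  rintro y ⟨h1, h2, h3⟩ z ⟨g1, g2, g3⟩
  have he := fun j hj => (itin_eq (h3.trans g3.symm) j hj)
  unfold NI at h2 g2
  push Not at h2 g2
  obtain ⟨a, ha⟩ := h2
  obtain ⟨b, hb⟩ := g2
  have hab : S.X (n, y) (m + 1) = S.X (n, z) (m + 1) := by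
    have := (he (m + 1) (by omega)).1
    rw [ha, hb, Int.floor_intCast, Int.floor_intCast] at this
    rw [ha, hb, this]
  obtain ⟨σ, hσ, hs⟩ : ∃ σ, Sgn σ ∧ 0 ≤ nd σ (S.X (n, y)) (S.X (n, z)) 1 := by
    rcases le_total y z with h | h
    · exact ⟨1, Or.inl rfl, by simp [nd, Sys.X]; linarith⟩
    · exact ⟨-1, Or.inr rfl, by simp [nd, Sys.X]; linarith⟩
  have e0 : nd σ (S.X (n, y)) (S.X (n, z)) 0 = 0 := by simp [nd, Sys.X]
  have := grow (nd σ (S.X (n, y)) (S.X (n, z))) m (fun i hi => by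
    have c1 := (h1 i hi).cell
    have c2 := (g1 i hi).cell
    rw [← (he (i + 1) (by omega)).1] at c2
    obtain ⟨u, hu, _, hu2, _⟩ := S.nd_rec (fun j => ⌊S.X (n, y) j⌋) σ hσ (S.X (n, y)) (S.X (n, z)) i
      (by rw [S.X_succ2, S.φ_eq _ _ c1.1 c1.2]) (by rw [S.X_succ2, S.φ_eq _ _ c2.1 c2.2])
    exact ⟨u, hu, hu2⟩) e0.ge (by rw [e0]; exact hs) m le_rfl
  have e1 : nd σ (S.X (n, y)) (S.X (n, z)) (m + 1) = 0 := by simp [nd, hab]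
  have e2 : nd σ (S.X (n, y)) (S.X (n, z)) 1 = 0 := by linarith [this.1, this.2.2]
  have := nd_inv hσ (S.X (n, y)) (S.X (n, z)) 1
  rw [e2, mul_zero, add_zero] at this
  exact this

theorem round_s {c x : ℝ} (hc : c < 1 / 8) (h : ¬ gd c x) :
    |x - round x| < c ∧ (round x = ⌊x⌋ ∧ 0 ≤ x - round x ∨ round x = ⌊x⌋ + 1 ∧ x - round x < 0) := by
  have h0 := Int.fract_nonneg x
  have h1 := Int.fract_lt_one x
  have hx := Int.floor_add_fract x
  rw [round_eq]
  by_cases hg : Int.fract x < c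
  · have : ⌊x + 1 / 2⌋ = ⌊x⌋ := by
      rw [Int.floor_eq_iff]; constructor <;> linarith
    rw [this]
    refine ⟨?_, Or.inl ⟨rfl, by linarith⟩⟩
    rw [abs_lt]; constructor <;> linarith
  · have h2 : 1 - c < Int.fract x := by
      by_contra h3
      exact h ⟨not_lt.1 hg, not_lt.1 h3⟩
    have : ⌊x + 1 / 2⌋ = ⌊x⌋ + 1 := by
      rw [Int.floor_eq_iff]; push_cast; constructor <;> linarith
    rw [this]
    push_cast
    refine ⟨?_, Or.inr ⟨rfl, by linarith⟩⟩
    rw [abs_lt]; constructor <;> linarith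

/-- smallness of `c` -/
def Sys.Small (S : Sys) (c : ℝ) : Prop := 0 < c ∧ c < 1 / 8 ∧
  ∀ b : ℤ, (b = 0 ∨ b = 1) → ∀ k : ℤ, |S.β b - k| ≤ (S.A + 2) * c → S.β b = k

/-- recurrence of `round` along a sticky orbit -/
theorem sticky {c : ℝ} (hc : S.Small c) (p) (i0 : ℕ) (h1 : ∀ i, NI (S.X p (i + 1)))
    (h2 : ∀ i ≥ i0, ¬ gd c (S.X p (i + 1))) (i : ℕ) (hi : i0 ≤ i) :
    (round (S.X p (i + 2)) - ⌊S.X p (i + 2)⌋ = 1 - (round (S.X p (i + 1)) - ⌊S.X p (i + 1)⌋)) ∧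
    (round (S.X p (i + 3)) : ℝ) = S.β ((round (S.X p (i + 2)) - ⌊S.X p (i + 2)⌋ : ℤ)) +
      2 * ⌊S.X p (i + 2)⌋ - round (S.X p (i + 1)) := by
  set r : ℕ → ℝ := fun j => S.X p (j + 1) - round (S.X p (j + 1)) with hr
  have hs : ∀ j ≥ i0, |r j| < c ∧ (round (S.X p (j + 1)) = ⌊S.X p (j + 1)⌋ ∧ 0 ≤ r j ∨
      round (S.X p (j + 1)) = ⌊S.X p (j + 1)⌋ + 1 ∧ r j < 0) := fun j hj =>
    round_s hc.2.1 (h2 j hj)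
  have hr0 : ∀ j, r j ≠ 0 := fun j h => h1 j _ (sub_eq_zero.1 h)
  have key : ∀ j ≥ i0, ∃ m ≥ (2:ℝ), r (j + 2) = -m * r (j + 1) - r j ∧
      (round (S.X p (j + 3)) : ℝ) = S.β ((round (S.X p (j + 2)) - ⌊S.X p (j + 2)⌋ : ℤ)) +
      2 * ⌊S.X p (j + 2)⌋ - round (S.X p (j + 1)) := by
    intro j hj
    set s : ℤ := round (S.X p (j + 2)) - ⌊S.X p (j + 2)⌋ with hsdef
    have hs01 : s = 0 ∨ s = 1 := by
      rcases (hs (j + 1) (by omega)).2 with h | h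
      · left; exact sub_eq_zero.2 h.1
      · right; exact sub_eq_iff_eq_add'.2 h.1
    have hc2 := (h1 (j + 1)).cell
    have e1 : S.X p (j + 3) = S.bb ⌊S.X p (j + 2)⌋ (S.X p (j + 2)) - S.X p (j + 1) := by
      rw [S.X_succ2, S.φ_eq _ _ hc2.1 hc2.2]
    obtain ⟨m, m1, m2, m3, _⟩ := S.bb_diff ⌊S.X p (j + 2)⌋ (S.X p (j + 2)) (round (S.X p (j + 2)))
    have e2 : S.bb ⌊S.X p (j + 2)⌋ (round (S.X p (j + 2))) = S.β s + 2 * ⌊S.X p (j + 2)⌋ := by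
      unfold Sys.bb; rw [hsdef]; push_cast; rfl
    have e3 : r (j + 2) + r j + m * r (j + 1) = S.β s -
        ((round (S.X p (j + 3)) + round (S.X p (j + 1)) - 2 * ⌊S.X p (j + 2)⌋ : ℤ) : ℝ) := by
      simp only [hr]; push_cast
      rw [e2] at m3
      rw [show j + 2 + 1 = j + 3 from rfl, show j + 1 + 1 = j + 2 from rfl]
      linarith
    have e4 : S.β s = ((round (S.X p (j + 3)) + round (S.X p (j + 1)) - 2 * ⌊S.X p (j + 2)⌋ : ℤ) : ℝ) := by
      apply hc.2.2 s hs01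
      rw [← e3]
      have a1 := (hs j hj).1
      have a2 := (hs (j + 1) (by omega)).1
      have a3 := (hs (j + 2) (by omega)).1
      have a4 : |m * r (j + 1)| ≤ S.A * c := by
        rw [abs_mul, abs_of_nonneg (by linarith)]
        exact mul_le_mul m2 a2.le (abs_nonneg _) (by linarith)
      refine (abs_add_le _ _).trans ?_
      have := abs_add_le (r (j + 2)) (r j)
      linarith
    refine ⟨m, m1, by linarith, ?_⟩
    rw [e4]; push_cast; ring
  refine ⟨?_, (key i hi).choose_spec.2.2⟩
  obtain ⟨σ, hσ, hs0⟩ : ∃ σ, Sgn σ ∧ 0 ≤ σ * r i := by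
    rcases le_total 0 (r i) with h | h
    · exact ⟨1, Or.inl rfl, by linarith⟩
    · exact ⟨-1, Or.inr rfl, by linarith⟩
  have := (bdd_decr (fun j => σ * (-1) ^ j * r (i + j)) c (fun j => by
      rw [abs_mul, (hσ.mul (sgn_pow _)).abs, one_mul]; exact (hs _ (by omega)).1.le) (fun j => by
      obtain ⟨m, hm, e, _⟩ := key (i + j) (by omega)
      refine ⟨m, hm, ?_⟩
      rw [show i + (j + 2) = i + j + 2 from rfl, e, show i + (j + 1) = i + j + 1 from rfl]
      ring) (by simpa using hs0) 0).1
  have hb := (hs (i + 1) (by omega)).2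
  have ha := (hs i hi).2
  have n0 := hr0 i
  have n1 := hr0 (i + 1)
  simp only [zero_add, pow_one] at this
  rcases hσ with h | h <;> subst h <;> rcases ha with ha | ha <;> rcases hb with hb | hb <;>
    first
    | (have b1 := ha.1; have b2 := hb.1; rw [show i + 1 + 1 = i + 2 from rfl] at b2; omega)
    | (exfalso; rcases lt_or_gt_of_ne n0 with h | h <;> rcases lt_or_gt_of_ne n1 with h' | h' <;>
        linarith [ha.2, hb.2])

theorem sticky_inj {c : ℝ} (hc : S.Small c) (n : ℤ) (i0 : ℕ) (l : List (ℤ × ℤ)) :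
    {y : ℝ | (∀ i, NI (S.X (n, y) (i + 1))) ∧ (∀ i ≥ i0, ¬ gd c (S.X (n, y) (i + 1))) ∧
      itin (S.X (n, y)) (i0 + 3) = l}.Subsingleton := by
  rintro y ⟨h1, h2, h3⟩ z ⟨g1, g2, g3⟩
  have he := fun j hj => (itin_eq (h3.trans g3.symm) j hj)
  have hall : ∀ j, (⌊S.X (n, y) (i0 + 1 + j)⌋ = ⌊S.X (n, z) (i0 + 1 + j)⌋ ∧
      round (S.X (n, y) (i0 + 1 + j)) = round (S.X (n, z) (i0 + 1 + j))) ∧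
      (⌊S.X (n, y) (i0 + 1 + j + 1)⌋ = ⌊S.X (n, z) (i0 + 1 + j + 1)⌋ ∧
      round (S.X (n, y) (i0 + 1 + j + 1)) = round (S.X (n, z) (i0 + 1 + j + 1))) := by
    intro j
    induction j with
    | zero => exact ⟨he _ (by omega), he _ (by omega)⟩
    | succ j ih =>
      refine ⟨ih.2, ?_⟩
      have a := (sticky hc (n, y) i0 h1 h2 (i0 + j) (by omega)).2
      have b := (sticky hc (n, z) i0 g1 g2 (i0 + j) (by omega)).2
      have a' := (sticky hc (n, y) i0 h1 h2 (i0 + j + 1) (by omega)).1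
      have b' := (sticky hc (n, z) i0 g1 g2 (i0 + j + 1) (by omega)).1
      rw [show i0 + 1 + j + 1 = i0 + j + 2 by omega, show i0 + 1 + j = i0 + j + 1 by omega] at ih
      rw [show i0 + 1 + (j + 1) + 1 = i0 + j + 3 by omega]
      rw [ih.2.1, ih.2.2, ih.1.2, ← b] at a
      have a := Int.cast_injective a
      refine ⟨?_, a⟩
      rw [show i0 + j + 1 + 2 = i0 + j + 3 by omega, show i0 + j + 1 + 1 = i0 + j + 2 by omega] at a' b'
      omega
  have hfl : ∀ j, ⌊S.X (n, y) j⌋ = ⌊S.X (n, z) j⌋ := by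
    intro j
    by_cases hj : j < i0 + 3
    · exact (he j hj).1
    · have := (hall (j - (i0 + 1))).1.1
      rwa [show i0 + 1 + (j - (i0 + 1)) = j by omega] at this
  have r1 : S.Rec (fun j => ⌊S.X (n, y) j⌋) (S.X (n, y)) := S.rec_X _ _ fun j => (h1 j).cell
  have r2 : S.Rec (fun j => ⌊S.X (n, y) j⌋) (S.X (n, z)) := S.rec_X _ _ fun j => by
    simp only [hfl]; exact (g1 j).cell
  obtain ⟨σ, hσ, e0, _, hd⟩ := S.pair _ _ _ r1 r2 1 (fun j => by
    have a := (h1 j).cell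
    have b := (g1 j).cell
    rw [← hfl] at b
    rw [abs_le]; constructor <;> linarith [a.1, a.2, b.1, b.2])
  have e1 : nd σ (S.X (n, z)) (S.X (n, y)) 0 = 0 := by rw [e0]; simp [Sys.X]
  have := hd 0
  rw [e1] at this
  have h := nd_inv hσ (S.X (n, z)) (S.X (n, y)) 1
  rw [le_antisymm this.2 this.1, mul_zero, add_zero] at h
  exact h.symm

/-- generic points on integer lines -/
theorem gen_line {c : ℝ} (hc : S.Small c) (n : ℤ) : ∀ᵐ y : ℝ, (∀ i, NI (S.X (n, y) (i + 1))) ∧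
    ∀ i0, ∃ i ≥ i0, gd c (S.X (n, y) (i + 1)) := by
  have h1 : (⋃ m : ℕ, ⋃ l : List (ℤ × ℤ), {y : ℝ | (∀ i < m, NI (S.X (n, y) (i + 1))) ∧
      ¬ NI (S.X (n, y) (m + 1)) ∧ itin (S.X (n, y)) (m + 2) = l}).Countable :=
    countable_iUnion fun m => countable_iUnion fun l => (first_int n m l).countable
  have h2 : (⋃ i0 : ℕ, ⋃ l : List (ℤ × ℤ), {y : ℝ | (∀ i, NI (S.X (n, y) (i + 1))) ∧
      (∀ i ≥ i0, ¬ gd c (S.X (n, y) (i + 1))) ∧ itin (S.X (n, y)) (i0 + 3) = l}).Countable :=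
    countable_iUnion fun m => countable_iUnion fun l => (sticky_inj hc n m l).countable
  filter_upwards [h1.ae_notMem volume, h2.ae_notMem volume] with y a b
  have hNI : ∀ i, NI (S.X (n, y) (i + 1)) := by
    by_contra hcon
    push Not at hcon
    classical
    apply a
    simp only [mem_iUnion]
    exact ⟨Nat.find hcon, _, fun i hi => not_not.1 (Nat.find_min hcon hi), Nat.find_spec hcon, rfl⟩
  refine ⟨hNI, ?_⟩
  by_contra hcon
  push Not at hcon
  obtain ⟨i0, hi0⟩ := hcon
  apply b
  simp only [mem_iUnion]
  exact ⟨i0, _, hNI, hi0, rfl⟩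

end BB

namespace BB
variable {S : Sys} (R : Par S)

theorem gd_of {k : ℤ} {d x : ℝ} (hd : 0 < d) (h1 : k + d ≤ x) (h2 : x ≤ k + 1 - d) : gd d x := by
  have : ⌊x⌋ = k := by rw [Int.floor_eq_iff]; constructor <;> linarith
  unfold gd
  rw [← Int.self_sub_floor, this]
  constructor <;> linarith

theorem line (V : ℕ → Set (ℝ × ℝ)) (hV : Antitone V)
    (h : ∀ n : ℤ, ∀ᵐ y : ℝ, ∃ k, ((n:ℝ), y) ∉ closure (V k)) (ε : ℝ) (hε : 0 < ε) :
    ∃ k : ℕ, ∀ d : ℝ, 0 < d → d ≤ 1 / ((k:ℝ) + 1) →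
      μ {q | ¬ gd d q.2 ∧ q.swap ∈ V k} ≤ ENNReal.ofReal (ε * d) := by
  set W : ℤ → ℕ → Set ℝ := fun n k => Prod.snd ''
    ((Icc ((n:ℝ) - 1 / ((k:ℝ) + 1)) (n + 1 / ((k:ℝ) + 1)) ×ˢ Icc (0:ℝ) 2) ∩ closure (V k)) with hW
  have hmono : ∀ n, Antitone (W n) := by
    intro n a b hab
    have : 1 / ((b:ℝ) + 1) ≤ 1 / ((a:ℝ) + 1) := Nat.one_div_le_one_div hab
    exact image_mono (inter_subset_inter (prod_mono (Icc_subset_Icc (by linarith) (by linarith)) le_rfl)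
      (closure_mono (hV hab)))
  have hcpt : ∀ n k, IsCompact (W n k) := fun n k =>
    ((isCompact_Icc.prod isCompact_Icc).inter_right isClosed_closure).image continuous_snd
  have hnull : ∀ n, volume (⋂ k, W n k) = 0 := by
    intro n
    refine measure_mono_null ?_ (ae_iff.1 (h n))
    intro y hy
    rw [mem_iInter] at hy
    simp only [mem_ofPred_eq, not_exists, not_not]
    intro j
    choose a ha hay using hy
    have e : ∀ k, a k = ((a k).1, y) := fun k => by rw [← hay k]
    have ht : Tendsto a atTop (nhds ((n:ℝ), y)) := by
      rw [show a = fun k => ((a k).1, y) from funext e]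
      refine Tendsto.prodMk_nhds ?_ tendsto_const_nhds
      have h1 := tendsto_one_div_add_atTop_nhds_zero_nat (𝕜 := ℝ)
      refine tendsto_of_tendsto_of_tendsto_of_le_of_le (g := fun k : ℕ => (n:ℝ) - 1 / ((k:ℝ) + 1))
        (h := fun k : ℕ => (n:ℝ) + 1 / ((k:ℝ) + 1))
        (by simpa using h1.const_sub (n:ℝ)) (by simpa using h1.const_add (n:ℝ))
        (fun k => (ha k).1.1.1) (fun k => (ha k).1.1.2)
    exact isClosed_closure.mem_of_tendsto ht (eventually_atTop.2 ⟨j, fun k hk =>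
      closure_mono (hV hk) (ha k).2⟩)
  have hlim : ∀ n, ∃ k, volume (W n k) < ENNReal.ofReal (ε / 6) := by
    intro n
    have := tendsto_measure_iInter_atTop (μ := volume) (s := W n)
      (fun k => (hcpt n k).measurableSet.nullMeasurableSet) (hmono n)
      ⟨0, (hcpt n 0).measure_lt_top.ne⟩
    rw [hnull] at this
    exact (this.eventually_lt_const (ENNReal.ofReal_pos.2 (by positivity))).exists
  obtain ⟨k0, h0⟩ := hlim 0
  obtain ⟨k1, h1⟩ := hlim 1
  obtain ⟨k2, h2⟩ := hlim 2
  set k := max k0 (max k1 k2) with hk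
  refine ⟨k, fun d d0 d1 => ?_⟩
  have hWk : ∀ n : ℤ, (n = 0 ∨ n = 1 ∨ n = 2) → volume (W n k) ≤ ENNReal.ofReal (ε / 6) := by
    rintro n (h | h | h) <;> subst h
    · exact (measure_mono (hmono 0 (by omega))).trans h0.le
    · exact (measure_mono (hmono 1 (by omega))).trans h1.le
    · exact (measure_mono (hmono 2 (by omega))).trans h2.le
  set Z : ℤ → Set (ℝ × ℝ) := fun n => W n k ×ˢ Icc ((n:ℝ) - d) (n + d) with hZ
  have hZm : ∀ n : ℤ, (n = 0 ∨ n = 1 ∨ n = 2) → volume (Z n) ≤ ENNReal.ofReal (ε / 6 * (2 * d)) := by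
    intro n hn
    rw [hZ, Measure.volume_eq_prod, Measure.prod_prod, Real.volume_Icc,
      ENNReal.ofReal_mul (by positivity)]
    exact mul_le_mul' (hWk n hn) (by apply ENNReal.ofReal_le_ofReal; linarith)
  have hsub : {q : ℝ × ℝ | ¬ gd d q.2 ∧ q.swap ∈ V k} ∩ I2 ×ˢ I2 ⊆ Z 0 ∪ (Z 1 ∪ Z 2) := by
    rintro ⟨x, y⟩ ⟨⟨hq, hv⟩, hx, hy⟩
    have hin : ∀ n : ℤ, (n:ℝ) - d ≤ y → y ≤ n + d → (x, y) ∈ Z n := by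
      intro n a b
      refine ⟨⟨(y, x), ⟨⟨⟨by simp only; linarith, by simp only; linarith⟩, hx.1, hx.2.le⟩,
        subset_closure hv⟩, rfl⟩, a, b⟩
    have f0 := Int.fract_nonneg y
    have f1 := Int.fract_lt_one y
    have ff := Int.floor_add_fract y
    have hy0 := hy.1
    have hy2 := hy.2
    simp only at hy0 hy2
    have : ⌊y⌋ = 0 ∨ ⌊y⌋ = 1 := by
      have a : 0 ≤ ⌊y⌋ := Int.floor_nonneg.2 hy0
      have b : ⌊y⌋ < 2 := Int.floor_lt.2 (by exact_mod_cast hy2)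
      omega
    by_cases hg : d ≤ Int.fract y
    · have hg2 : 1 - d < Int.fract y := by
        by_contra hcon
        exact hq ⟨hg, not_lt.1 hcon⟩
      rcases this with h | h <;> rw [h] at ff <;> push_cast at ff
      · exact Or.inr (Or.inl (hin 1 (by push_cast; linarith) (by push_cast; linarith)))
      · exact Or.inr (Or.inr (hin 2 (by push_cast; linarith) (by push_cast; linarith)))
    · push Not at hg
      rcases this with h | h <;> rw [h] at ff <;> push_cast at ff
      · exact Or.inl (hin 0 (by push_cast; linarith) (by push_cast; linarith))
      · exact Or.inr (Or.inl (hin 1 (by push_cast; linarith) (by push_cast; linarith)))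
  rw [μ_eq, Measure.restrict_apply' (show MeasurableSet (I2 ×ˢ I2) from measurableSet_Ico.prod measurableSet_Ico)]
  refine (measure_mono hsub).trans ((measure_union_le _ _).trans
    ((add_le_add le_rfl (measure_union_le _ _)).trans ?_))
  refine (add_le_add (hZm 0 (by simp)) (add_le_add (hZm 1 (by simp)) (hZm 2 (by simp)))).trans ?_
  rw [← ENNReal.ofReal_add (by positivity) (by positivity),
    ← ENNReal.ofReal_add (by positivity) (by positivity)]
  apply ENNReal.ofReal_le_ofReal
  linarith

theorem X_contAt {p : ℝ × ℝ} (h : ∀ i, NI (S.X p (i + 1))) : ∀ i, ContinuousAt (fun p => S.X p i) p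
  | 0 => continuous_fst.continuousAt
  | 1 => continuous_snd.continuousAt
  | (i + 2) => by
    have h1 := X_contAt h (i + 1)
    have h2 := X_contAt h i
    exact (ContinuousAt.comp (f := fun p => S.X p (i + 1)) (g := S.φ)
      (S.φ_contAt _ _ (h i).cell.1 (h i).cell.2) h1).sub h2

theorem not_closure {V : Set (ℝ × ℝ)} {p : ℝ × ℝ} (h : ∀ᶠ q in nhds p, q ∉ V) : p ∉ closure V := by
  rw [mem_closure_iff_frequently]
  exact fun hf => hf (h.mono fun _ hx => hx)

theorem dc2 {c : ℝ} (hc : S.Small c) (m : ℕ) (ε : ℝ) (hε : 0 < ε) : ∃ δ > 0, ∀ d, 0 < d → d ≤ δ →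
    μ {q | ¬ gd d q.2 ∧ ¬ gd d (S.X q.swap (m + 1))} ≤ ENNReal.ofReal (ε * d) := by
  obtain ⟨k, hk⟩ := line (fun k => {p | ¬ gd (1 / ((k:ℝ) + 1)) (S.X p (m + 1))}) (by
      intro a b hab p hp hg
      exact hp (gd_mono (Nat.one_div_le_one_div hab) hg)) (by
    intro n
    filter_upwards [gen_line hc n] with y hy
    have hcell := (hy.1 m).cell
    set a := S.X (n, y) (m + 1) with ha
    set e : ℝ := min (a - ⌊a⌋) (⌊a⌋ + 1 - a) / 2 with he
    have h1 := min_le_left (a - ⌊a⌋) (⌊a⌋ + 1 - a)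
    have h2 := min_le_right (a - ⌊a⌋) (⌊a⌋ + 1 - a)
    have e0 : 0 < e := half_pos (lt_min (by linarith [hcell.1]) (by linarith [hcell.2]))
    obtain ⟨k, hk⟩ := exists_nat_one_div_lt e0
    refine ⟨k, not_closure ?_⟩
    filter_upwards [Metric.continuousAt_iff'.1 (X_contAt hy.1 (m + 1)) e e0] with q hq hn
    rw [Real.dist_eq, ← ha, abs_lt] at hq
    exact hn (gd_mono hk.le (gd_of (k := ⌊a⌋) e0 (by linarith) (by linarith)))) ε hε
  refine ⟨1 / ((k:ℝ) + 1), by positivity, fun d d0 d1 => (measure_mono ?_).trans (hk d d0 d1)⟩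
  rintro q ⟨h1, h2⟩
  exact ⟨h1, fun h => h2 (gd_mono d1 h)⟩

theorem cnt_unbdd (c : ℝ) (x : ℕ → ℝ) (h : ∀ i0, ∃ i ≥ i0, gd c (x (i + 1))) (M : ℕ) :
    ∃ K, M < cnt c x K := by
  have hm : Monotone (cnt c x) := monotone_nat_of_le_succ (cnt_mono1 c x)
  induction M with
  | zero =>
    obtain ⟨i, _, hi⟩ := h 0
    exact ⟨i + 1, by simp [cnt, hi]⟩
  | succ M ih =>
    obtain ⟨K, hK⟩ := ih
    obtain ⟨i, h1, hi⟩ := h K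
    refine ⟨i + 1, ?_⟩
    have := hm h1
    simp [cnt, hi]; omega

theorem cnt_near {c : ℝ} (c0 : 0 < c) {p : ℝ × ℝ} (h : ∀ i, NI (S.X p (i + 1))) (K : ℕ) :
    ∀ᶠ q in nhds p, cnt (2 * c) (S.X p) K ≤ cnt c (S.X q) K := by
  induction K with
  | zero => exact Eventually.of_forall fun _ => le_rfl
  | succ K ih =>
    filter_upwards [ih, Metric.continuousAt_iff'.1 (X_contAt h (K + 1)) c c0] with q h1 h2
    simp only [cnt]
    refine add_le_add h1 ?_
    split_ifs with a b b <;> try omega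
    exfalso
    apply b
    rw [Real.dist_eq, abs_lt] at h2
    have := (h K).cell.gd a
    exact gd_of (k := ⌊S.X p (K + 1)⌋) c0 (by linarith) (by linarith)

theorem T_swap_iter (p) (n : ℕ) : S.T^[n] (S.T^[n] p).swap = p.swap := by
  induction n generalizing p with
  | zero => rfl
  | succ n ih =>
    rw [Function.iterate_succ_apply, Function.iterate_succ_apply' S.T n p, S.T_swap_T, ih]

theorem X_swap_ge (p) (n a : ℕ) : S.X (S.T^[n] p).swap (a + n) = S.X p.swap a := by
  rw [← S.X_iter, T_swap_iter]

theorem X_swap_le (p) (n m : ℕ) : S.X (S.T^[n + m] p).swap m = S.X p (n + 1) := by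
  have := X_swap_ge (S := S) (S.T^[n] p) m 0
  rw [← Function.iterate_add_apply, zero_add, add_comm m n] at this
  rw [this, S.T_iter]; rfl

theorem cnt_swap (c : ℝ) (p) (K i : ℕ) :
    cnt c (S.X (S.T^[i + K] p).swap) K ≤ cnt c (S.X p) (i + K) := by
  have : ∀ m n, cnt c (S.X (S.T^[n + m] p).swap) m + cnt c (S.X p) n ≤ cnt c (S.X p) (n + m) := by
    intro m
    have : ∀ j ≤ m, ∀ n, cnt c (S.X (S.T^[n + m] p).swap) j + cnt c (S.X p) (n + (m - j)) ≤
        cnt c (S.X p) (n + m) := by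
      intro j
      induction j with
      | zero => intro _ n; simp [cnt]
      | succ j ih =>
        intro hj n
        have a := ih (by omega) n
        have e := X_swap_le (S := S) p (n + (m - (j + 1))) (j + 1)
        rw [show n + (m - (j + 1)) + (j + 1) = n + m by omega] at e
        rw [show n + (m - j) = n + (m - (j + 1)) + 1 by omega] at a
        simp only [cnt] at a ⊢
        rw [e]
        omega
    intro n
    simpa using this m le_rfl n
  have := this K i
  omega

theorem per_near (S : Sys) (d : ℝ) : Per {q : ℝ × ℝ | ¬ gd d q.2} :=
  (per_gd (S := S) d 1).compl

theorem tail (hc : S.Small (2 * R.c)) (ε : ℝ) (hε : 0 < ε) : ∃ K : ℕ, ∃ δ > 0, ∀ d, 0 < d → d ≤ δ →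
    μ {p | gd R.c p.2 ∧ ∃ i ≥ K, ¬ gd (d * R.q ^ R.N (S.X p) i) (S.X p (i + 1))} ≤
      ENNReal.ofReal (ε * d) := by
  have hq := R.q1
  have hq0 := R.q0
  obtain ⟨M, hM⟩ := exists_pow_lt_of_lt_one (show 0 < ε * (1 - R.q) / 16 by
    have : 0 < 1 - R.q := by linarith
    positivity) hq
  obtain ⟨K, hK⟩ := line (fun k => {p | R.N (S.X p) k ≤ M})
    (fun a b hab p hp => (R.N_mono _ hab).trans hp) (by
      intro n
      filter_upwards [gen_line hc n] with y hy
      obtain ⟨K, hK⟩ := cnt_unbdd _ _ hy.2 M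
      refine ⟨K, not_closure ?_⟩
      filter_upwards [cnt_near R.c0 hy.1 K] with q hq
      simp only [not_le]
      exact hK.trans_le hq) (ε / (2 * (M + 1))) (by positivity)
  refine ⟨K, 1 / ((K:ℝ) + 1), by positivity, fun d d0 d1 => ?_⟩
  set B : ℕ → Set (ℝ × ℝ) := fun N => if N ≤ M then {q | ¬ gd d q.2 ∧ R.N (S.X q.swap) K ≤ M} else
    {q | ¬ gd (d * R.q ^ N) q.2} with hB
  have hBp : ∀ N, Per (B N) := by
    intro N
    simp only [hB]
    split_ifs
    · exact (per_near S d).inter (per_N R K (Iic M)).swap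
    · exact per_near S _
  refine (measure_mono ?_).trans ((trick2 R B hBp).trans ?_)
  · rintro p ⟨hg, i, hi, hn⟩
    refine ⟨hg, i, ?_⟩
    simp only [hB]
    split_ifs with h
    · refine ⟨fun hgd => hn ?_, ?_⟩
      · rw [S.T_iter] at hgd
        exact gd_mono (mul_le_of_le_one_right d0.le (R.qn1 _)) hgd
      · have := cnt_swap (S := S) R.c p K (i - K)
        rw [show i - K + K = i by omega] at this
        exact this.trans h
    · rw [S.T_iter]; exact hn
  · have hsum := Summable.sum_add_tsum_nat_add' (f := fun n => μ (B n)) (k := M + 1)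
      ENNReal.summable
    rw [← hsum]
    have a1 : ∑ N ∈ Finset.range (M + 1), μ (B N) ≤ ENNReal.ofReal (ε / 2 * d) := by
      refine (Finset.sum_le_sum (g := fun _ => ENNReal.ofReal (ε / (2 * (M + 1)) * d))
        fun N hN => ?_).trans ?_
      · have : N ≤ M := by have := Finset.mem_range.1 hN; omega
        simp only [hB, this, if_true]
        exact hK d d0 d1
      · rw [Finset.sum_const, Finset.card_range, ← ENNReal.ofReal_nsmul]
        apply ENNReal.ofReal_le_ofReal
        rw [nsmul_eq_mul]
        push_cast
        apply le_of_eq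
        field_simp
    have a2 : ∑' n, μ (B (n + (M + 1))) ≤ ENNReal.ofReal (ε / 2 * d) := by
      have : ∀ n, μ (B (n + (M + 1))) ≤ ENNReal.ofReal (8 * d * R.q ^ (M + 1) * R.q ^ n) := by
        intro n
        have : ¬ (n + (M + 1) ≤ M) := by omega
        simp only [hB, this, if_false]
        refine (near_le _).trans (ENNReal.ofReal_le_ofReal ?_)
        rw [pow_add]; apply le_of_eq; ring
      refine (ENNReal.tsum_le_tsum this).trans ?_
      rw [← ENNReal.ofReal_tsum_of_nonneg (fun n => by positivity)
        ((summable_geometric_of_lt_one hq0.le hq).mul_left _), tsum_mul_left,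
        tsum_geometric_of_lt_one hq0.le hq]
      apply ENNReal.ofReal_le_ofReal
      have h1 : 0 < 1 - R.q := by linarith
      rw [mul_inv_le_iff₀ h1]
      have h2 : R.q ^ (M + 1) ≤ R.q ^ M := pow_le_pow_of_le_one hq0.le hq.le (by omega)
      nlinarith
    refine (add_le_add a1 a2).trans ?_
    rw [← ENNReal.ofReal_add (by positivity) (by positivity)]
    apply ENNReal.ofReal_le_ofReal; linarith

end BB

namespace BB
variable {S : Sys} (R : Par S)

theorem cell_fail {x y : ℝ} (h : ¬ ∃ k, Cell k x ∧ Cell k y) :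
    ∃ m : ℤ, (y ≤ m ∧ m ≤ x) ∨ (x ≤ m ∧ m ≤ y) := by
  by_contra hcon
  push Not at hcon
  apply h
  have h0 := Int.floor_le x
  have h1 := Int.lt_floor_add_one x
  have a := hcon ⌊x⌋
  have b := hcon (⌊x⌋ + 1)
  push_cast at b
  have c1 : (⌊x⌋ : ℝ) < y := by
    by_contra hc
    linarith [a.1 (not_lt.1 hc)]
  have c2 : y < ⌊x⌋ + 1 := by
    by_contra hc
    linarith [b.2 h1.le]
  have c3 : (⌊x⌋ : ℝ) ≠ x := fun he => by
    have := a.2 he.ge; linarith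
  exact ⟨⌊x⌋, ⟨lt_of_le_of_ne h0 c3, h1⟩, c1, c2⟩

theorem near_not {x D : ℝ} {m : ℤ} (h : |x - m| < D) : ¬ gd D x := by
  intro hg
  have hD : 0 < D := (abs_nonneg _).trans_lt h
  have hc := (hg.cell hD).gd hg
  rw [abs_lt] at h
  rcases lt_or_ge ⌊x⌋ m with h1 | h1
  · have : ((⌊x⌋ : ℤ):ℝ) + 1 ≤ m := by exact_mod_cast h1
    linarith
  · have : (m:ℝ) ≤ ⌊x⌋ := by exact_mod_cast h1
    linarith

def Tl (d : ℝ) (K : ℕ) : Set (ℝ × ℝ) :=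
  {p | gd R.c p.2 ∧ ∃ i ≥ K, ¬ gd (d * R.q ^ R.N (S.X p) i) (S.X p (i + 1))}

def Fl (s d : ℝ) (i : ℕ) (p : ℝ × ℝ) : Prop :=
  ∃ m : ℤ, 0 ≤ s * (-1) ^ i * (S.X p (i + 1) - m) ∧ s * (-1) ^ i * (S.X p (i + 1) - m) ≤ d

theorem Fl.near {s d : ℝ} {i : ℕ} {p : ℝ × ℝ} (hs : Sgn s) (h : Fl (S := S) s d i p) :
    ∃ m : ℤ, |S.X p (i + 1) - m| ≤ d := by
  obtain ⟨m, h1, h2⟩ := h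
  refine ⟨m, ?_⟩
  rw [← abs_of_nonneg h1, abs_mul, (hs.mul (sgn_pow i)).abs, one_mul] at h2
  exact h2

theorem gs_fail (p : ℝ × ℝ) (s d d' : ℝ) (hs : Sgn s) (hd : 0 < d) (hd' : d' = s * d) (K : ℕ)
    (hg : gd R.c p.2) (h : ¬ R.GS p d') : p ∈ Tl R (2 * d) K ∨ ∃ i < K, Fl (S := S) s d i p := by
  unfold Par.GS at h
  push Not at h
  obtain ⟨i, hi⟩ := h
  have hq := R.qn0 (R.N (S.X p) i)
  have hq1 := R.qn1 (R.N (S.X p) i)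
  have hss := (hs.mul (sgn_pow i)).sq
  obtain ⟨m, hm⟩ := cell_fail (x := S.X p (i + 1))
    (y := S.X p (i + 1) - (-1) ^ i * d' * R.q ^ R.N (S.X p) i) (by
      rintro ⟨k, h1, h2⟩; exact hi k h1 h2)
  have key : 0 ≤ s * (-1) ^ i * (S.X p (i + 1) - m) ∧
      s * (-1) ^ i * (S.X p (i + 1) - m) ≤ d * R.q ^ R.N (S.X p) i := by
    have hp : 0 < d * R.q ^ R.N (S.X p) i := by positivity
    rw [hd'] at hm
    rcases hs.mul (sgn_pow i) with e | e
    · have : (-1) ^ i * (s * d) * R.q ^ R.N (S.X p) i = d * R.q ^ R.N (S.X p) i := by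
        linear_combination (d * R.q ^ R.N (S.X p) i) * e
      rw [this] at hm
      rw [e]
      rcases hm with hm | hm <;> constructor <;> linarith
    · have : (-1) ^ i * (s * d) * R.q ^ R.N (S.X p) i = - (d * R.q ^ R.N (S.X p) i) := by
        linear_combination (d * R.q ^ R.N (S.X p) i) * e
      rw [this] at hm
      rw [e]
      rcases hm with hm | hm <;> constructor <;> linarith
  by_cases hK : i < K
  · exact Or.inr ⟨i, hK, m, key.1, key.2.trans (mul_le_of_le_one_right hd.le hq1)⟩
  · obtain ⟨m, hm⟩ := Fl.near (S := S) hs ⟨m, key⟩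
    refine Or.inl ⟨hg, i, not_lt.1 hK, near_not (m := m) (hm.trans_lt ?_)⟩
    have : 0 < d * R.q ^ R.N (S.X p) i := by positivity
    linarith

def Dbl (D : ℝ) (K : ℕ) (p : ℝ × ℝ) : Prop :=
  ∃ a b, a < b ∧ b < K ∧ ¬ gd D (S.X p (a + 1)) ∧ ¬ gd D (S.X p (b + 1))

theorem Dbl.mk {D : ℝ} {K : ℕ} {p : ℝ × ℝ} {a b : ℕ} (h : a ≠ b) (ha : a < K) (hb : b < K)
    (h1 : ¬ gd D (S.X p (a + 1))) (h2 : ¬ gd D (S.X p (b + 1))) : Dbl (S := S) D K p := by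
  rcases lt_or_gt_of_ne h with h | h
  · exact ⟨a, b, h, hb, h1, h2⟩
  · exact ⟨b, a, h, ha, h2, h1⟩

theorem diverge (P : ℝ × ℝ) (r : ℝ) (hr : 0 < r) (n : ℕ)
    (h : ∀ i < n, ∃ k, Cell k (S.X P (i + 1)) ∧ Cell k (S.X (P.1, P.2 + r) (i + 1))) :
    0 ≤ nd (-1) (S.X (P.1, P.2 + r)) (S.X P) n ∧
    nd (-1) (S.X (P.1, P.2 + r)) (S.X P) n ≤ nd (-1) (S.X (P.1, P.2 + r)) (S.X P) (n + 1) ∧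
    nd (-1) (S.X (P.1, P.2 + r)) (S.X P) (n + 1) ≤ S.A ^ n * r ∧
    r ≤ nd (-1) (S.X (P.1, P.2 + r)) (S.X P) (n + 1) := by
  induction n with
  | zero => simp [nd, Sys.X, hr.le]
  | succ n ih =>
    obtain ⟨a1, a2, a3, a4⟩ := ih fun i hi => h i (by omega)
    obtain ⟨k, c1, c2⟩ := h n (by omega)
    obtain ⟨m, m1, m2, m3, _⟩ := S.nd_rec (fun _ => k) (-1) (Or.inr rfl) (S.X (P.1, P.2 + r)) (S.X P) n
      (by rw [S.X_succ2, S.φ_eq _ _ c2.1 c2.2]) (by rw [S.X_succ2, S.φ_eq _ _ c1.1 c1.2])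
    set e0 := nd (-1) (S.X (P.1, P.2 + r)) (S.X P) n
    set e1 := nd (-1) (S.X (P.1, P.2 + r)) (S.X P) (n + 1)
    rw [show n + 1 + 1 = n + 2 from rfl, m3]
    have b1 : 2 * e1 ≤ m * e1 := mul_le_mul_of_nonneg_right m1 (by linarith)
    have b2 : m * e1 ≤ S.A * e1 := mul_le_mul_of_nonneg_right m2 (by linarith)
    have b3 : S.A * e1 ≤ S.A * (S.A ^ n * r) := mul_le_mul_of_nonneg_left a3 (by linarith)
    refine ⟨by linarith, by linarith, ?_, by linarith⟩
    rw [pow_succ]; linarith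

theorem sep (P : ℝ × ℝ) (r d D : ℝ) (hr : 0 < r) (hd : 0 ≤ d) (K j j' : ℕ) (hj : j < K) (hj' : j' < K)
    (h1 : Fl (S := S) 1 d j P) (h2 : Fl (S := S) (-1) d j' (P.1, P.2 + r))
    (hD : S.A ^ K * r + 2 * d < D) (hD1 : D ≤ 1) :
    Dbl (S := S) D K P ∨ Dbl (S := S) D K (P.1, P.2 + r) := by
  set Q : ℝ × ℝ := (P.1, P.2 + r) with hQ
  have hdiv := diverge (S := S) P r hr
  rw [← hQ] at hdiv
  have hdist : ∀ i < K, (∀ i' < i, ∃ k, Cell k (S.X P (i' + 1)) ∧ Cell k (S.X Q (i' + 1))) →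
      |S.X Q (i + 1) - S.X P (i + 1)| ≤ S.A ^ K * r := by
    intro i hi hc
    obtain ⟨a1, a2, a3, a4⟩ := hdiv i hc
    rw [← abs_nd (σ := -1) (Or.inr rfl), abs_of_nonneg (by linarith)]
    refine a3.trans (mul_le_mul_of_nonneg_right ?_ hr.le)
    exact pow_le_pow_right₀ (by linarith [S.A_ge]) hi.le
  have hAr : 0 ≤ S.A ^ K * r := mul_nonneg (pow_nonneg (by linarith [S.A_ge]) _) hr.le
  obtain ⟨mP, hmP⟩ := h1.near (Or.inl rfl)
  obtain ⟨mQ, hmQ⟩ := h2.near (Or.inr rfl)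
  have nP : ¬ gd D (S.X P (j + 1)) := near_not (hmP.trans_lt (by linarith))
  have nQ : ¬ gd D (S.X Q (j' + 1)) := near_not (hmQ.trans_lt (by linarith))
  have fin : j = j' → (∀ i' < j, ∃ k, Cell k (S.X P (i' + 1)) ∧ Cell k (S.X Q (i' + 1))) → False := by
    intro e hc
    subst e
    obtain ⟨a1, a2, a3, a4⟩ := hdiv j hc
    have b3 := hdist j hj hc
    rw [← abs_nd (σ := -1) (Or.inr rfl), abs_of_nonneg (by linarith)] at b3
    obtain ⟨m, u1, u2⟩ := h1
    obtain ⟨m', v1, v2⟩ := h2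
    unfold nd at a4 b3
    rw [pow_succ] at a4 b3
    rcases sgn_pow j with e | e <;> rw [e] at u1 u2 v1 v2 a4 b3
    · have e1 : (m:ℝ) < m' := by linarith
      have e2 : (m':ℝ) < m + 1 := by linarith
      norm_cast at e1 e2
      omega
    · have e1 : (m':ℝ) < m := by linarith
      have e2 : (m:ℝ) < m' + 1 := by linarith
      norm_cast at e1 e2
      omega
  by_cases hex : ∃ h, h < K ∧ ¬ ∃ k, Cell k (S.X P (h + 1)) ∧ Cell k (S.X Q (h + 1))
  · classical
    obtain ⟨hK, hn⟩ := Nat.find_spec hex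
    have hmin : ∀ i' < Nat.find hex, ∃ k, Cell k (S.X P (i' + 1)) ∧ Cell k (S.X Q (i' + 1)) := by
      intro i' hi'
      have := Nat.find_min hex hi'
      push Not at this
      exact this (by omega)
    set h := Nat.find hex
    have hd1 := abs_le.1 (hdist h hK hmin)
    obtain ⟨m, hm⟩ := cell_fail hn
    have n1 : ¬ gd D (S.X P (h + 1)) := near_not (m := m) (by
      rw [abs_lt]; rcases hm with hm | hm <;> constructor <;> linarith [hd1.1, hd1.2])
    have n2 : ¬ gd D (S.X Q (h + 1)) := near_not (m := m) (by
      rw [abs_lt]; rcases hm with hm | hm <;> constructor <;> linarith [hd1.1, hd1.2])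
    by_cases e1 : h = j
    · by_cases e2 : h = j'
      · exact (fin (e1.symm.trans e2) (e1 ▸ hmin)).elim
      · exact Or.inr (Dbl.mk e2 hK hj' n2 nQ)
    · exact Or.inl (Dbl.mk e1 hK hj n1 nP)
  · push Not at hex
    by_cases e : j = j'
    · exact (fin e fun i' hi' => hex i' (by omega)).elim
    · refine Or.inr (Dbl.mk e hj hj' (near_not (m := mP) ?_) nQ)
      have hd1 := abs_le.1 (hdist j hj fun i' hi' => hex i' (by omega))
      rw [abs_le] at hmP
      rw [abs_lt]; constructor <;> linarith [hd1.1, hd1.2]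

def Zs (S : Sys) (D : ℝ) (m : ℕ) : Set (ℝ × ℝ) := {q | ¬ gd D q.2 ∧ ¬ gd D (S.X q.swap (m + 1))}

def NN (S : Sys) (D : ℝ) (K : ℕ) : Set (ℝ × ℝ) := ⋃ b ∈ Finset.range K, ⋃ m ∈ Finset.range (2 * K),
  S.T^[b] ⁻¹' Zs S D m

theorem mem_NN {D : ℝ} {K b m : ℕ} {p : ℝ × ℝ} (hb : b < K) (hm : m < 2 * K)
    (h : S.T^[b] p ∈ Zs S D m) : p ∈ NN S D K := by
  simp only [NN, mem_iUnion, Finset.mem_range]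
  exact ⟨b, hb, m, hm, h⟩

theorem Dbl.NN {D : ℝ} {K : ℕ} {p : ℝ × ℝ} (h : Dbl (S := S) D K p) : p ∈ NN S D K := by
  obtain ⟨a, b, hab, hb, h1, h2⟩ := h
  refine mem_NN (b := b) (m := b - a - 1) hb (by omega) ⟨?_, ?_⟩
  · rw [S.T_iter]; exact h2
  · have := X_swap_le (S := S) p a (b - a)
    rw [show a + (b - a) = b by omega] at this
    rw [show b - a - 1 + 1 = b - a by omega, this]
    exact h1

theorem mix_NN {D : ℝ} {K a b : ℕ} {p : ℝ × ℝ} (ha : a < K) (hb : b < K)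
    (h1 : ¬ gd D (S.X p.swap (a + 1))) (h2 : ¬ gd D (S.X p (b + 1))) : p ∈ NN S D K := by
  refine mem_NN (b := b) (m := a + b) hb (by omega) ⟨?_, ?_⟩
  · rw [S.T_iter]; exact h2
  · have := X_swap_ge (S := S) p b (a + 1)
    rw [show a + b + 1 = a + 1 + b by omega, this]
    exact h1

theorem per_Zs (D : ℝ) (m : ℕ) : Per (Zs S D m) :=
  (per_near S D).inter (per_gd (S := S) D (m + 1)).swap.compl

theorem per_NN (D : ℝ) (K : ℕ) : Per (NN S D K) := by
  refine ⟨?_, fun p m n => ?_⟩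
  · exact Finset.measurableSet_biUnion _ fun b _ => Finset.measurableSet_biUnion _ fun m _ =>
      ((per_Zs D m).iter b).1
  · simp only [NN, mem_iUnion]
    exact exists_congr fun b => exists_congr fun _ => exists_congr fun i => exists_congr fun _ =>
      ((per_Zs D i).iter b).2 p m n

theorem ev_of {P : ℝ → Prop} (h : ∃ δ > 0, ∀ d, 0 < d → d ≤ δ → P d) :
    ∀ᶠ d in nhdsWithin (0:ℝ) (Ioi 0), P d := by
  obtain ⟨δ, hδ, h⟩ := h
  filter_upwards [Ioc_mem_nhdsGT hδ] with d hd
  exact h d hd.1 hd.2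

theorem ev_mul {P : ℝ → Prop} (h : ∀ᶠ d in nhdsWithin (0:ℝ) (Ioi 0), P d) (C : ℝ) (hC : 0 < C) :
    ∀ᶠ d in nhdsWithin (0:ℝ) (Ioi 0), P (C * d) := by
  have : Tendsto (fun d => C * d) (nhdsWithin (0:ℝ) (Ioi 0)) (nhdsWithin (0:ℝ) (Ioi 0)) := by
    refine tendsto_nhdsWithin_iff.2 ⟨?_, ?_⟩
    · have : Tendsto (fun d => C * d) (nhds (0:ℝ)) (nhds (C * 0)) :=
        (continuous_const.mul continuous_id).tendsto 0
      rw [mul_zero] at this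
      exact this.mono_left nhdsWithin_le_nhds
    · filter_upwards [self_mem_nhdsWithin] with d hd
      exact mul_pos hC hd
  exact this.eventually h

theorem nn_small {c : ℝ} (hc : S.Small c) (K : ℕ) (ε : ℝ) (hε : 0 < ε) :
    ∀ᶠ D in nhdsWithin (0:ℝ) (Ioi 0), μ (NN S D K) ≤ ENNReal.ofReal (ε * D) := by
  have h : ∀ᶠ D in nhdsWithin (0:ℝ) (Ioi 0), ∀ m ∈ Finset.range (2 * K),
      μ (Zs S D m) ≤ ENNReal.ofReal (ε / (K * (2 * K) + 1) * D) :=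
    (Finset.eventually_all _).2 fun m _ => ev_of (dc2 hc m _ (by positivity))
  filter_upwards [h, self_mem_nhdsWithin] with D hD hD0
  rw [mem_Ioi] at hD0
  have : ∀ b, μ (⋃ m ∈ Finset.range (2 * K), S.T^[b] ⁻¹' Zs S D m) ≤
      (2 * K) • ENNReal.ofReal (ε / (K * (2 * K) + 1) * D) := by
    intro b
    refine (measure_biUnion_finset_le _ _).trans ((Finset.sum_le_card_nsmul _ _ _ fun m hm => ?_).trans
      (by rw [Finset.card_range]))
    rw [(per_Zs D m).μ_iter]; exact hD m hm
  refine (measure_biUnion_finset_le _ _).trans ((Finset.sum_le_card_nsmul _ _ _ fun b _ =>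
    this b).trans ?_)
  rw [Finset.card_range, ← ENNReal.ofReal_nsmul, ← ENNReal.ofReal_nsmul]
  apply ENNReal.ofReal_le_ofReal
  simp only [nsmul_eq_mul]
  push_cast
  have : (K:ℝ) * (2 * K * (ε / (K * (2 * K) + 1) * D)) = (K * (2 * K)) / (K * (2 * K) + 1) * (ε * D) := by
    field_simp
  rw [this]
  apply mul_le_of_le_one_left (by positivity)
  rw [div_le_one (by positivity)]; linarith

end BB

namespace BB
variable {S : Sys} (R : Par S)

theorem gd_add {c r x : ℝ} (hc : 0 < c) (h : gd (2 * c) x) (hr : |r| ≤ c) : gd c (x + r) := by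
  have := (h.cell (by linarith)).gd h
  rw [abs_le] at hr
  exact gd_of (k := ⌊x⌋) hc (by linarith) (by linarith)

theorem mc_det (P : ℝ × ℝ) (r d D : ℝ) (K : ℕ) (hr : 0 < r) (hd : d = r / (1 - R.q)) (hrc : r ≤ R.c)
    (hdc : d < 2 * R.c) (h1 : gd (2 * R.c) P.1) (h2 : gd (2 * R.c) P.2)
    (hD : S.A ^ K * r + 2 * d < D) (hD1 : D ≤ 1)
    (f1 : ¬ R.Hyp r P) (f2 : ¬ R.Hyp (-r) (P.1, P.2 + r)) :
    (P ∈ Tl R (2 * d) K ∨ (P.1, P.2 + r) ∈ Tl R (2 * d) K ∨ P.swap ∈ Tl R (2 * d) K ∨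
      Prod.swap (P.1, P.2 + r) ∈ Tl R (2 * d) K) ∨ (P ∈ NN S D K ∨ (P.1, P.2 + r) ∈ NN S D K ∨
      S.T P.swap ∈ NN S D K ∨ S.T (Prod.swap (P.1, P.2 + r)) ∈ NN S D K) := by
  have hc := R.c0
  have hq := R.q1
  have hd0 : 0 < d := by rw [hd]; exact div_pos hr (by linarith)
  have hAr : 0 ≤ S.A ^ K * r := mul_nonneg (pow_nonneg (by linarith [S.A_ge]) _) hr.le
  have g1 : gd R.c P.1 := gd_mono (by linarith) h1
  have g2 : gd R.c P.2 := gd_mono (by linarith) h2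
  have g3 : gd R.c (P.2 + r) := gd_add hc h2 (by rw [abs_of_pos hr]; exact hrc)
  have i1 : ¬ (R.GS P.swap d ∧ R.GS (P.1, P.2 + r) (-d)) := by
    rintro ⟨a, b⟩
    exact f1 ⟨g1, g3, by rw [← hd]; exact a, by rw [← hd]; exact b⟩
  have i2 : ¬ (R.GS (Prod.swap (P.1, P.2 + r)) (-d) ∧ R.GS P d) := by
    rintro ⟨a, b⟩
    refine f2 ⟨g1, by simpa using g2, by rw [neg_div, ← hd]; exact a, ?_⟩
    rw [neg_div, ← hd, neg_neg]
    simpa using b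
  by_contra hcon
  push Not at hcon
  obtain ⟨⟨t1, t2, t3, t4⟩, n1, n2, n3, n4⟩ := hcon
  have s1 : Sgn (1:ℝ) := Or.inl rfl
  have s2 : Sgn (-1:ℝ) := Or.inr rfl
  have a1 := fun h => (gs_fail R P 1 d d s1 hd0 (by ring) K g2 h).resolve_left t1
  have a2 := fun h => (gs_fail R (P.1, P.2 + r) (-1) d (-d) s2 hd0 (by ring) K g3 h).resolve_left t2
  have a3 := fun h => (gs_fail R P.swap 1 d d s1 hd0 (by ring) K g1 h).resolve_left t3
  have a4 := fun h => (gs_fail R (Prod.swap (P.1, P.2 + r)) (-1) d (-d) s2 hd0 (by ring) K g1 h).resolve_left t4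
  have nr : ∀ (s : ℝ) (i : ℕ) (p : ℝ × ℝ), Sgn s → Fl (S := S) s d i p → ¬ gd D (S.X p (i + 1)) := by
    intro s i p hs h
    obtain ⟨m, hm⟩ := h.near hs
    exact near_not (hm.trans_lt (by linarith))
  have up : ∀ (s : ℝ) (i : ℕ) (p : ℝ × ℝ), p.2 = P.1 → Sgn s → Fl (S := S) s d i p → ∃ j, i = j + 1 ∧
      Fl (S := S) (-s) d j (S.T p) := by
    intro s i p hp hs h
    cases i with
    | zero =>
      exfalso
      obtain ⟨m, hm⟩ := h.near hs
      refine near_not (hm.trans_lt hdc) ?_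
      show gd _ p.2
      rw [hp]; exact h1
    | succ j =>
      refine ⟨j, rfl, ?_⟩
      obtain ⟨m, u, v⟩ := h
      refine ⟨m, ?_⟩
      rw [S.X_T]
      rw [pow_succ] at u v
      constructor <;> linarith
  by_cases b1 : R.GS P.swap d
  · obtain ⟨j', hj', fj'⟩ := a2 fun h => i1 ⟨b1, h⟩
    by_cases b2 : R.GS P d
    · obtain ⟨a, ha, fa⟩ := a4 fun h => i2 ⟨h, b2⟩
      exact n2 (mix_NN ha hj' (nr _ _ _ s2 fa) (nr _ _ _ s2 fj'))
    · obtain ⟨j, hj, fj⟩ := a1 b2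
      rcases sep P r d D hr hd0.le K j j' hj hj' fj fj' hD hD1 with h | h
      · exact n1 h.NN
      · exact n2 h.NN
  · obtain ⟨a, ha, fa⟩ := a3 b1
    by_cases b2 : R.GS P d
    · obtain ⟨b, hb, fb⟩ := a4 fun h => i2 ⟨h, b2⟩
      obtain ⟨j', e', fj'⟩ := up _ _ _ rfl s1 fa
      obtain ⟨j, e, fj⟩ := up _ _ _ rfl s2 fb
      rw [neg_neg] at fj
      have e : ((S.T (Prod.swap (P.1, P.2 + r))).1, (S.T (Prod.swap (P.1, P.2 + r))).2 + r) =
          S.T P.swap := by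
        simp only [Sys.T, Prod.fst_swap, Prod.snd_swap, Prod.mk.injEq, true_and]; ring
      rcases sep (S.T (Prod.swap (P.1, P.2 + r))) r d D hr hd0.le K j j' (by omega) (by omega) fj
        (by rw [e]; exact fj') hD hD1 with h | h
      · exact n4 h.NN
      · rw [e] at h; exact n3 h.NN
    · obtain ⟨j, hj, fj⟩ := a1 b2
      exact n1 (mix_NN ha hj (nr _ _ _ s1 fa) (nr _ _ _ s1 fj))

theorem per_Tl (d : ℝ) (K : ℕ) : Per (Tl R d K) := by
  have e : Tl R d K = {p | gd R.c (S.X p 1)} ∩ ⋃ j : ℕ, ⋃ N : ℕ,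
      ({p | R.N (S.X p) (K + j) ∈ ({N} : Set ℕ)} ∩ {p | gd (d * R.q ^ N) (S.X p (K + j + 1))}ᶜ) := by
    ext p
    simp only [Tl, mem_inter_iff, mem_iUnion, mem_ofPred_eq, mem_compl_iff, mem_singleton_iff]
    refine and_congr Iff.rfl ⟨?_, ?_⟩
    · rintro ⟨i, hi, h⟩
      exact ⟨i - K, _, rfl, by rw [show K + (i - K) = i by omega]; exact h⟩
    · rintro ⟨j, N, rfl, h⟩
      exact ⟨K + j, by omega, h⟩
  rw [e]
  exact (per_gd R.c 1).inter (Per.iUnion fun j => Per.iUnion fun N =>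
    (per_N R _ _).inter (per_gd _ _).compl)

theorem mc (hc : S.Small (2 * R.c)) (A : Set (ℝ × ℝ)) (hA : Per A) (hT : ∀ p, S.T p ∈ A ↔ p ∈ A)
    (ε : ℝ) (hε : 0 < ε) : ∀ᶠ r in nhdsWithin (0:ℝ) (Ioi 0),
    μ {P | gd (2 * R.c) P.1 ∧ gd (2 * R.c) P.2 ∧ ¬(P ∈ A ↔ (P.1, P.2 + r) ∈ A)} ≤
      ENNReal.ofReal (ε * r) := by
  have hq : 0 < 1 - R.q := by linarith [R.q1]
  have hc0 := R.c0
  obtain ⟨K, hK⟩ := tail R hc (ε / 8 / (2 / (1 - R.q))) (by positivity)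
  have hK := ev_mul (ev_of hK) (2 / (1 - R.q)) (by positivity)
  have hA0 : 0 ≤ S.A ^ K := pow_nonneg (by linarith [S.A_ge]) _
  set C : ℝ := S.A ^ K + 2 / (1 - R.q) + 1 with hC
  have hC0 : 0 < C := by positivity
  have hN := ev_mul (nn_small hc K (ε / 8 / C) (by positivity)) C hC0
  have hsm : ∀ᶠ r in nhdsWithin (0:ℝ) (Ioi 0), r ≤ R.c ∧ r / (1 - R.q) ≤ R.c / 4 ∧ C * r ≤ 1 := by
    apply ev_of
    refine ⟨min R.c (min (R.c / 4 * (1 - R.q)) (1 / C)), by positivity, fun d _ hd => ?_⟩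
    rw [le_min_iff, le_min_iff] at hd
    exact ⟨hd.1, (div_le_iff₀ hq).2 hd.2.1, by rw [mul_comm]; exact (le_div_iff₀ hC0).1 hd.2.2⟩
  filter_upwards [hK, hN, hsm, self_mem_nhdsWithin] with r hK hN hsm hr
  rw [mem_Ioi] at hr
  have z1 := T0 R A hA hT r (by rw [abs_of_pos hr]; exact hsm.2.1)
  have z2 := ae_shift (T0 R A hA hT (-r) (by rw [abs_neg, abs_of_pos hr]; exact hsm.2.1)) (0, r)
  set d := r / (1 - R.q) with hd
  have e2d : 2 / (1 - R.q) * r = 2 * d := by rw [hd]; ring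
  change μ (Tl R (2 / (1 - R.q) * r) K) ≤ _ at hK
  rw [e2d] at hK
  have hd0 : 0 < d := by positivity
  set f : ℝ × ℝ → ℝ × ℝ := fun P => P + (0, r) with hf
  have ef : ∀ P, f P = (P.1, P.2 + r) := fun P => by simp [hf, Prod.ext_iff]
  set U : Set (ℝ × ℝ) := (Tl R (2 * d) K ∪ (f ⁻¹' Tl R (2 * d) K ∪ (Prod.swap ⁻¹' Tl R (2 * d) K ∪
    f ⁻¹' (Prod.swap ⁻¹' Tl R (2 * d) K)))) ∪ (NN S (C * r) K ∪ (f ⁻¹' NN S (C * r) K ∪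
      (Prod.swap ⁻¹' (S.T ⁻¹' NN S (C * r) K) ∪ f ⁻¹' (Prod.swap ⁻¹' (S.T ⁻¹' NN S (C * r) K))))) with hU
  have hsub : {P | gd (2 * R.c) P.1 ∧ gd (2 * R.c) P.2 ∧ ¬(P ∈ A ↔ (P.1, P.2 + r) ∈ A)} ≤ᵐ[μ] U := by
    rw [μ_eq]
    filter_upwards [ae_restrict_of_ae z1, ae_restrict_of_ae z2] with P z1 z2
    rintro ⟨g1, g2, h⟩
    have := mc_det R P r d (C * r) K hr hd hsm.1 (by linarith [hsm.2.1]) g1 g2 (by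
      rw [← e2d, hC]; nlinarith) hsm.2.2 (fun hh => h (z1 hh)) (fun hh => h (by
        have e : P + (0, r) = (P.1, P.2 + r) := ef P
        rw [e] at z2
        have := z2 hh
        simp only [neg_add_cancel_right, add_neg_cancel_right] at this
        exact this.symm))
    rw [← ef P] at this
    exact this
  have hTl := per_Tl R (2 * d) K
  have hNN := per_NN (S := S) (C * r) K
  have sw := hTl.swap
  have sN := hNN.T (S := S)
  have m1 : μ (f ⁻¹' Tl R (2 * d) K) = μ (Tl R (2 * d) K) := hTl.μ_add (0, r)
  have m2 := hTl.μ_swap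
  have m3 : μ (f ⁻¹' (Prod.swap ⁻¹' Tl R (2 * d) K)) = μ (Tl R (2 * d) K) :=
    (sw.μ_add (0, r)).trans m2
  have m4 : μ (f ⁻¹' NN S (C * r) K) = μ (NN S (C * r) K) := hNN.μ_add (0, r)
  have m5 : μ (Prod.swap ⁻¹' (S.T ⁻¹' NN S (C * r) K)) = μ (NN S (C * r) K) :=
    sN.μ_swap.trans hNN.μ_T
  have m6 : μ (f ⁻¹' (Prod.swap ⁻¹' (S.T ⁻¹' NN S (C * r) K))) = μ (NN S (C * r) K) :=
    (sN.swap.μ_add (0, r)).trans m5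
  have un4 : ∀ a b c d : Set (ℝ × ℝ), μ (a ∪ (b ∪ (c ∪ d))) ≤ μ a + (μ b + (μ c + μ d)) :=
    fun a b c d => (measure_union_le _ _).trans (add_le_add le_rfl ((measure_union_le _ _).trans
      (add_le_add le_rfl (measure_union_le _ _))))
  refine (measure_mono_ae hsub).trans ((measure_union_le _ _).trans ((add_le_add (un4 _ _ _ _)
    (un4 _ _ _ _)).trans ?_))
  rw [m1, m2, m3, m4, m5, m6]
  have k1 : μ (Tl R (2 * d) K) ≤ ENNReal.ofReal (ε / 8 * r) := by
    refine hK.trans (le_of_eq ?_)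
    rw [← e2d]; congr 1; field_simp
  have k2 : μ (NN S (C * r) K) ≤ ENNReal.ofReal (ε / 8 * r) := by
    refine hN.trans (le_of_eq ?_)
    congr 1; field_simp
  refine (add_le_add (add_le_add k1 (add_le_add k1 (add_le_add k1 k1)))
    (add_le_add k2 (add_le_add k2 (add_le_add k2 k2)))).trans (le_of_eq ?_)
  have : 0 ≤ ε / 8 * r := by positivity
  rw [← ENNReal.ofReal_add this this, ← ENNReal.ofReal_add this (by linarith),
    ← ENNReal.ofReal_add this (by linarith), ← ENNReal.ofReal_add (by linarith) (by linarith)]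
  congr 1; ring

end BB

namespace BB
variable {S : Sys} (R : Par S)

theorem ex_par (S : Sys) (δ : ℝ) (hδ : 0 < δ) : ∃ R : Par S, R.c ≤ δ ∧ S.Small (2 * R.c) := by
  have hA := S.A_ge
  have hs : ∀ x : ℝ, ∃ e > 0, ∀ k : ℤ, |x - k| ≤ e → x = k := by
    intro x
    by_cases hx : Int.fract x = 0
    · refine ⟨1 / 2, by norm_num, fun k hk => ?_⟩
      obtain ⟨z, rfl⟩ := Int.fract_eq_zero_iff.1 hx
      norm_cast at hk ⊢
      by_contra h
      have h1 : (1:ℤ) ≤ |z - k| := Int.one_le_abs (sub_ne_zero.2 h)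
      have h2 : (1:ℝ) ≤ ((|z - k| : ℤ) : ℝ) := by exact_mod_cast h1
      linarith
    · have h0 : 0 < Int.fract x := lt_of_le_of_ne (Int.fract_nonneg x) (Ne.symm hx)
      have h1 := Int.fract_lt_one x
      refine ⟨min (Int.fract x) (1 - Int.fract x) / 2, by
        have := lt_min h0 (sub_pos.2 h1); linarith, fun k hk => ?_⟩
      exfalso
      have m1 := min_le_left (Int.fract x) (1 - Int.fract x)
      have m2 := min_le_right (Int.fract x) (1 - Int.fract x)
      have hf := Int.floor_add_fract x
      rw [abs_le] at hk
      rcases le_or_gt k ⌊x⌋ with h | h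
      · have : (k:ℝ) ≤ ⌊x⌋ := by exact_mod_cast h
        linarith [hk.1, hk.2]
      · have : (⌊x⌋:ℝ) + 1 ≤ k := by exact_mod_cast h
        linarith [hk.1, hk.2]
  obtain ⟨e0, he0, h0⟩ := hs (S.β 0)
  obtain ⟨e1, he1, h1⟩ := hs (S.β 1)
  set c := min (min δ (1 / 32)) (min e0 e1 / (2 * (S.A + 2))) with hc
  have hc0 : 0 < c := by
    have := lt_min he0 he1
    have : 0 < min e0 e1 / (2 * (S.A + 2)) := by positivity
    exact lt_min (lt_min hδ (by norm_num)) this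
  have hc1 : c ≤ 1 / 32 := (min_le_left _ _).trans (min_le_right _ _)
  have hc2 : (S.A + 2) * (2 * c) ≤ min e0 e1 := by
    have : c ≤ min e0 e1 / (2 * (S.A + 2)) := min_le_right _ _
    rw [le_div_iff₀ (by linarith)] at this
    linarith
  obtain ⟨ε, hε, hg⟩ := S.good (c / 2) (by linarith) (by linarith)
  have hr : ∃ ρ : ℝ, 0 < ρ ∧ ρ < 1 ∧ 1 ≤ ρ ^ 3 * (1 + ε) := by
    have hx : 0 < ε / (3 * (1 + ε)) := by positivity
    have hx1 : ε / (3 * (1 + ε)) < 1 := by rw [div_lt_one (by linarith)]; linarith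
    refine ⟨1 - ε / (3 * (1 + ε)), by linarith, by linarith, ?_⟩
    have h := one_add_mul_le_pow (a := -(ε / (3 * (1 + ε)))) (by linarith) 3
    have h' : (1 + (3:ℕ) * -(ε / (3 * (1 + ε)))) * (1 + ε) = 1 := by
      have : 1 + ε ≠ 0 := by linarith
      push_cast; field_simp; ring
    rw [← sub_eq_add_neg] at h
    nlinarith
  obtain ⟨ρ, r0, r1, r2⟩ := hr
  refine ⟨⟨c, ε, ρ, hc0, by linarith, hg, r0, r1, r2⟩, (min_le_left _ _).trans (min_le_left _ _),
    by show 0 < 2 * c; linarith, by show 2 * c < 1 / 8; linarith, ?_⟩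
  rintro b (rfl | rfl) k hk
  · have := h0 k (by simpa using hk.trans (hc2.trans (min_le_left _ _)))
    simpa using this
  · have := h1 k (by simpa using hk.trans (hc2.trans (min_le_right _ _)))
    simpa using this

theorem vert0 (hc : S.Small (2 * R.c)) (A : Set (ℝ × ℝ)) (hA : Per A) (hT : ∀ p, S.T p ∈ A ↔ p ∈ A)
    (t : ℝ) (ht : 0 < t) : ∀ᵐ P : ℝ × ℝ, ¬ (gd (2 * R.c) P.1 ∧
      (∀ s, 0 ≤ s → s ≤ t → gd (2 * R.c) (P.2 + s)) ∧ ¬(P ∈ A ↔ (P.1, P.2 + t) ∈ A)) := by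
  set E := {P : ℝ × ℝ | gd (2 * R.c) P.1 ∧
      (∀ s, 0 ≤ s → s ≤ t → gd (2 * R.c) (P.2 + s)) ∧ ¬(P ∈ A ↔ (P.1, P.2 + t) ∈ A)} with hE
  suffices h : volume E = 0 by
    rw [ae_iff]; convert h using 2; ext P; simp [hE]
  have pg : ∀ x : ℝ, ∀ m : ℤ, gd (2 * R.c) (x + 2 * m) ↔ gd (2 * R.c) x := by
    intro x m
    have : x + 2 * (m:ℝ) = x + ((2 * m : ℤ) : ℝ) := by push_cast; ring
    unfold gd; rw [this, Int.fract_add_intCast]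
  have pA : ∀ (P : ℝ × ℝ) (m n : ℤ) (r : ℝ),
      (P.1 + 2 * m, P.2 + 2 * n + r) ∈ A ↔ (P.1, P.2 + r) ∈ A := by
    intro P m n r
    rw [← hA.2 (P.1, P.2 + r) m n]
    simp only [add_right_comm]
  refine null_vol E (fun p m n hp => ?_) ?_
  · refine ⟨(pg _ _).2 hp.1, fun s s0 s1 => ?_, ?_⟩
    · rw [add_right_comm, pg]; exact hp.2.1 s s0 s1
    · have := hp.2.2
      rwa [hA.2, pA]
  have key : ∀ ε > 0, μ E ≤ ENNReal.ofReal (ε * t) := by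
    intro ε hε
    have hm := mc R hc A hA hT ε hε
    have hlim : Tendsto (fun n : ℕ => t / ((n:ℝ) + 1)) atTop (nhdsWithin (0:ℝ) (Ioi 0)) := by
      refine tendsto_nhdsWithin_iff.2 ⟨?_, Eventually.of_forall fun n => by
        show 0 < t / ((n:ℝ) + 1); positivity⟩
      exact (tendsto_const_div_atTop_nhds_zero_nat t).comp (tendsto_add_atTop_nat 1) |>.congr
        (fun n => by simp)
    obtain ⟨n, hn⟩ := (hlim.eventually hm).exists
    set r := t / ((n:ℝ) + 1) with hr
    have hr0 : 0 < r := by positivity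
    have hrt : ((n:ℝ) + 1) * r = t := by rw [hr]; field_simp
    set D := {P : ℝ × ℝ | gd (2 * R.c) P.1 ∧ gd (2 * R.c) P.2 ∧ ¬(P ∈ A ↔ (P.1, P.2 + r) ∈ A)} with hD
    have hDP : Per D := by
      constructor
      · have h1 : MeasurableSet {P : ℝ × ℝ | (P.1, P.2 + r) ∈ A} :=
          (measurable_fst.prodMk (measurable_snd.add_const r)) hA.1
        have h2 : MeasurableSet {P : ℝ × ℝ | P ∈ A} := hA.1
        exact (measurable_fst (gd_meas _)).inter ((measurable_snd (gd_meas _)).inter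
          (h2.iff h1).compl)
      · intro P m n
        show (_ ∧ _ ∧ _) ↔ (_ ∧ _ ∧ _)
        simp only [pg, hA.2, pA]
    have hsub : E ⊆ ⋃ k ∈ Finset.range (n + 1), (fun p : ℝ × ℝ => p + (0, (k:ℝ) * r)) ⁻¹' D := by
      intro P hP
      by_contra hno
      simp only [mem_iUnion, not_exists] at hno
      have hk : ∀ k : ℕ, k ≤ n + 1 → (P ∈ A ↔ (P.1, P.2 + k * r) ∈ A) := by
        intro k
        induction k with
        | zero => intro _; simp
        | succ k ih =>
          intro hk
          rw [ih (by omega)]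
          have h := hno k (by simp; omega)
          by_contra hne
          apply h
          have hk1 : (k:ℝ) ≤ n + 1 := by exact_mod_cast (by omega : k ≤ n + 1)
          refine ⟨?_, ?_, ?_⟩
          · simpa using hP.1
          · exact hP.2.1 _ (by positivity) (by
            rw [← hrt]; exact mul_le_mul_of_nonneg_right hk1 hr0.le)
          · intro h'
            apply hne
            simp only [Prod.fst_add, Prod.snd_add, add_zero] at h'
            have e : P + (0, (k:ℝ) * r) = (P.1, P.2 + k * r) := by ext <;> simp
            rw [e] at h'
            rw [h']; push_cast; ring_nf
      have := hk (n + 1) le_rfl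
      push_cast at this
      rw [hrt] at this
      exact hP.2.2 this
    refine (measure_mono hsub).trans ((measure_biUnion_finset_le _ _).trans ?_)
    have : ∀ k ∈ Finset.range (n + 1), μ ((fun p : ℝ × ℝ => p + (0, (k:ℝ) * r)) ⁻¹' D)
        ≤ ENNReal.ofReal (ε * r) := fun k _ => (hDP.μ_add _).le.trans hn
    refine (Finset.sum_le_sum this).trans ?_
    rw [Finset.sum_const, Finset.card_range, nsmul_eq_mul, ← ENNReal.ofReal_natCast,
      ← ENNReal.ofReal_mul (by positivity)]
    apply le_of_eq; congr 1; rw [← hrt]; push_cast; ring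
  have hl : Tendsto (fun ε : ℝ => ENNReal.ofReal (ε * t)) (nhdsWithin 0 (Ioi 0)) (nhds 0) := by
    have : Tendsto (fun ε : ℝ => ENNReal.ofReal (ε * t)) (nhds 0) (nhds 0) := by
      have hcont : Continuous fun ε : ℝ => ENNReal.ofReal (ε * t) :=
        ENNReal.continuous_ofReal.comp (continuous_id.mul continuous_const)
      simpa using hcont.tendsto 0
    exact this.mono_left nhdsWithin_le_nhds
  exact le_antisymm (ge_of_tendsto hl (by
    filter_upwards [self_mem_nhdsWithin] with ε hε using key ε hε)) bot_le

theorem vert1 (A : Set (ℝ × ℝ)) (hA : Per A) (hT : ∀ p, S.T p ∈ A ↔ p ∈ A) (t : ℝ) (ht : 0 < t) :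
    ∀ᵐ P : ℝ × ℝ, ∀ i j : ℤ, Cell i P.1 → Cell j P.2 → Cell j (P.2 + t) →
      (P ∈ A ↔ (P.1, P.2 + t) ∈ A) := by
  choose R hR hs using fun n : ℕ => ex_par S (1 / ((n:ℝ) + 1)) (by positivity)
  filter_upwards [ae_all_iff.2 fun n => vert0 (R n) (hs n) A hA hT t ht] with P hP i j h1 h2 h3
  set e := min (min (P.1 - i) (i + 1 - P.1)) (min (P.2 - j) (j + 1 - (P.2 + t))) with he
  have e0 : 0 < e := lt_min (lt_min (by linarith [h1.1]) (by linarith [h1.2]))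
    (lt_min (by linarith [h2.1]) (by linarith [h3.2]))
  have e1 : e ≤ P.1 - i := (min_le_left _ _).trans (min_le_left _ _)
  have e2 : e ≤ i + 1 - P.1 := (min_le_left _ _).trans (min_le_right _ _)
  have e3 : e ≤ P.2 - j := (min_le_right _ _).trans (min_le_left _ _)
  have e4 : e ≤ j + 1 - (P.2 + t) := (min_le_right _ _).trans (min_le_right _ _)
  obtain ⟨n, hn⟩ := exists_nat_one_div_lt (show 0 < e / 2 by linarith)
  have hc := hR n
  have h0 := (R n).c0
  by_contra hne
  exact hP n ⟨gd_of (k := i) (by linarith) (by linarith) (by linarith), fun s s0 s1 =>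
    gd_of (k := j) (by linarith) (by linarith) (by linarith), hne⟩

theorem vert (A : Set (ℝ × ℝ)) (hA : Per A) (hT : ∀ p, S.T p ∈ A ↔ p ∈ A) (t : ℝ) :
    ∀ᵐ P : ℝ × ℝ, ∀ i j : ℤ, Cell i P.1 → Cell j P.2 → Cell j (P.2 + t) →
      (P ∈ A ↔ (P.1, P.2 + t) ∈ A) := by
  rcases lt_trichotomy t 0 with h | rfl | h
  · filter_upwards [ae_shift (vert1 A hA hT (-t) (by linarith)) (0, t)] with P hP i j h1 h2 h3
    have := hP i j (by simpa using h1) (by simpa using h3) (by simpa using h2)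
    simp only [Prod.fst_add, Prod.snd_add, add_zero, add_neg_cancel_right] at this
    rw [← this]
    have e : P + (0, t) = (P.1, P.2 + t) := by ext <;> simp
    rw [e]
  · simp
  · exact vert1 A hA hT t h

theorem tr (A : Set (ℝ × ℝ)) (hA : Per A) (hT : ∀ p, S.T p ∈ A ↔ p ∈ A) (v : ℝ × ℝ) :
    ∀ᵐ P : ℝ × ℝ, ∀ i j : ℤ, Cell i P.1 → Cell j P.2 → Cell i (P.1 + v.1) → Cell j (P.2 + v.2) →
      (P ∈ A ↔ P + v ∈ A) := by
  filter_upwards [vert A hA hT v.2, ae_shift (ae_swap (vert _ hA.swap (swap_inv hT) v.1)) (0, v.2)]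
    with P h1 h2 i j k1 k2 k3 k4
  rw [h1 i j k1 k2 k4]
  have := h2 j i (by simpa using k4) (by simpa using k1) (by simpa using k3)
  simp only [mem_preimage, Prod.swap_swap, Prod.swap_prod_mk, Prod.fst_swap, Prod.snd_swap,
    Prod.fst_add, Prod.snd_add, add_zero] at this
  have e : P + (0, v.2) = (P.1, P.2 + v.2) := by ext <;> simp
  rw [e] at this
  exact this

theorem conv0 (B C : Set (ℝ × ℝ)) (hB : MeasurableSet B) (hC : MeasurableSet C)
    (h : ∀ v : ℝ × ℝ, ∀ᵐ P : ℝ × ℝ, ¬ (P ∈ B ∧ P + v ∈ C)) :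
    (∀ᵐ P : ℝ × ℝ, P ∉ B) ∨ ∀ᵐ P : ℝ × ℝ, P ∉ C := by
  have hm : MeasurableSet {x : (ℝ × ℝ) × (ℝ × ℝ) | ¬ (x.2 ∈ B ∧ x.2 + x.1 ∈ C)} :=
    ((measurable_snd hB).inter ((measurable_snd.add measurable_fst) hC)).compl
  have h2 := (Measure.ae_ae_comm (μ := volume) (ν := volume) (p := fun v P : ℝ × ℝ => ¬ (P ∈ B ∧ P + v ∈ C)) hm).1 (Eventually.of_forall h)
  by_cases hb : ∀ᵐ P : ℝ × ℝ, P ∉ B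
  · exact Or.inl hb
  · right
    obtain ⟨P, hP, hP2⟩ := (not_eventually.1 hb).and_eventually h2 |>.exists
    have := ae_shift hP2 (-P)
    filter_upwards [this] with Q hQ hQ2
    exact hQ ⟨not_not.1 hP, by simpa using hQ2⟩

theorem cell_meas (i : ℤ) : MeasurableSet {x | Cell i x} := measurableSet_Ioo

theorem cell_const (A : Set (ℝ × ℝ)) (hA : Per A) (hT : ∀ p, S.T p ∈ A ↔ p ∈ A) (i j : ℤ) :
    ∃ F : Prop, ∀ᵐ P : ℝ × ℝ, Cell i P.1 → Cell j P.2 → (P ∈ A ↔ F) := by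
  have hQ : MeasurableSet {P : ℝ × ℝ | Cell i P.1 ∧ Cell j P.2} :=
    (measurable_fst (cell_meas i)).inter (measurable_snd (cell_meas j))
  rcases conv0 ({P : ℝ × ℝ | Cell i P.1 ∧ Cell j P.2} ∩ A) ({P : ℝ × ℝ | Cell i P.1 ∧ Cell j P.2} ∩ Aᶜ)
    (hQ.inter hA.1) (hQ.inter hA.1.compl) (fun v => by
      filter_upwards [tr A hA hT v] with P hP
      rintro ⟨⟨⟨h1, h2⟩, h3⟩, ⟨h4, h5⟩, h6⟩
      exact h6 ((hP i j h1 h2 h4 h5).1 h3)) with h | h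
  · refine ⟨False, ?_⟩
    filter_upwards [h] with P hP h1 h2
    exact iff_false_intro fun h3 => hP ⟨⟨h1, h2⟩, h3⟩
  · refine ⟨True, ?_⟩
    filter_upwards [h] with P hP h1 h2
    exact iff_true_intro (by_contra fun h3 => hP ⟨⟨h1, h2⟩, h3⟩)

theorem T_qmp : Measure.QuasiMeasurePreserving S.T (volume : Measure (ℝ × ℝ)) volume := by
  have h1 : MeasurePreserving (fun p : ℝ × ℝ => (p.1, S.φ p.1 - p.2))
      ((volume : Measure ℝ).prod volume) ((volume : Measure ℝ).prod volume) :=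
    (MeasurePreserving.id volume).skew_product (g := fun a b => S.φ a - b)
      ((S.meas.comp measurable_fst).sub measurable_snd)
      (Eventually.of_forall fun a => (Measure.measurePreserving_sub_left volume (S.φ a)).map_eq)
  exact (h1.comp (Measure.measurePreserving_swap (μ := (volume : Measure ℝ))
    (ν := (volume : Measure ℝ)))).quasiMeasurePreserving

theorem ex_nonint (S : Sys) (j : ℤ) : ∃ y, Cell j y ∧ ∀ m : ℤ, S.φ y ≠ m := by
  have hA := S.A_ge
  have hh : 1 / (2 * S.A) ≤ 1 / 4 := by
    apply one_div_le_one_div_of_le <;> linarith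
  have h0 : 0 < 1 / (2 * S.A) := by positivity
  have c1 : Cell j (j + 1 / 2) := ⟨by linarith, by linarith⟩
  have c2 : Cell j (j + 1 / 2 + 1 / (2 * S.A)) := ⟨by linarith, by linarith⟩
  by_contra! hne
  obtain ⟨m1, h1⟩ := hne _ c1
  obtain ⟨m2, h2⟩ := hne _ c2
  rw [S.φ_eq j _ c1.1 c1.2] at h1
  rw [S.φ_eq j _ c2.1 c2.2] at h2
  obtain ⟨m, k1, k2, k3, -⟩ := S.bb_diff j (j + 1 / 2) (j + 1 / 2 + 1 / (2 * S.A))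
  rw [h1, h2] at k3
  have k4 : (m1:ℝ) - m2 = m * (1 / (2 * S.A)) := by rw [k3]; ring
  have k5 : 0 < m * (1 / (2 * S.A)) := by positivity
  have k6 : m * (1 / (2 * S.A)) ≤ 1 / 2 := by
    calc m * (1 / (2 * S.A)) ≤ S.A * (1 / (2 * S.A)) := by gcongr
      _ = 1 / 2 := by field_simp
  have a1 : (0:ℝ) < ((m1 - m2 : ℤ) : ℝ) := by push_cast; linarith
  have a2 : ((m1 - m2 : ℤ) : ℝ) < 1 := by push_cast; linarith
  norm_cast at a1 a2
  omega

theorem main (A : Set (ℝ × ℝ)) (hA : Per A) (hT : ∀ p, S.T p ∈ A ↔ p ∈ A) :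
    (∀ᵐ P : ℝ × ℝ, P ∈ A) ∨ ∀ᵐ P : ℝ × ℝ, P ∉ A := by
  choose F hF using fun i j => cell_const A hA hT i j
  have hF' : ∀ᵐ P : ℝ × ℝ, ∀ i j : ℤ, Cell i P.1 → Cell j P.2 → (P ∈ A ↔ F i j) :=
    ae_all_iff.2 fun i => ae_all_iff.2 fun j => hF i j
  have hd : ∀ᵐ P : ℝ × ℝ, ∀ i j l : ℤ, Cell i P.1 → Cell j P.2 → Cell l (S.φ P.2 - P.1) →
      (F i j ↔ F j l) := by
    filter_upwards [hF', T_qmp.ae hF'] with P h1 h2 i j l k1 k2 k3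
    rw [← h1 i j k1 k2, ← h2 j l k2 k3, hT]
  have hden := Measure.dense_of_ae hd
  have step : ∀ (i j l : ℤ) (x y : ℝ), Cell i x → Cell j y → Cell l (S.φ y - x) →
      (F i j ↔ F j l) := by
    intro i j l x y h1 h2 h3
    have hcont : ContinuousAt (fun P : ℝ × ℝ => S.φ P.2 - P.1) (x, y) :=
      (ContinuousAt.comp (f := Prod.snd) (S.φ_contAt j y h2.1 h2.2) continuousAt_snd).sub continuousAt_fst
    have n1 : ∀ᶠ P : ℝ × ℝ in nhds (x, y), Cell i P.1 :=
      continuousAt_fst.eventually (Ioo_mem_nhds h1.1 h1.2)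
    have n2 : ∀ᶠ P : ℝ × ℝ in nhds (x, y), Cell j P.2 :=
      continuousAt_snd.eventually (Ioo_mem_nhds h2.1 h2.2)
    have n3 : ∀ᶠ P : ℝ × ℝ in nhds (x, y), Cell l (S.φ P.2 - P.1) :=
      hcont.eventually (Ioo_mem_nhds h3.1 h3.2)
    obtain ⟨P, hP, hP2⟩ := mem_closure_iff_nhds.1 (hden (x, y)) _ (n1.and (n2.and n3))
    exact hP2 i j l hP.1 hP.2.1 hP.2.2
  choose y hy hy2 using ex_nonint S
  have st : ∀ i j : ℤ, (F i j ↔ F j (⌊S.φ (y j)⌋ - i)) ∧ (F i j ↔ F j (⌊S.φ (y j)⌋ - i - 1)) := by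
    intro i j
    have f0 : 0 < Int.fract (S.φ (y j)) := by
      refine lt_of_le_of_ne (Int.fract_nonneg _) fun h => ?_
      obtain ⟨z, hz⟩ := Int.fract_eq_zero_iff.1 h.symm
      exact hy2 j z hz.symm
    have f1 := Int.fract_lt_one (S.φ (y j))
    have ff := Int.floor_add_fract (S.φ (y j))
    constructor
    · refine step i j _ (i + Int.fract (S.φ (y j)) / 2) (y j) ⟨by linarith, by linarith⟩ (hy j)
        ⟨?_, ?_⟩ <;> push_cast <;> linarith
    · refine step i j _ (i + (Int.fract (S.φ (y j)) + 1) / 2) (y j) ⟨by linarith, by linarith⟩ (hy j)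
        ⟨?_, ?_⟩ <;> push_cast <;> linarith
  have s1 : ∀ j l : ℤ, F j l ↔ F j (l - 1) := by
    intro j l
    have := st (⌊S.φ (y j)⌋ - l) j
    rw [sub_sub_cancel] at this
    exact this.1.symm.trans this.2
  have s2 : ∀ j l : ℤ, F j l ↔ F j 0 := by
    intro j l
    induction l using Int.induction_on with
    | zero => rfl
    | succ n ih => rw [s1, add_sub_cancel_right]; exact ih
    | pred n ih => rw [← s1]; exact ih
  have s3 : ∀ i j : ℤ, F i j ↔ F 0 0 := by
    intro i j
    rw [s2 i j, ← s2 i 0, (st i 0).1, s2]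
  have ni : ∀ᵐ P : ℝ × ℝ, NI P.1 ∧ NI P.2 := by
    have h0 : ∀ᵐ x : ℝ, NI x :=
      ((countable_range (fun m : ℤ => (m:ℝ))).ae_notMem volume).mono fun x hx m e => hx ⟨m, e.symm⟩
    exact (Measure.quasiMeasurePreserving_fst.ae h0).and (Measure.quasiMeasurePreserving_snd.ae h0)
  by_cases h : F 0 0
  · left
    filter_upwards [hF', ni] with P h1 h2
    exact (h1 _ _ h2.1.cell h2.2.cell).2 ((s3 _ _).2 h)
  · right
    filter_upwards [hF', ni] with P h1 h2
    exact fun h3 => h ((s3 _ _).1 ((h1 _ _ h2.1.cell h2.2.cell).1 h3))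

end BB


namespace BB

theorem mk_sys (f : ℝ → ℝ) (g : ℝ) (hg : 0 < g)
    (hreg : ∃ F : ℝ → ℝ, ContDiffOn ℝ 3 F (Set.Icc (0 : ℝ) 1) ∧
      (∀ t ∈ Set.Ioo (0 : ℝ) 1, f t = F t))
    (hneg : ∀ t ∈ Set.Ioo (0 : ℝ) 1, deriv (deriv f) t < -g) :
    ∃ S : Sys, S.φ = fun x => 2 * x + 4 / g * deriv f (Int.fract x) := by
  obtain ⟨F, hF, hfF⟩ := hreg
  set I := Icc (0:ℝ) 1 with hI
  have hU : UniqueDiffOn ℝ I := uniqueDiffOn_Icc one_pos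
  set D1 := derivWithin F I with hD1
  set D2 := derivWithin D1 I with hD2
  have c1 : ContDiffOn ℝ 2 D1 I := hF.derivWithin hU (by norm_num)
  have c2 : ContDiffOn ℝ 1 D2 I := c1.derivWithin hU (by norm_num)
  have c3 : ContinuousOn (derivWithin D2 I) I := c2.continuousOn_derivWithin hU le_rfl
  have nh : ∀ t ∈ Ioo (0:ℝ) 1, I ∈ nhds t := fun t ht => Icc_mem_nhds ht.1 ht.2
  have d1 : ∀ t ∈ Ioo (0:ℝ) 1, deriv f t = D1 t := by
    intro t ht
    have : f =ᶠ[nhds t] F := by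
      filter_upwards [Ioo_mem_nhds ht.1 ht.2] with x hx using hfF x hx
    rw [this.deriv_eq, hD1, derivWithin_of_mem_nhds (nh t ht)]
  have d2 : ∀ t ∈ Ioo (0:ℝ) 1, deriv (deriv f) t = D2 t := by
    intro t ht
    have : deriv f =ᶠ[nhds t] D1 := by
      filter_upwards [Ioo_mem_nhds ht.1 ht.2] with x hx using d1 x hx
    rw [this.deriv_eq, hD2, derivWithin_of_mem_nhds (nh t ht)]
  have hd : ∀ t ∈ Ioo (0:ℝ) 1, HasDerivAt D1 (D2 t) t := fun t ht =>
    ((c1.differentiableOn (by norm_num) t ⟨ht.1.le, ht.2.le⟩).hasDerivWithinAt).hasDerivAt (nh t ht)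
  have hlt : ∀ t ∈ Ioo (0:ℝ) 1, D2 t < -g := fun t ht => d2 t ht ▸ hneg t ht
  have hle : ∀ t ∈ I, D2 t ≤ -g := by
    have hcl : closure (Ioo (0:ℝ) 1) = I := closure_Ioo (by norm_num)
    intro t ht
    rw [← hcl] at ht
    exact ContinuousWithinAt.closure_le ht ((c2.continuousOn t (hcl ▸ ht)).mono Ioo_subset_Icc_self)
      continuousWithinAt_const fun y hy => (hlt y hy).le
  obtain ⟨C, hC⟩ := isCompact_Icc.exists_bound_of_continuousOn c3
  obtain ⟨M, hM⟩ := isCompact_Icc.exists_bound_of_continuousOn c2.continuousOn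
  have hC0 : 0 ≤ C := (norm_nonneg _).trans (hC 0 (by simp))
  have hL : ∀ x ∈ I, ∀ y ∈ I, |D2 x - D2 y| ≤ C * |x - y| := by
    intro x hx y hy
    exact (convex_Icc (0:ℝ) 1).norm_image_sub_le_of_norm_derivWithin_le
      (c2.differentiableOn (by norm_num)) hC hy hx
  set k : ℝ → ℝ := fun x => max 0 (min x 1) with hk
  have kI : ∀ x, k x ∈ I := fun x => ⟨le_max_left _ _, max_le zero_le_one (min_le_right _ _)⟩
  have kid : ∀ x ∈ I, k x = x := fun x hx => by
    show max 0 (min x 1) = x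
    rw [min_eq_left hx.2, max_eq_right hx.1]
  have kc : Continuous k := by fun_prop
  have kl : ∀ x y, |k x - k y| ≤ |x - y| := fun x y =>
    by
    have h1 := abs_max_sub_max_le_max 0 (min x 1) 0 (min y 1)
    have h2 := abs_min_sub_min_le_max x 1 y 1
    simp only [sub_self, abs_zero, abs_nonneg, max_eq_left, max_eq_right] at h1 h2
    exact h1.trans h2
  set α : ℝ → ℝ := fun x => -(2 + 4 / g * D2 (k x)) with hα
  have αc : Continuous α := by
    have : Continuous fun x => D2 (k x) := c2.continuousOn.comp_continuous kc kI
    exact (continuous_const.add (continuous_const.mul this)).neg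
  have hg4 : 4 / g * g = 4 := by field_simp
  have hg0 : 0 < 4 / g := by positivity
  set h : ℝ → ℝ := fun x => 2 * x + 4 / g * D1 x with hh
  have hcont : ContinuousOn h I :=
    (continuousOn_const.mul continuousOn_id).add (continuousOn_const.mul c1.continuousOn)
  have hder : ∀ x ∈ Ioo (0:ℝ) 1, HasDerivAt h (-α x) x := by
    intro x hx
    have := ((hasDerivAt_id x).const_mul 2).add ((hd x hx).const_mul (4 / g))
    have e : -α x = 2 * 1 + 4 / g * D2 x := by
      show - -(2 + 4 / g * D2 (k x)) = _
      rw [kid x ⟨hx.1.le, hx.2.le⟩]; ring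
    rw [e]; exact this
  set β : ℝ → ℝ := fun x => h 0 + ∫ y in (0:ℝ)..x, -α y with hβ
  refine ⟨⟨fun x => 2 * x + 4 / g * deriv f (Int.fract x), β, α, 2 + 4 / g * M, 4 / g * C, ?_, ?_, ?_,
    ?_, ?_, ?_, ?_, ?_⟩, rfl⟩
  · exact (measurable_const.mul measurable_id).add
      (measurable_const.mul ((measurable_deriv f).comp measurable_fract))
  · intro x
    show 2 * (x + 1) + 4 / g * deriv f (Int.fract (x + 1)) = _
    rw [Int.fract_add_one]; ring
  · intro x x0 x1
    have e : Int.fract x = x := Int.fract_eq_self.2 ⟨x0.le, x1⟩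
    show 2 * x + 4 / g * deriv f (Int.fract x) = h 0 + ∫ y in (0:ℝ)..x, -α y
    rw [e, d1 x ⟨x0, x1⟩, intervalIntegral.integral_eq_sub_of_hasDerivAt_of_le x0.le
      (hcont.mono (Icc_subset_Icc le_rfl x1.le))
      (fun y hy => hder y ⟨hy.1, hy.2.trans x1⟩) (αc.neg.intervalIntegrable _ _)]
    ring
  · intro x
    exact (αc.neg.integral_hasStrictDerivAt 0 x).hasDerivAt.const_add _
  · intro x
    have := mul_le_mul_of_nonneg_left (hle _ (kI x)) hg0.le
    show 2 ≤ -(2 + 4 / g * D2 (k x))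
    linarith
  · intro x
    have h1 := (abs_le.1 (hM _ (kI x))).1
    have := mul_le_mul_of_nonneg_left h1 hg0.le
    show -(2 + 4 / g * D2 (k x)) ≤ _
    linarith
  · intro x y
    have e : α x - α y = -(4 / g * (D2 (k x) - D2 (k y))) := by simp only [hα]; ring
    rw [e, abs_neg, abs_mul, abs_of_pos hg0, mul_assoc]
    exact mul_le_mul_of_nonneg_left ((hL _ (kI x) _ (kI y)).trans
      (mul_le_mul_of_nonneg_left (kl x y) hC0)) hg0.le
  · intro c c0 c1
    obtain ⟨z, hz, hz2⟩ := (isCompact_Icc (a := c) (b := 1 - c)).exists_isMinOn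
      (nonempty_Icc.2 (by linarith)) αc.continuousOn
    have hz3 : 2 < α z := by
      have zi : z ∈ Ioo (0:ℝ) 1 := ⟨by linarith [hz.1], by linarith [hz.2]⟩
      have := mul_lt_mul_of_pos_left (hlt z zi) hg0
      show 2 < -(2 + 4 / g * D2 (k z))
      rw [kid z ⟨zi.1.le, zi.2.le⟩]
      linarith
    refine ⟨α z - 2, by linarith, fun x h1 h2 => ?_⟩
    have := isMinOn_iff.1 hz2 x ⟨h1, h2⟩
    linarith

noncomputable def Φ (g : ℝ) (p : ℝ × ℝ) : ℝ × ℝ := (Int.fract p.1, g * Int.fract ((p.2 - p.1) / 2))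

theorem Φ_conj (f : ℝ → ℝ) (g : ℝ) (hg : 0 < g) (S : Sys)
    (hS : S.φ = fun x => 2 * x + 4 / g * deriv f (Int.fract x)) (p : ℝ × ℝ) :
    limitTorusMap f g (Φ g p) = Φ g (S.T p) := by
  have e1 : Int.fract ((Φ g p).1 + 2 * (Φ g p).2 / g) = Int.fract p.2 := by
    rw [Int.fract_eq_fract]
    refine ⟨-⌊p.1⌋ - 2 * ⌊(p.2 - p.1) / 2⌋, ?_⟩
    unfold Φ Int.fract
    push_cast; field_simp; ring
  have e2 : Int.fract (((Φ g p).2 + 2 * deriv f (Int.fract p.2)) / g) =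
      Int.fract ((S.φ p.2 - p.1 - p.2) / 2) := by
    rw [hS, Int.fract_eq_fract]
    refine ⟨-⌊(p.2 - p.1) / 2⌋, ?_⟩
    simp only [Φ]
    rw [← Int.self_sub_floor ((p.2 - p.1) / 2)]
    push_cast; field_simp; ring
  unfold limitTorusMap
  rw [e1, e2]
  rfl

theorem map_fract : MeasurePreserving (Int.fract : ℝ → ℝ) (volume.restrict I2)
    ((2 : ENNReal) • volume.restrict (Ico (0:ℝ) 1)) := by
  refine ⟨measurable_fract, ?_⟩
  ext s hs
  have ht : MeasurableSet ((Int.fract : ℝ → ℝ) ⁻¹' s) := measurable_fract hs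
  rw [Measure.map_apply measurable_fract hs, Measure.restrict_apply ht, Measure.smul_apply,
    Measure.restrict_apply hs, smul_eq_mul]
  have e : I2 = Ico (0:ℝ) 1 ∪ Ico 1 2 := (Ico_union_Ico_eq_Ico (by norm_num) (by norm_num)).symm
  have h1 : (Int.fract : ℝ → ℝ) ⁻¹' s ∩ Ico 0 1 = s ∩ Ico 0 1 := by
    ext x
    simp only [mem_inter_iff, mem_preimage]
    refine and_congr_left fun hx => ?_
    rw [Int.fract_eq_self.2 ⟨hx.1, hx.2⟩]
  have h2 : (Int.fract : ℝ → ℝ) ⁻¹' s ∩ Ico 1 2 = (fun x => x + -1) ⁻¹' (s ∩ Ico 0 1) := by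
    rw [← h1]
    ext x
    simp only [mem_inter_iff, mem_preimage]
    rw [← sub_eq_add_neg, Int.fract_sub_one]
    refine and_congr_right fun _ => ?_
    simp only [mem_Ico]
    constructor <;> rintro ⟨h, h'⟩ <;> constructor <;> linarith
  have hdis : Disjoint (Ico (0:ℝ) 1) (Ico 1 2) := by
    rw [Set.disjoint_left]; rintro x h h'; exact absurd h.2 (not_lt.2 h'.1)
  rw [e, inter_union_distrib_left, measure_union (hdis.mono inter_subset_right inter_subset_right)
    (ht.inter measurableSet_Ico), h1, h2, measure_preimage_add_right, two_mul]

theorem map_v (g : ℝ) (hg : 0 < g) (a : ℝ) :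
    Measure.map (fun b => g * Int.fract ((b - a) / 2)) (volume.restrict I2) =
      ENNReal.ofReal (2 / g) • volume.restrict (Ico 0 g) := by
  have hm : ∀ a : ℝ, Measurable fun b : ℝ => g * Int.fract ((b - a) / 2) := fun a =>
    measurable_const.mul (measurable_fract.comp ((measurable_id.sub_const a).div_const 2))
  ext s hs
  rw [Measure.map_apply (hm a) hs, Measure.restrict_apply (hm a hs), Measure.smul_apply,
    Measure.restrict_apply hs, smul_eq_mul]
  have h1 := per1_add ((fun b => g * Int.fract ((b - 0) / 2)) ⁻¹' s) (hm 0 hs) (fun x n => by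
    have : (x + 2 * (n:ℝ) - 0) / 2 = (x - 0) / 2 + n := by ring
    rw [mem_preimage, mem_preimage, this, Int.fract_add_intCast]) (-a)
  have e : (fun b => g * Int.fract ((b - a) / 2)) ⁻¹' s =
      {x | x + -a ∈ (fun b => g * Int.fract ((b - 0) / 2)) ⁻¹' s} := by
    ext x; simp [sub_eq_add_neg]
  rw [e, h1]
  have e2 : (fun b => g * Int.fract ((b - 0) / 2)) ⁻¹' s ∩ I2 =
      (fun x => (g / 2) * x) ⁻¹' (s ∩ Ico 0 g) := by
    ext x
    have e3 : x ∈ I2 ↔ g / 2 * x ∈ Ico 0 g := by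
      simp only [I2, mem_Ico]
      constructor
      · rintro ⟨h, h'⟩; exact ⟨by positivity, by nlinarith⟩
      · rintro ⟨h, h'⟩; exact ⟨by by_contra! hx; nlinarith, by nlinarith⟩
    simp only [mem_inter_iff, mem_preimage]
    rw [← e3]
    refine and_congr_left fun hx => ?_
    have : Int.fract ((x - 0) / 2) = x / 2 := by
      rw [sub_zero]
      exact Int.fract_eq_self.2 ⟨by have := hx.1; positivity, by have := hx.2; linarith⟩
    rw [this]; ring_nf
  rw [e2, Real.volume_preimage_mul_left (by positivity), abs_of_pos (by positivity), inv_div]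

theorem Φ_mp (g : ℝ) (hg : 0 < g) : MeasurePreserving (Φ g) μ ((4 : ENNReal) • torusMeasure g) := by
  have h := map_fract.skew_product (μc := volume.restrict I2)
    (g := fun a b => g * Int.fract ((b - a) / 2))
    (measurable_const.mul (measurable_fract.comp ((measurable_snd.sub measurable_fst).div_const 2)))
    (Eventually.of_forall fun a => map_v g hg a)
  have e : ((2 : ENNReal) • volume.restrict (Ico (0:ℝ) 1)).prod
      (ENNReal.ofReal (2 / g) • volume.restrict (Ico 0 g)) = (4 : ENNReal) • torusMeasure g := by
    rw [Measure.prod_smul_left, Measure.prod_smul_right, Measure.prod_restrict, torusMeasure,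
      smul_smul, smul_smul, ← ENNReal.ofReal_inv_of_pos hg]
    congr 1
    rw [show (2:ENNReal) = ENNReal.ofReal 2 by simp, show (4:ENNReal) = ENNReal.ofReal 4 by simp,
      ← ENNReal.ofReal_mul (by norm_num), ← ENNReal.ofReal_mul (by norm_num)]
    congr 1; ring
  rw [← e]
  exact h

theorem Φ_per (g : ℝ) (s : Set (ℝ × ℝ)) (hs : MeasurableSet s)
    (hm : Measurable (Φ g)) : Per (Φ g ⁻¹' s) := by
  refine ⟨hm hs, fun p m n => ?_⟩
  have : Φ g (p.1 + 2 * m, p.2 + 2 * n) = Φ g p := by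
    unfold Φ
    have e1 : p.1 + 2 * (m:ℝ) = p.1 + ((2 * m : ℤ) : ℝ) := by push_cast; ring
    have e2 : (p.2 + 2 * (n:ℝ) - (p.1 + 2 * m)) / 2 = (p.2 - p.1) / 2 + ((n - m : ℤ) : ℝ) := by
      push_cast; ring
    simp only [e2]
    rw [e1, Int.fract_add_intCast, Int.fract_add_intCast]
  rw [mem_preimage, mem_preimage, this]

end BB
theorem ergodic_limitTorusMap_of_ddf_lt_neg_g (f : ℝ → ℝ) (g : ℝ) (hg : 0 < g)
    (hper : ∀ t, f (t + 1) = f t)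
    (hreg : ∃ F : ℝ → ℝ, ContDiffOn ℝ 3 F (Set.Icc (0 : ℝ) 1) ∧
      (∀ t ∈ Set.Ioo (0 : ℝ) 1, f t = F t) ∧
      derivWithin F (Set.Icc (0 : ℝ) 1) 0 ≠ derivWithin F (Set.Icc (0 : ℝ) 1) 1)
    (hneg : ∀ t ∈ Set.Ioo (0 : ℝ) 1, deriv (deriv f) t < -g) :
    Ergodic (limitTorusMap f g) (torusMeasure g) := by
  obtain ⟨F, hF1, hF2, -⟩ := hreg
  obtain ⟨S, hS⟩ := BB.mk_sys f g hg ⟨F, hF1, hF2⟩ hneg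
  have hΦ := BB.Φ_mp g hg
  have hconj := BB.Φ_conj f g hg S hS
  have hval : ∀ s, MeasurableSet s → BB.μ (BB.Φ g ⁻¹' s) = 4 * torusMeasure g s := fun s hs => by
    rw [hΦ.measure_preimage hs.nullMeasurableSet]; rfl
  have hFm : Measurable (limitTorusMap f g) := by
    have h1 : Measurable fun p : ℝ × ℝ => Int.fract (p.1 + 2 * p.2 / g) :=
      measurable_fract.comp (by fun_prop)
    exact h1.prodMk (measurable_const.mul (measurable_fract.comp
      ((measurable_snd.add (measurable_const.mul ((measurable_deriv f).comp h1))).div_const g)))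
  refine { measurable := hFm, map_eq := ?_, aeconst_set := ?_ }
  · ext s hs
    rw [Measure.map_apply hFm hs]
    have e : BB.Φ g ⁻¹' (limitTorusMap f g ⁻¹' s) = S.T ⁻¹' (BB.Φ g ⁻¹' s) := by
      ext p; simp only [mem_preimage, hconj]
    have h1 := hval _ (hFm hs)
    rw [e, (BB.Φ_per g s hs hΦ.measurable).μ_T, hval s hs] at h1
    exact ((ENNReal.mul_right_inj (by norm_num) (by norm_num)).1 h1).symm
  · intro s hs hinv
    have hμ : BB.μ ≤ volume := by rw [BB.μ_eq]; exact Measure.restrict_le_self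
    have h0 : ∀ t, MeasurableSet t → (∀ᵐ P : ℝ × ℝ, P ∉ BB.Φ g ⁻¹' t) → torusMeasure g t = 0 := by
      intro t ht h
      have h1 : volume (BB.Φ g ⁻¹' t) = 0 := by
        rw [ae_iff] at h; simp only [not_not] at h; exact h
      have h2 : BB.μ (BB.Φ g ⁻¹' t) = 0 := le_antisymm ((hμ _).trans h1.le) bot_le
      rw [hval t ht] at h2
      simpa using h2
    rw [eventuallyConst_set']
    rcases BB.main (S := S) (BB.Φ g ⁻¹' s) (BB.Φ_per g s hs hΦ.measurable) (fun p => by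
      rw [mem_preimage, mem_preimage, ← hconj, ← mem_preimage, hinv]) with h | h
    · right
      rw [ae_eq_univ]
      refine h0 _ hs.compl ?_
      filter_upwards [h] with P hP hP2
      exact hP2 hP
    · left
      rw [ae_eq_empty]
      exact h0 _ hs h
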